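/- Let ℓ ≥ 3, m = 2^ℓ − 2 and k = 2^{ℓ−2}. For every convex body K ⊆ ℝ^m with 0 ∈ int(K) there exist k pairwise distinct linear hyperplanes H_1, …, H_k in ℝ^m (hyperplanes through the origin) whose centers of mass coincide: m(H_1) = ⋯ = m(H_k). -/

import Mathlib

open MeasureTheory RealInnerProductSpace

/-- The center of mass of `K ∩ H` with respect to `(m-1)`-dimensional Hausdorff measure. -/
noncomputable def centerOfMass (m : ℕ) (K H : Set (EuclideanSpace ℝ (Fin m))) :
    EuclideanSpace ℝ (Fin m) :=
  ((μH[(m : ℝ) - 1] (K ∩ H)).toReal)⁻¹ • ∫ x in K ∩ H, x ∂(μH[(m : ℝ) - 1])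

/-- `H` is a linear hyperplane in `ℝ^m`, i.e. a hyperplane through the origin. -/
def IsLinearHyperplane {m : ℕ} (H : Set (EuclideanSpace ℝ (Fin m))) : Prop :=
  ∃ w : EuclideanSpace ℝ (Fin m), w ≠ 0 ∧ H = {x | ⟪x, w⟫ = 0}

/-- Chains with coefficients modulo 2 on a set of cells. -/
abbrev Chain (B : Type) : Type := B →₀ ZMod 2

namespace Chain

variable {A B C D V : Type}

/-- A cell, regarded as a chain. -/
noncomputable def cell (b : B) : Chain B := Finsupp.single b 1

theorem hom_ext [AddCommMonoid V] [Module (ZMod 2) V] {f g : Chain B →ₗ[ZMod 2] V}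
    (h : ∀ b, f (cell b) = g (cell b)) : f = g :=
  Finsupp.lhom_ext' fun b => LinearMap.ext_ring (h b)

/-- The linear map with prescribed values on cells. -/
noncomputable def lift [AddCommMonoid V] [Module (ZMod 2) V] (f : B → V) :
    Chain B →ₗ[ZMod 2] V :=
  Finsupp.linearCombination (ZMod 2) f

@[simp] theorem lift_cell [AddCommMonoid V] [Module (ZMod 2) V] (f : B → V) (b : B) :
    lift f (cell b) = f b := by
  simp [lift, cell]

theorem add_self [AddCommGroup V] [Module (ZMod 2) V] (x : V) : x + x = 0 := by
  rw [← two_smul (ZMod 2) x, show (2 : ZMod 2) = 0 from rfl, zero_smul]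

theorem add_self_left [AddCommGroup V] [Module (ZMod 2) V] (x y : V) : x + (x + y) = y := by
  rw [← add_assoc, add_self, zero_add]

theorem eq_of_add_eq_zero [AddCommGroup V] [Module (ZMod 2) V] {x y : V} (h : x + y = 0) :
    x = y := by
  rw [← add_zero x, ← add_self y, ← add_assoc, h, zero_add]

/-- Chains supported in a set of cells. -/
abbrev on (K : Set B) : Submodule (ZMod 2) (Chain B) := Finsupp.supported (ZMod 2) (ZMod 2) K

theorem on_eq_span (K : Set B) : on K = Submodule.span (ZMod 2) (cell '' K) :=
  Finsupp.supported_eq_span_single _ _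

theorem cell_mem_on {K : Set B} {b : B} (h : b ∈ K) : cell b ∈ on K :=
  Finsupp.single_mem_supported _ _ h

theorem mem_on_univ (x : Chain B) : x ∈ on (Set.univ : Set B) := by
  rw [on, Finsupp.supported_univ]; trivial

theorem on_mono {K L : Set B} (h : K ⊆ L) : on K ≤ on L := Finsupp.supported_mono h

theorem map_on_le {K : Set B} {f : Chain B →ₗ[ZMod 2] Chain C} {L : Set C}
    (h : ∀ b ∈ K, f (cell b) ∈ on L) {x : Chain B} (hx : x ∈ on K) : f x ∈ on L := by
  have : on K ≤ (on L).comap f := by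
    rw [on_eq_span, Submodule.span_le]
    rintro _ ⟨b, hb, rfl⟩
    exact h b hb
  exact this hx

theorem eq_on [AddCommMonoid V] [Module (ZMod 2) V] {K : Set B} {f g : Chain B →ₗ[ZMod 2] V}
    (h : ∀ b ∈ K, f (cell b) = g (cell b)) {x : Chain B} (hx : x ∈ on K) : f x = g x := by
  have : on K ≤ LinearMap.eqLocus f g := by
    rw [on_eq_span, Submodule.span_le]
    rintro _ ⟨b, hb, rfl⟩
    exact h b hb
  exact this hx

/-- The map on chains induced by a map of cells. -/
noncomputable def act (g : A → B) : Chain A →ₗ[ZMod 2] Chain B := Finsupp.lmapDomain _ _ g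

@[simp] theorem act_cell (g : A → B) (a : A) : act g (cell a) = cell (g a) := by
  simp [act, cell]

theorem act_act (g : B → C) (f : A → B) (x : Chain A) : act g (act f x) = act (g ∘ f) x :=
  (LinearMap.congr_fun (f := act g ∘ₗ act f) (hom_ext (by simp)) x)

theorem act_id (x : Chain A) : act id x = x :=
  (LinearMap.congr_fun (f := act id) (g := LinearMap.id) (hom_ext (by simp)) x)

/-- The tensor product of chains. -/
noncomputable def tens : Chain A →ₗ[ZMod 2] Chain B →ₗ[ZMod 2] Chain (A × B) :=
  (TensorProduct.mk (ZMod 2) (Chain A) (Chain B)).compr₂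
    (finsuppTensorFinsupp' (ZMod 2) A B).toLinearMap

theorem cell_tens_cell (a : A) (b : B) : tens (cell a) (cell b) = cell (a, b) := by
  simp [tens, cell]

theorem tens_hom_ext [AddCommMonoid V] [Module (ZMod 2) V] {f g : Chain (A × B) →ₗ[ZMod 2] V}
    (h : ∀ x y, f (tens x y) = g (tens x y)) : f = g :=
  hom_ext fun ⟨a, b⟩ => by rw [← cell_tens_cell, h]

/-- The linear map on a tensor product induced by a bilinear map. -/
noncomputable def tlift [AddCommMonoid V] [Module (ZMod 2) V]
    (f : Chain A →ₗ[ZMod 2] Chain B →ₗ[ZMod 2] V) : Chain (A × B) →ₗ[ZMod 2] V :=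
  (TensorProduct.lift f) ∘ₗ (finsuppTensorFinsupp' (ZMod 2) A B).symm.toLinearMap

@[simp] theorem tlift_tens [AddCommMonoid V] [Module (ZMod 2) V]
    (f : Chain A →ₗ[ZMod 2] Chain B →ₗ[ZMod 2] V) (x : Chain A) (y : Chain B) :
    tlift f (tens x y) = f x y := by
  simp [tlift, tens]

/-- The tensor product of two linear maps. -/
noncomputable def tmap (f : Chain A →ₗ[ZMod 2] Chain C) (g : Chain B →ₗ[ZMod 2] Chain D) :
    Chain (A × B) →ₗ[ZMod 2] Chain (C × D) :=
  tlift (tens.compl₁₂ f g)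

@[simp] theorem tmap_tens (f : Chain A →ₗ[ZMod 2] Chain C) (g : Chain B →ₗ[ZMod 2] Chain D)
    (x : Chain A) (y : Chain B) : tmap f g (tens x y) = tens (f x) (g y) := by
  simp [tmap]

/-- The product of two functionals. -/
noncomputable def tfun (f : Chain A →ₗ[ZMod 2] ZMod 2) (g : Chain B →ₗ[ZMod 2] ZMod 2) :
    Chain (A × B) →ₗ[ZMod 2] ZMod 2 :=
  tlift ((LinearMap.mul (ZMod 2) (ZMod 2)).compl₁₂ f g)

@[simp] theorem tfun_tens (f : Chain A →ₗ[ZMod 2] ZMod 2) (g : Chain B →ₗ[ZMod 2] ZMod 2)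
    (x : Chain A) (y : Chain B) : tfun f g (tens x y) = f x * g y := by
  simp [tfun]

@[simp] theorem act_map_tens (f : A → C) (g : B → D) (x : Chain A) (y : Chain B) :
    act (Prod.map f g) (tens x y) = tens (act f x) (act g y) := by
  rw [← tmap_tens]
  refine LinearMap.congr_fun (hom_ext ?_) _
  rintro ⟨a, b⟩
  rw [act_cell, Prod.map_apply, ← cell_tens_cell, ← cell_tens_cell, tmap_tens, act_cell, act_cell]

theorem tens_mem_on {K : Set A} {L : Set B} {x : Chain A} {y : Chain B} (hx : x ∈ on K)
    (hy : y ∈ on L) : tens x y ∈ on (K ×ˢ L) := by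
  have h1 : ∀ a ∈ K, tens (cell a) y ∈ on (K ×ˢ L) := fun a ha =>
    map_on_le (f := tens (cell a)) (fun b hb => by
      rw [cell_tens_cell]; exact cell_mem_on ⟨ha, hb⟩) hy
  exact map_on_le (f := tens.flip y) h1 hx

end Chain

section CellularTopology

open Chain

/-- An augmented cell complex with coefficients modulo 2. -/
class CellComplex (B : Type) where
  /-- the boundary operator -/
  d : Chain B →ₗ[ZMod 2] Chain B
  /-- the augmentation -/
  ε : Chain B →ₗ[ZMod 2] ZMod 2
  /-- the dimension of a cell -/
  deg : B → ℕ
  d_d : ∀ x, d (d x) = 0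
  ε_d : ∀ x, ε (d x) = 0
  d_cell : ∀ b, d (cell b) ∈ on {b' | deg b' < deg b}

namespace CellComplex

variable {A B C D : Type} [CellComplex A] [CellComplex B] [CellComplex C] [CellComplex D]

attribute [simp] d_d ε_d

noncomputable instance : CellComplex Unit where
  d := 0
  ε := lift fun _ => 1
  deg _ := 0
  d_d _ := rfl
  ε_d _ := map_zero _
  d_cell _ := Submodule.zero_mem _

/-- The boundary operator of a product. -/
noncomputable def prodD (A B : Type) [CellComplex A] [CellComplex B] :
    Chain (A × B) →ₗ[ZMod 2] Chain (A × B) := tmap d .id + tmap .id d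

noncomputable instance : CellComplex (A × B) where
  d := prodD A B
  ε := tfun ε ε
  deg b := deg b.1 + deg b.2
  d_d x := LinearMap.congr_fun (f := prodD A B ∘ₗ prodD A B) (g := 0)
    (tens_hom_ext fun x y => by simp [prodD, add_self]) x
  ε_d x := LinearMap.congr_fun (f := tfun ε ε ∘ₗ prodD A B) (g := 0)
    (tens_hom_ext fun x y => by simp [prodD]) x
  d_cell := by
    rintro ⟨a, b⟩
    rw [← cell_tens_cell, prodD, LinearMap.add_apply, tmap_tens, tmap_tens]
    refine Submodule.add_mem _ ?_ ?_
    · refine on_mono ?_ (tens_mem_on (d_cell a) (cell_mem_on (Set.mem_singleton b)))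
      rintro ⟨a', b'⟩ ⟨h, rfl⟩
      exact Nat.add_lt_add_right h _
    · refine on_mono ?_ (tens_mem_on (cell_mem_on (Set.mem_singleton a)) (d_cell b))
      rintro ⟨a', b'⟩ ⟨rfl, h⟩
      exact Nat.add_lt_add_left h _

@[simp] theorem d_tens (x : Chain A) (y : Chain B) :
    d (tens x y) = tens (d x) y + tens x (d y) := by
  change prodD A B _ = _
  simp [prodD]

@[simp] theorem ε_tens (x : Chain A) (y : Chain B) : ε (tens x y) = ε x * ε y :=
  tfun_tens _ _ _ _

theorem deg_prod (x : A × B) : deg x = deg x.1 + deg x.2 := rfl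

@[simp] theorem ε_unit (b : Unit) : ε (cell b) = 1 := lift_cell _ _

@[simp] theorem d_unit (x : Chain Unit) : d x = 0 := rfl

/-- An augmentation-preserving chain map. -/
structure IsChainMap (f : Chain A →ₗ[ZMod 2] Chain B) : Prop where
  d_map : ∀ x, d (f x) = f (d x)
  ε_map : ∀ x, ε (f x) = ε x

theorem IsChainMap.of_cell {f : Chain A →ₗ[ZMod 2] Chain B}
    (h1 : ∀ a, d (f (cell a)) = f (d (cell a))) (h2 : ∀ a, ε (f (cell a)) = ε (cell a)) :
    IsChainMap f :=
  ⟨LinearMap.congr_fun (f := d ∘ₗ f) (g := f ∘ₗ d) (hom_ext h1),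
    LinearMap.congr_fun (f := ε ∘ₗ f) (hom_ext h2)⟩

theorem IsChainMap.of_tens {f : Chain (A × B) →ₗ[ZMod 2] Chain C}
    (h1 : ∀ x y, d (f (tens x y)) = f (d (tens x y)))
    (h2 : ∀ x y, ε (f (tens x y)) = ε (tens x y)) : IsChainMap f :=
  ⟨LinearMap.congr_fun (f := d ∘ₗ f) (g := f ∘ₗ d) (tens_hom_ext h1),
    LinearMap.congr_fun (f := ε ∘ₗ f) (tens_hom_ext h2)⟩

theorem IsChainMap.id : IsChainMap (LinearMap.id : Chain A →ₗ[ZMod 2] Chain A) :=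
  ⟨fun _ => rfl, fun _ => rfl⟩

theorem IsChainMap.comp {g : Chain B →ₗ[ZMod 2] Chain C} {f : Chain A →ₗ[ZMod 2] Chain B}
    (hg : IsChainMap g) (hf : IsChainMap f) : IsChainMap (g ∘ₗ f) :=
  ⟨fun x => by simp [hg.d_map, hf.d_map], fun x => by simp [hg.ε_map, hf.ε_map]⟩

theorem IsChainMap.tmap {f : Chain A →ₗ[ZMod 2] Chain C} {g : Chain B →ₗ[ZMod 2] Chain D}
    (hf : IsChainMap f) (hg : IsChainMap g) : IsChainMap (tmap f g) :=
  .of_tens (fun x y => by simp [hf.d_map, hg.d_map]) fun x y => by simp [hf.ε_map, hg.ε_map]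

/-- A set of cells carrying an acyclic subcomplex, contracted by a map raising dimensions by at
most one. -/
def IsAcyclicOn (K : Set B) : Prop :=
  (∀ b ∈ K, d (cell b) ∈ on K) ∧ ∃ (c : Chain B →ₗ[ZMod 2] Chain B) (v : B),
    v ∈ K ∧ d (cell v) = 0 ∧ ε (cell v) = 1 ∧ deg v = 0 ∧ ∀ b ∈ K,
      c (cell b) ∈ on (K ∩ {b' | deg b' < deg b + 2}) ∧
      d (c (cell b)) + c (d (cell b)) = cell b + ε (cell b) • cell v

theorem IsAcyclicOn.prod {K : Set A} {L : Set B} (hK : IsAcyclicOn K) (hL : IsAcyclicOn L) :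
    IsAcyclicOn (K ×ˢ L) := by
  obtain ⟨hdK, c, v, hv, dv, εv, degv, hc⟩ := hK
  obtain ⟨hdL, c', v', hv', dv', εv', degv', hc'⟩ := hL
  constructor
  · rintro ⟨a, b⟩ ⟨ha, hb⟩
    rw [← cell_tens_cell, d_tens]
    exact add_mem (tens_mem_on (hdK a ha) (cell_mem_on hb))
      (tens_mem_on (cell_mem_on ha) (hdL b hb))
  · have key : ∀ x ∈ on K, d (c x) + c (d x) = x + ε x • cell v := fun x hx =>
      eq_on (f := d ∘ₗ c + c ∘ₗ d) (g := .id + (ε : Chain A →ₗ[ZMod 2] _).smulRight (cell v))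
        (fun b hb => by simpa using (hc b hb).2) hx
    refine ⟨tmap c .id + tmap ((ε : Chain A →ₗ[ZMod 2] _).smulRight (cell v)) c', (v, v'),
      ⟨hv, hv'⟩, ?_, ?_, ?_, ?_⟩
    · simp [← cell_tens_cell, dv, dv']
    · simp [← cell_tens_cell, εv, εv']
    · simp [deg_prod, degv, degv']
    · rintro ⟨a, b⟩ ⟨ha, hb⟩
      rw [← cell_tens_cell]
      constructor
      · simp only [LinearMap.add_apply, tmap_tens, LinearMap.id_apply, LinearMap.smulRight_apply]
        refine add_mem ?_ ?_
        · refine on_mono ?_ (tens_mem_on (hc a ha).1 (cell_mem_on (Set.mem_singleton b)))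
          rintro ⟨a', b'⟩ ⟨h, rfl⟩
          refine ⟨⟨h.1, hb⟩, ?_⟩
          have := h.2
          simp only [Set.mem_ofPred_eq, deg_prod] at this ⊢
          omega
        · rw [map_smul, LinearMap.smul_apply]
          refine Submodule.smul_mem _ _ (on_mono ?_ (tens_mem_on
            (cell_mem_on (Set.mem_singleton v)) (hc' b hb).1))
          rintro ⟨a', b'⟩ ⟨h', h⟩
          obtain rfl : a' = v := h'
          refine ⟨⟨hv, h.1⟩, ?_⟩
          have := h.2
          simp only [Set.mem_ofPred_eq, deg_prod, degv] at this ⊢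
          omega
      · have e1 := key _ (cell_mem_on ha)
        have e2 := (hc' b hb).2
        rw [← cell_tens_cell]
        simp only [LinearMap.add_apply, tmap_tens, LinearMap.id_apply, d_tens, map_add,
          LinearMap.smulRight_apply, map_smul, LinearMap.smul_apply, dv, map_zero,
          LinearMap.zero_apply, zero_add, ε_d, zero_smul, ε_tens]
        have e3 := congrArg (fun z => tens z (cell b)) e1
        have e4 := congrArg (fun z => ε (cell a) • tens (cell v) z) e2
        simp only [map_add, LinearMap.add_apply, map_smul, LinearMap.smul_apply, smul_add,
          smul_smul] at e3 e4
        linear_combination (norm := module) e3 + e4 + add_self (tens (c (cell a)) (d (cell b)))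
          + add_self (ε (cell a) • tens (cell v) (cell b))

theorem isAcyclicOn_unit : IsAcyclicOn (Set.univ : Set Unit) :=
  ⟨fun _ _ => mem_on_univ _, 0, (), trivial, rfl, ε_unit _, rfl, fun b _ => ⟨zero_mem _, by
    simp [add_self]⟩⟩

theorem IsAcyclicOn.solve {K : Set B} (hK : IsAcyclicOn K) {n : ℕ} {z : Chain B}
    (hz : z ∈ on (K ∩ {b | deg b < n})) (hdz : d z = 0) (hεz : ε z = 0) (a : ZMod 2) :
    ∃ w ∈ on (K ∩ {b | deg b < n + 1}), d w = z ∧ ε w = a := by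
  obtain ⟨-, c, v, hv, dv, εv, degv, hc⟩ := hK
  have key : d (c z) + c (d z) = z + ε z • cell v :=
    eq_on (f := d ∘ₗ c + c ∘ₗ d) (g := .id + (ε : Chain B →ₗ[ZMod 2] _).smulRight (cell v))
      (fun b hb => by simpa using (hc b hb).2) (on_mono Set.inter_subset_left hz)
  refine ⟨c z + (a + ε (c z)) • cell v, add_mem ?_ ?_, ?_, ?_⟩
  · refine map_on_le (fun b hb => on_mono ?_ (hc b hb.1).1) hz
    rintro b' ⟨h1, h2⟩
    refine ⟨h1, ?_⟩
    have := hb.2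
    simp only [Set.mem_ofPred_eq] at this h2 ⊢
    omega
  · exact Submodule.smul_mem _ _ (cell_mem_on ⟨hv, by simp [degv]⟩)
  · simpa [dv, hdz, hεz] using key
  · simp only [map_add, map_smul, εv, smul_eq_mul, mul_one]
    rw [add_comm a, add_self_left]

end CellComplex

open CellComplex

/-- A group action on the cells of a complex compatible with the complex structure. -/
structure CellAction (Γ B : Type) [Group Γ] [CellComplex B] where
  /-- the action on cells -/
  ρ : Γ → B → B
  one : ∀ b, ρ 1 b = b
  mul : ∀ g h b, ρ (g * h) b = ρ g (ρ h b)
  d_cell : ∀ g b, d (cell (ρ g b)) = act (ρ g) (d (cell b))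
  ε_cell : ∀ g b, ε (cell (ρ g b)) = ε (cell b)
  deg_eq : ∀ g b, deg (ρ g b) = deg b

namespace CellAction

variable {Γ A B Y : Type} [Group Γ] [CellComplex A] [CellComplex B] [CellComplex Y]

theorem d_act (α : CellAction Γ B) (g : Γ) (x : Chain B) :
    d (act (α.ρ g) x) = act (α.ρ g) (d x) :=
  LinearMap.congr_fun (f := d ∘ₗ act (α.ρ g)) (g := act (α.ρ g) ∘ₗ d)
    (hom_ext fun b => by simp [α.d_cell]) x

theorem ε_act (α : CellAction Γ B) (g : Γ) (x : Chain B) : ε (act (α.ρ g) x) = ε x :=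
  LinearMap.congr_fun (f := ε ∘ₗ act (α.ρ g)) (g := ε) (hom_ext fun b => by simp [α.ε_cell]) x

theorem act_mul (α : CellAction Γ B) (g h : Γ) (x : Chain B) :
    act (α.ρ (g * h)) x = act (α.ρ g) (act (α.ρ h) x) := by
  rw [act_act]; congr 2; funext b; exact α.mul g h b

theorem inv_cancel (α : CellAction Γ B) (g : Γ) (b : B) : α.ρ g⁻¹ (α.ρ g b) = b := by
  rw [← α.mul, inv_mul_cancel, α.one]

/-- A linear map commuting with the actions. -/
def Equivariant (α : CellAction Γ B) (β : CellAction Γ Y) (h : Chain B →ₗ[ZMod 2] Chain Y) :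
    Prop := ∀ g x, h (act (α.ρ g) x) = act (β.ρ g) (h x)

theorem Equivariant.of_cell {α : CellAction Γ B} {β : CellAction Γ Y}
    {h : Chain B →ₗ[ZMod 2] Chain Y}
    (H : ∀ g b, h (cell (α.ρ g b)) = act (β.ρ g) (h (cell b))) : Equivariant α β h := fun g =>
  LinearMap.congr_fun (f := h ∘ₗ act (α.ρ g)) (g := act (β.ρ g) ∘ₗ h)
    (hom_ext fun b => by simp [H])

theorem Equivariant.comp {α : CellAction Γ A} {β : CellAction Γ B} {γ : CellAction Γ Y}
    {g : Chain B →ₗ[ZMod 2] Chain Y} {f : Chain A →ₗ[ZMod 2] Chain B}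
    (hg : Equivariant β γ g) (hf : Equivariant α β f) : Equivariant α γ (g ∘ₗ f) := fun a x => by
  simp [hf a, hg a]

theorem exists_orbit_section (α : CellAction Γ B) :
    ∃ (rep : B → B) (γ : B → Γ), (∀ b, α.ρ (γ b) (rep b) = b) ∧ ∀ g b, rep (α.ρ g b) = rep b := by
  let _ : MulAction Γ B := { smul := α.ρ, one_smul := α.one, mul_smul := α.mul }
  let s := MulAction.orbitRel Γ B
  have h : ∀ b : B, ∃ g : Γ, α.ρ g (Quotient.out (Quotient.mk s b)) = b := fun b => by
    have : s b (Quotient.out (Quotient.mk s b)) := Quotient.exact (Quotient.out_eq _).symm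
    exact this
  choose γ hγ using h
  refine ⟨fun b => Quotient.out (Quotient.mk s b), γ, hγ, fun g b => ?_⟩
  change Quotient.out _ = Quotient.out _
  congr 1
  exact Quotient.sound ⟨g, rfl⟩

/-- The value of an equivariant solution of `∂h = h∂ + θ`, `εh = a` at a cell. -/
def IsSolutionAt (K : B → Set Y) (θ : Chain B →ₗ[ZMod 2] Chain Y) (a : Chain B →ₗ[ZMod 2] ZMod 2)
    (h : Chain B →ₗ[ZMod 2] Chain Y) (b : B) : Prop :=
  d (h (cell b)) = h (d (cell b)) + θ (cell b) ∧ ε (h (cell b)) = a (cell b) ∧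
    h (cell b) ∈ on (K b)

theorem exists_equivariant_step (α : CellAction Γ B) (β : CellAction Γ Y) {S : Set B}
    (hS : ∀ g, ∀ b ∈ S, α.ρ g b ∈ S) (free : ∀ g, ∀ b ∈ S, α.ρ g b = b → g = 1)
    (hdS : ∀ b ∈ S, d (cell b) ∈ on S) {K K' : B → Set Y}
    (hK : ∀ g, ∀ b ∈ S, ∀ y ∈ K b, β.ρ g y ∈ K (α.ρ g b))
    (hK' : ∀ b ∈ S, ∀ b' ∈ S, b' ∈ (d (cell b)).support → K b' ⊆ K' b)
    (solve : ∀ b ∈ S, ∀ z ∈ on (K' b), d z = 0 → ε z = 0 → ∀ a, ∃ w ∈ on (K b), d w = z ∧ ε w = a)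
    {θ : Chain B →ₗ[ZMod 2] Chain Y} {a : Chain B →ₗ[ZMod 2] ZMod 2}
    (hθ : Equivariant α β θ) (ha : ∀ g x, a (act (α.ρ g) x) = a x)
    (hdθ : ∀ b ∈ S, d (θ (cell b)) = θ (d (cell b))) (hεθ : ∀ b ∈ S, ε (θ (cell b)) = 0)
    (had : ∀ b ∈ S, a (d (cell b)) = 0) (hθK : ∀ b ∈ S, θ (cell b) ∈ on (K' b))
    (n : ℕ) (h : Chain B →ₗ[ZMod 2] Chain Y) (heq : Equivariant α β h)
    (hsol : ∀ b ∈ S, deg b < n → IsSolutionAt K θ a h b) :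
    ∃ h' : Chain B →ₗ[ZMod 2] Chain Y, Equivariant α β h' ∧
      (∀ b ∈ S, deg b < n + 1 → IsSolutionAt K θ a h' b) ∧
      ∀ b, deg b ≠ n → h' (cell b) = h (cell b) := by
  classical
  obtain ⟨rep, γ, hγ, hrep⟩ := α.exists_orbit_section
  have dsupp : ∀ b ∈ S, d (cell b) ∈ on {b' | b' ∈ S ∧ deg b' < deg b ∧
      b' ∈ (d (cell b)).support} := fun b hb b' hb' =>
    ⟨hdS b hb hb', CellComplex.d_cell b hb', hb'⟩
  have ex : ∀ b ∈ S, deg b = n → ∃ w ∈ on (K b), d w = h (d (cell b)) + θ (cell b) ∧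
      ε w = a (cell b) := by
    intro b hb hn
    apply solve b hb
    · refine add_mem (map_on_le (fun b' hb' => ?_) (dsupp b hb)) (hθK b hb)
      exact on_mono (hK' b hb b' hb'.1 hb'.2.2) (hsol b' hb'.1 (hn ▸ hb'.2.1)).2.2
    · have e : d (h (d (cell b))) = h (d (d (cell b))) + θ (d (cell b)) :=
        eq_on (f := d ∘ₗ h) (g := h ∘ₗ d + θ)
          (fun b' hb' => (hsol b' hb'.1 (hn ▸ hb'.2.1)).1) (dsupp b hb)
      rw [map_add, e, hdθ b hb, d_d, map_zero, zero_add, add_self]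
    · have e : ε (h (d (cell b))) = a (d (cell b)) :=
        eq_on (f := ε ∘ₗ h) (g := a)
          (fun b' hb' => (hsol b' hb'.1 (hn ▸ hb'.2.1)).2.1) (dsupp b hb)
      rw [map_add, e, had b hb, hεθ b hb, add_zero]
  choose! w hwK hwd hwε using ex
  have hrepS : ∀ b, rep b ∈ S ↔ b ∈ S := fun b =>
    ⟨fun hb => hγ b ▸ hS _ _ hb, fun hb => by
      have := hS (γ b)⁻¹ b hb
      rwa [← congrArg (α.ρ (γ b)⁻¹) (hγ b), α.inv_cancel] at this⟩
  have hrepdeg : ∀ b, deg (rep b) = deg b := fun b => by rw [← α.deg_eq (γ b), hγ]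
  let h' : Chain B →ₗ[ZMod 2] Chain Y := Chain.lift fun b =>
    if b ∈ S ∧ deg b = n then act (β.ρ (γ b)) (w (rep b)) else h (cell b)
  have h'1 : ∀ b, b ∈ S → deg b = n → h' (cell b) = act (β.ρ (γ b)) (w (rep b)) :=
    fun b h1 h2 => by simp only [h', lift_cell, h1, h2, and_self, if_true]
  have h'2 : ∀ b, ¬ (b ∈ S ∧ deg b = n) → h' (cell b) = h (cell b) :=
    fun b h1 => by simp only [h', lift_cell, h1, if_false]
  have hd : ∀ b ∈ S, deg b ≤ n → h' (d (cell b)) = h (d (cell b)) := fun b hb hn =>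
    eq_on (fun b' hb' => h'2 b' fun hh => by have := hb'.2.1; omega) (dsupp b hb)
  refine ⟨h', .of_cell fun g b => ?_, fun b hb hn => ?_, fun b hb => h'2 b fun hh => hb hh.2⟩
  · by_cases hb : b ∈ S ∧ deg b = n
    · rw [h'1 b hb.1 hb.2, h'1 _ (hS g b hb.1) (by rw [α.deg_eq, hb.2]), hrep, ← β.act_mul]
      congr 3
      refine inv_mul_eq_one.mp (free _ (rep b) ((hrepS b).2 hb.1) ?_)
      have e1 := hγ (α.ρ g b)
      have e2 := congrArg (α.ρ g) (hγ b)
      rw [hrep] at e1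
      rw [← α.mul, ← e1] at e2
      rw [α.mul, e2, α.inv_cancel]
    · have hb' : ¬ (α.ρ g b ∈ S ∧ deg (α.ρ g b) = n) := fun hh => hb
        ⟨by simpa [α.inv_cancel] using hS g⁻¹ _ hh.1, by rw [← hh.2, α.deg_eq]⟩
      rw [h'2 b hb, h'2 _ hb', ← heq, act_cell]
  · unfold IsSolutionAt
    rw [hd b hb (by omega)]
    by_cases hbn : deg b = n
    · have hr := (hrepS b).2 hb
      have hrn := (hrepdeg b).trans hbn
      rw [h'1 b hb hbn, β.d_act, hwd _ hr hrn, map_add, ← heq, ← hθ, act_cell, ← α.d_act,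
        act_cell, hγ, β.ε_act, hwε _ hr hrn]
      refine ⟨rfl, ?_, ?_⟩
      · rw [← ha (γ b), act_cell, hγ]
      · refine map_on_le (fun y hy => ?_) (hwK _ hr hrn)
        rw [act_cell]
        exact cell_mem_on (by simpa [hγ] using hK (γ b) _ hr y hy)
    · rw [h'2 b fun hh => hbn hh.2]
      exact hsol b hb (by omega)

/-- Equivariant acyclic carriers. -/
theorem exists_equivariant (α : CellAction Γ B) (β : CellAction Γ Y) {S : Set B}
    (hS : ∀ g, ∀ b ∈ S, α.ρ g b ∈ S) (free : ∀ g, ∀ b ∈ S, α.ρ g b = b → g = 1)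
    (hdS : ∀ b ∈ S, d (cell b) ∈ on S) {K K' : B → Set Y}
    (hK : ∀ g, ∀ b ∈ S, ∀ y ∈ K b, β.ρ g y ∈ K (α.ρ g b))
    (hK' : ∀ b ∈ S, ∀ b' ∈ S, b' ∈ (d (cell b)).support → K b' ⊆ K' b)
    (solve : ∀ b ∈ S, ∀ z ∈ on (K' b), d z = 0 → ε z = 0 → ∀ a, ∃ w ∈ on (K b), d w = z ∧ ε w = a)
    {θ : Chain B →ₗ[ZMod 2] Chain Y} {a : Chain B →ₗ[ZMod 2] ZMod 2}
    (hθ : Equivariant α β θ) (ha : ∀ g x, a (act (α.ρ g) x) = a x)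
    (hdθ : ∀ b ∈ S, d (θ (cell b)) = θ (d (cell b))) (hεθ : ∀ b ∈ S, ε (θ (cell b)) = 0)
    (had : ∀ b ∈ S, a (d (cell b)) = 0) (hθK : ∀ b ∈ S, θ (cell b) ∈ on (K' b)) :
    ∃ h : Chain B →ₗ[ZMod 2] Chain Y, Equivariant α β h ∧ ∀ b ∈ S, IsSolutionAt K θ a h b := by
  choose! f hf1 hf2 hf3 using
    exists_equivariant_step α β hS free hdS hK hK' solve hθ ha hdθ hεθ had hθK
  let H : ℕ → Chain B →ₗ[ZMod 2] Chain Y := fun n => Nat.rec 0 f n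
  have hH : ∀ n, H (n + 1) = f n (H n) := fun n => rfl
  have good : ∀ n, Equivariant α β (H n) ∧ ∀ b ∈ S, deg b < n → IsSolutionAt K θ a (H n) b := by
    intro n
    induction n with
    | zero => exact ⟨fun g x => by simp [H], fun b _ h => by omega⟩
    | succ n ih => rw [hH]; exact ⟨hf1 n _ ih.1 ih.2, hf2 n _ ih.1 ih.2⟩
  have stable : ∀ b n, deg b < n → H n (cell b) = H (deg b + 1) (cell b) := by
    intro b n hn
    induction n, hn using Nat.le_induction with
    | base => rfl
    | succ n hn ih => rw [hH, hf3 n _ (good n).1 (good n).2 b (by omega), ih]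
  let h : Chain B →ₗ[ZMod 2] Chain Y := Chain.lift fun b => H (deg b + 1) (cell b)
  have hh : ∀ b, h (cell b) = H (deg b + 1) (cell b) := fun b => lift_cell _ b
  refine ⟨h, .of_cell fun g b => ?_, fun b hb => ?_⟩
  · rw [hh, hh, α.deg_eq, ← act_cell]
    exact (good (deg b + 1)).1 g (cell b)
  · have e : h (d (cell b)) = H (deg b + 1) (d (cell b)) :=
      eq_on (fun b' (hb' : deg b' < deg b) => by rw [hh, stable b' (deg b + 1) (by omega)])
        (CellComplex.d_cell b)
    unfold IsSolutionAt
    rw [e, hh]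
    exact (good _).2 b hb (Nat.lt_succ_self _)

/-- Two equivariant chain maps into an acyclic complex cannot be distinguished, on a chain whose
boundary is killed by invariant functionals, by an invariant functional killing boundaries. -/
theorem functional_eq (α : CellAction Γ B) (β : CellAction Γ Y) {S : Set B}
    (hS : ∀ g, ∀ b ∈ S, α.ρ g b ∈ S) (free : ∀ g, ∀ b ∈ S, α.ρ g b = b → g = 1)
    (hdS : ∀ b ∈ S, d (cell b) ∈ on S) (hY : IsAcyclicOn (Set.univ : Set Y))
    {f f' : Chain B →ₗ[ZMod 2] Chain Y} (hf : Equivariant α β f) (hf' : Equivariant α β f')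
    (hdf : ∀ b ∈ S, d (f (cell b)) = f (d (cell b)) ∧ ε (f (cell b)) = ε (cell b))
    (hdf' : ∀ b ∈ S, d (f' (cell b)) = f' (d (cell b)) ∧ ε (f' (cell b)) = ε (cell b))
    {φ : Chain Y →ₗ[ZMod 2] ZMod 2} (hφ : ∀ g x, φ (act (β.ρ g) x) = φ x) (hφd : ∀ x, φ (d x) = 0)
    {x : Chain B} (hxS : x ∈ on S) (hx : ∀ ψ : Chain B →ₗ[ZMod 2] ZMod 2,
      (∀ g x, ψ (act (α.ρ g) x) = ψ x) → ψ (d x) = 0) :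
    φ (f x) = φ (f' x) := by
  obtain ⟨h, heq, hsol⟩ := exists_equivariant α β hS free hdS (K := fun _ => Set.univ)
    (K' := fun _ => Set.univ) (fun _ _ _ _ _ => trivial) (fun _ _ _ _ _ _ _ => trivial)
    (θ := f + f') (a := 0)
    (fun b hb z _ hdz hεz a => by
      obtain ⟨n, hn⟩ : ∃ n, z ∈ on (Set.univ ∩ {y : Y | deg y < n}) := by
        refine ⟨z.support.sup deg + 1, fun y hy => ⟨trivial, ?_⟩⟩
        exact Nat.lt_succ_of_le (Finset.le_sup (f := deg) hy)
      obtain ⟨w, -, h1, h2⟩ := hY.solve hn hdz hεz a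
      exact ⟨w, mem_on_univ w, h1, h2⟩)
    (fun g x => by simp [hf g, hf' g]) (fun _ _ => rfl)
    (fun b hb => by simp [hdf b hb, hdf' b hb]) (fun b hb => by simp [hdf b hb, hdf' b hb, add_self])
    (fun _ _ => rfl) (fun _ _ => mem_on_univ _)
  have e : d (h x) = h (d x) + (f + f') x :=
    eq_on (f := d ∘ₗ h) (g := h ∘ₗ d + (f + f')) (fun b hb => (hsol b hb).1) hxS
  have e2 := congrArg φ e
  have e3 : φ (h (d x)) = 0 := hx (φ ∘ₗ h) fun g y => by simp [heq g, hφ]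
  rw [hφd, map_add, e3, zero_add, LinearMap.add_apply, map_add] at e2
  exact eq_of_add_eq_zero e2.symm

end CellAction

/-- Powers of a type, as iterated products. -/
def Pw (α : Type) : ℕ → Type
  | 0 => Unit
  | n + 1 => α × Pw α n

/-- Perfect binary trees of depth `r` with labels in `α`. -/
def Tr (α : Type) : ℕ → Type
  | 0 => Unit
  | r + 1 => α × Tr α r × Tr α r

/-- The action of a sign. -/
def sg {α : Type} [InvolutiveNeg α] (s : ℤˣ) (x : α) : α := if s = 1 then x else -x

@[simp] theorem sg_one {α : Type} [InvolutiveNeg α] (x : α) : sg 1 x = x := if_pos rfl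

@[simp] theorem sg_neg_one {α : Type} [InvolutiveNeg α] (x : α) : sg (-1) x = -x :=
  if_neg (by decide)

theorem sg_mul {α : Type} [InvolutiveNeg α] (s t : ℤˣ) (x : α) : sg (s * t) x = sg s (sg t x) := by
  rcases Int.units_eq_one_or s with rfl | rfl <;> rcases Int.units_eq_one_or t with rfl | rfl <;>
    simp

section Neg

variable {α : Type} [InvolutiveNeg α]

instance : InvolutiveNeg Unit where
  neg := id
  neg_neg _ := rfl

instance Pw.instInvolutiveNeg : ∀ n, InvolutiveNeg (Pw α n)
  | 0 => inferInstanceAs (InvolutiveNeg Unit)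
  | n + 1 => let _ := Pw.instInvolutiveNeg n; inferInstanceAs (InvolutiveNeg (α × Pw α n))

instance Tr.instInvolutiveNeg : ∀ r, InvolutiveNeg (Tr α r)
  | 0 => inferInstanceAs (InvolutiveNeg Unit)
  | r + 1 => let _ := Tr.instInvolutiveNeg r; inferInstanceAs (InvolutiveNeg (α × Tr α r × Tr α r))

theorem Tr.neg_mk {r : ℕ} (x : α) (t u : Tr α r) :
    -(show Tr α (r + 1) from (x, t, u)) = (-x, -t, -u) := rfl

end Neg

/-- The wreath product of a group with the group of signs. -/
def Wr (G : Type) : Type := ℤˣ × G × G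

namespace Wr

variable {G : Type} [Group G]

instance : Mul (Wr G) where
  mul g h := (g.1 * h.1, if g.1 = 1 then g.2.1 * h.2.1 else g.2.1 * h.2.2,
    if g.1 = 1 then g.2.2 * h.2.2 else g.2.2 * h.2.1)

instance : One (Wr G) := ⟨((1 : ℤˣ), (1 : G), (1 : G))⟩

instance : Inv (Wr G) where
  inv g := (g.1, if g.1 = 1 then g.2.1⁻¹ else g.2.2⁻¹, if g.1 = 1 then g.2.2⁻¹ else g.2.1⁻¹)

end Wr

namespace Wr

/-- An element of the wreath product. -/
def mk {G : Type} (s : ℤˣ) (a b : G) : Wr G := (s, a, b)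

theorem cases {G : Type} (g : Wr G) : ∃ a b, g = mk 1 a b ∨ g = mk (-1) a b := by
  obtain ⟨s, a, b⟩ := g
  rcases Int.units_eq_one_or s with rfl | rfl
  · exact ⟨a, b, .inl rfl⟩
  · exact ⟨a, b, .inr rfl⟩

variable {G : Type} [Group G]

theorem mk_one_mul (s : ℤˣ) (a b a' b' : G) : mk 1 a b * mk s a' b' = mk s (a * a') (b * b') := by
  change (1 * s, _, _) = _
  rw [one_mul]
  rfl

theorem mk_neg_one_mul (s : ℤˣ) (a b a' b' : G) :
    mk (-1) a b * mk s a' b' = mk (-s) (a * b') (b * a') := by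
  change (-1 * s, _, _) = _
  rw [neg_one_mul]
  rfl

theorem one_def : (1 : Wr G) = mk 1 1 1 := rfl

theorem inv_one_mk (a b : G) : (mk 1 a b)⁻¹ = mk 1 a⁻¹ b⁻¹ := rfl

theorem inv_neg_one_mk (a b : G) : (mk (-1) a b)⁻¹ = mk (-1) b⁻¹ a⁻¹ := rfl

instance instGroup : Group (Wr G) :=
  Group.ofLeftAxioms
    (fun x y z => by
      obtain ⟨a, b, rfl | rfl⟩ := cases x <;> obtain ⟨a', b', rfl | rfl⟩ := cases y <;>
        obtain ⟨a'', b'', rfl | rfl⟩ := cases z <;>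
        simp [mk_one_mul, mk_neg_one_mul, mul_assoc])
    (fun x => by
      obtain ⟨a, b, rfl | rfl⟩ := cases x <;> simp [one_def, mk_one_mul])
    (fun x => by
      obtain ⟨a, b, rfl | rfl⟩ := cases x <;>
        simp [one_def, mk_one_mul, mk_neg_one_mul, inv_one_mk, inv_neg_one_mk])

end Wr

/-- The iterated wreath product acting on binary trees. -/
def W : ℕ → Type
  | 0 => Unit
  | r + 1 => Wr (W r)

instance W.instGroup : ∀ r, Group (W r)
  | 0 => inferInstanceAs (Group Unit)
  | r + 1 => @Wr.instGroup (W r) (W.instGroup r)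

namespace Tr

variable {α β : Type} [InvolutiveNeg α] [InvolutiveNeg β]

/-- The action of the iterated wreath product on trees: a sign at a node negates the label and,
if nontrivial, swaps the two subtrees. -/
def ρ : ∀ r, W r → Tr α r → Tr α r
  | 0, _, t => t
  | r + 1, (s, a, b), (x, t, u) =>
    (sg s x, if s = 1 then ρ r a t else ρ r a u, if s = 1 then ρ r b u else ρ r b t)

theorem ρ_mk_one {r : ℕ} (a b : W r) (x : α) (t u : Tr α r) :
    ρ (r + 1) (Wr.mk 1 a b) (x, t, u) = (x, ρ r a t, ρ r b u) := by
  simp [ρ, Wr.mk]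
  rfl

theorem ρ_mk_neg_one {r : ℕ} (a b : W r) (x : α) (t u : Tr α r) :
    ρ (r + 1) (Wr.mk (-1) a b) (x, t, u) = (-x, ρ r a u, ρ r b t) := by
  simp [ρ, Wr.mk]
  rfl

theorem ρ_one : ∀ r (t : Tr α r), ρ r 1 t = t
  | 0, _ => rfl
  | r + 1, (x, t, u) => by
    change ρ (r + 1) (Wr.mk 1 1 1) (x, t, u) = _
    rw [ρ_mk_one, ρ_one r, ρ_one r]

theorem ρ_mul : ∀ r (g h : W r) (t : Tr α r), ρ r (g * h) t = ρ r g (ρ r h t)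
  | 0, _, _, _ => rfl
  | r + 1, g, h, (x, t, u) => by
    change Wr (W r) at g h
    change ρ (r + 1) (HMul.hMul (α := Wr (W r)) g h) _ = _
    obtain ⟨a, b, rfl | rfl⟩ := Wr.cases g <;> obtain ⟨a', b', rfl | rfl⟩ := Wr.cases h <;>
      simp only [Wr.mk_one_mul, Wr.mk_neg_one_mul, ρ_mk_one, ρ_mk_neg_one, ρ_mul r, neg_neg] <;> rfl

theorem ρ_neg : ∀ r (g : W r) (t : Tr α r), ρ r g (-t) = -ρ r g t
  | 0, _, _ => rfl
  | r + 1, g, (x, t, u) => by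
    change Wr (W r) at g
    obtain ⟨a, b, rfl | rfl⟩ := Wr.cases g <;>
      simp only [Tr.neg_mk, ρ_mk_one, ρ_mk_neg_one, ρ_neg r] <;> rfl

/-- All labels of a tree satisfy a predicate. -/
def All (P : α → Prop) : ∀ r, Tr α r → Prop
  | 0, _ => True
  | r + 1, (x, t, u) => P x ∧ All P r t ∧ All P r u

theorem all_ρ {P : α → Prop} (hP : ∀ x, P x → P (-x)) :
    ∀ r (g : W r) (t : Tr α r), All P r t → All P r (ρ r g t)
  | 0, _, _, _ => trivial
  | r + 1, g, (x, t, u), ⟨h, h1, h2⟩ => by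
    change Wr (W r) at g
    obtain ⟨a, b, rfl | rfl⟩ := Wr.cases g
    · rw [ρ_mk_one]; exact ⟨h, all_ρ hP r _ _ h1, all_ρ hP r _ _ h2⟩
    · rw [ρ_mk_neg_one]; exact ⟨hP _ h, all_ρ hP r _ _ h2, all_ρ hP r _ _ h1⟩

theorem all_neg {P : α → Prop} (hP : ∀ x, P x → P (-x)) :
    ∀ r (t : Tr α r), All P r t → All P r (-t)
  | 0, _, _ => trivial
  | r + 1, (_, _, _), ⟨h, h1, h2⟩ => ⟨hP _ h, all_neg hP r _ h1, all_neg hP r _ h2⟩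

theorem ρ_free {P : α → Prop} (hP : ∀ x, P x → -x ≠ x) :
    ∀ r (g : W r) (t : Tr α r), All P r t → ρ r g t = t → g = 1
  | 0, _, _, _, _ => rfl
  | r + 1, g, (x, t, u), ⟨h, h1, h2⟩, e => by
    change Wr (W r) at g
    obtain ⟨a, b, rfl | rfl⟩ := Wr.cases g
    · rw [ρ_mk_one] at e
      have e2 := congrArg Prod.snd e
      rw [ρ_free hP r a t h1 (congrArg Prod.fst e2), ρ_free hP r b u h2 (congrArg Prod.snd e2)]
      rfl
    · rw [ρ_mk_neg_one] at e
      exact absurd (congrArg Prod.fst e) (hP x h)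

/-- The tree all of whose labels are equal. -/
def const (x : α) : ∀ r, Tr α r
  | 0 => ()
  | r + 1 => (x, const x r, const x r)

theorem exists_ρ_const (x : α) : ∀ r, ∃ g : W r, ρ r g (const x r) = -const x r
  | 0 => ⟨1, rfl⟩
  | r + 1 => by
    obtain ⟨g, hg⟩ := exists_ρ_const x r
    refine ⟨Wr.mk (-1) g g, ?_⟩
    rw [const, ρ_mk_neg_one, hg]
    rfl

end Tr

/-- A cell complex with an antipodal symmetry. -/
class SymmComplex (B : Type) [CellComplex B] [InvolutiveNeg B] : Prop where
  d_neg : ∀ b : B, d (cell (-b)) = act Neg.neg (d (cell b))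
  ε_neg : ∀ b : B, ε (cell (-b)) = ε (cell b)
  deg_neg : ∀ b : B, deg (-b) = deg b

section Swap

variable {A B C : Type} [CellComplex A] [CellComplex B] [CellComplex C]

@[simp] theorem act_swap_tens (x : Chain A) (y : Chain B) :
    act Prod.swap (tens x y) = tens y x := by
  have h : (tens (A := A) (B := B)).compr₂ (act Prod.swap) = tens.flip :=
    hom_ext fun a => hom_ext fun b => by simp [cell_tens_cell]
  exact LinearMap.congr_fun (LinearMap.congr_fun h x) y

theorem d_act_prod {f : A → A} {g : B → B} (hf : ∀ a, d (cell (f a)) = act f (d (cell a)))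
    (hg : ∀ b, d (cell (g b)) = act g (d (cell b))) (x : A × B) :
    d (cell (Prod.map f g x)) = act (Prod.map f g) (d (cell x)) := by
  obtain ⟨a, b⟩ := x
  simp [Prod.map_apply, ← cell_tens_cell, hf, hg]

theorem d_swap (x : A × B) : d (cell x.swap) = act Prod.swap (d (cell x)) := by
  obtain ⟨a, b⟩ := x
  simp [← cell_tens_cell, add_comm]

theorem ε_prod_map {f : A → A} {g : B → B} (hf : ∀ a, ε (cell (f a)) = ε (cell a))
    (hg : ∀ b, ε (cell (g b)) = ε (cell b)) (x : A × B) :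
    ε (cell (Prod.map f g x)) = ε (cell x) := by
  obtain ⟨a, b⟩ := x
  simp [Prod.map_apply, ← cell_tens_cell, hf, hg]

theorem ε_swap (x : A × B) : ε (cell x.swap) = ε (cell x) := by
  obtain ⟨a, b⟩ := x
  simp [← cell_tens_cell, mul_comm]

variable [InvolutiveNeg A] [InvolutiveNeg B] [SymmComplex A] [SymmComplex B]

instance : SymmComplex Unit := ⟨fun _ => by simp, fun _ => rfl, fun _ => rfl⟩

instance : SymmComplex (A × B) where
  d_neg := d_act_prod SymmComplex.d_neg SymmComplex.d_neg
  ε_neg := ε_prod_map SymmComplex.ε_neg SymmComplex.ε_neg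
  deg_neg b := congrArg₂ (· + ·) (SymmComplex.deg_neg b.1) (SymmComplex.deg_neg b.2)

end Swap

section Iterated

variable {α : Type} [CellComplex α]

noncomputable instance Pw.instCellComplex : ∀ n, CellComplex (Pw α n)
  | 0 => inferInstanceAs (CellComplex Unit)
  | n + 1 => let _ := Pw.instCellComplex n; inferInstanceAs (CellComplex (α × Pw α n))

noncomputable instance Tr.instCellComplex : ∀ r, CellComplex (Tr α r)
  | 0 => inferInstanceAs (CellComplex Unit)
  | r + 1 => let _ := Tr.instCellComplex r; inferInstanceAs (CellComplex (α × Tr α r × Tr α r))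

theorem Pw.isAcyclicOn (h : IsAcyclicOn (Set.univ : Set α)) :
    ∀ n, IsAcyclicOn (Set.univ : Set (Pw α n))
  | 0 => isAcyclicOn_unit
  | n + 1 => by
    have := h.prod (Pw.isAcyclicOn h n)
    rwa [Set.univ_prod_univ] at this

theorem Tr.isAcyclicOn (h : IsAcyclicOn (Set.univ : Set α)) :
    ∀ r, IsAcyclicOn (Set.univ : Set (Tr α r))
  | 0 => isAcyclicOn_unit
  | r + 1 => by
    have := h.prod ((Tr.isAcyclicOn h r).prod (Tr.isAcyclicOn h r))
    rwa [Set.univ_prod_univ, Set.univ_prod_univ] at this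

variable [InvolutiveNeg α] [SymmComplex α]

instance Pw.instSymmComplex : ∀ n, SymmComplex (Pw α n)
  | 0 => inferInstanceAs (SymmComplex Unit)
  | n + 1 =>
    have _ : SymmComplex (Pw α n) := Pw.instSymmComplex n
    inferInstanceAs (SymmComplex (α × Pw α n))

instance Tr.instSymmComplex : ∀ r, SymmComplex (Tr α r)
  | 0 => inferInstanceAs (SymmComplex Unit)
  | r + 1 =>
    have _ : SymmComplex (Tr α r) := Tr.instSymmComplex r
    inferInstanceAs (SymmComplex (α × Tr α r × Tr α r))

end Iterated

namespace CellAction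

variable {Γ Γ' A B : Type} [Group Γ] [Group Γ'] [CellComplex A] [CellComplex B]

/-- The diagonal action on a product. -/
noncomputable def prod (α : CellAction Γ A) (β : CellAction Γ B) : CellAction Γ (A × B) where
  ρ g := Prod.map (α.ρ g) (β.ρ g)
  one b := Prod.ext (α.one _) (β.one _)
  mul g h b := Prod.ext (α.mul _ _ _) (β.mul _ _ _)
  d_cell g := d_act_prod (α.d_cell g) (β.d_cell g)
  ε_cell g := ε_prod_map (α.ε_cell g) (β.ε_cell g)
  deg_eq g b := congrArg₂ (· + ·) (α.deg_eq g b.1) (β.deg_eq g b.2)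

/-- The pullback of an action along a homomorphism. -/
noncomputable def comap (f : Γ' →* Γ) (α : CellAction Γ A) : CellAction Γ' A where
  ρ g := α.ρ (f g)
  one b := by rw [map_one, α.one]
  mul g h b := by rw [map_mul, α.mul]
  d_cell g := α.d_cell (f g)
  ε_cell g := α.ε_cell (f g)
  deg_eq g := α.deg_eq (f g)

/-- The joint action of two commuting actions. -/
noncomputable def join (α : CellAction Γ A) (β : CellAction Γ' A)
    (comm : ∀ g h a, β.ρ h (α.ρ g a) = α.ρ g (β.ρ h a)) : CellAction (Γ × Γ') A where
  ρ g a := α.ρ g.1 (β.ρ g.2 a)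
  one b := by rw [Prod.fst_one, Prod.snd_one, α.one, β.one]
  mul g h b := by rw [Prod.fst_mul, Prod.snd_mul, α.mul, β.mul, comm]
  d_cell g b := by rw [α.d_cell, β.d_cell, act_act]; rfl
  ε_cell g b := by rw [α.ε_cell, β.ε_cell]
  deg_eq g b := by rw [α.deg_eq, β.deg_eq]

/-- The action of the group of signs given by an involution. -/
noncomputable def ofInvolution (τ : A → A) (h : ∀ a, τ (τ a) = a) (hd : ∀ a, d (cell (τ a)) = act τ (d (cell a)))
    (hε : ∀ a, ε (cell (τ a)) = ε (cell a)) (hdeg : ∀ a, deg (τ a) = deg a) :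
    CellAction ℤˣ A where
  ρ s a := if s = 1 then a else τ a
  one _ := if_pos rfl
  mul s t a := by
    rcases Int.units_eq_one_or s with rfl | rfl <;> rcases Int.units_eq_one_or t with rfl | rfl <;>
      simp [h]
  d_cell s a := by
    rcases Int.units_eq_one_or s with rfl | rfl
    · simp only [if_true]; exact (act_id _).symm
    · simp only [show ¬ (-1 : ℤˣ) = 1 by decide, if_false]; exact hd a
  ε_cell s a := by split_ifs <;> simp [hε]
  deg_eq s a := by split_ifs <;> simp [hdeg]

/-- The antipodal action. -/
noncomputable def antipodal (A : Type) [CellComplex A] [InvolutiveNeg A] [SymmComplex A] : CellAction ℤˣ A where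
  ρ := sg
  one := sg_one
  mul := sg_mul
  d_cell := (ofInvolution (A := A) Neg.neg neg_neg SymmComplex.d_neg SymmComplex.ε_neg
    SymmComplex.deg_neg).d_cell
  ε_cell := (ofInvolution (A := A) Neg.neg neg_neg SymmComplex.d_neg SymmComplex.ε_neg
    SymmComplex.deg_neg).ε_cell
  deg_eq := (ofInvolution (A := A) Neg.neg neg_neg SymmComplex.d_neg SymmComplex.ε_neg
    SymmComplex.deg_neg).deg_eq

end CellAction

namespace Tr

variable {α : Type} [InvolutiveNeg α]

theorem ρ_one_fun {r : ℕ} (a b : W r) : ρ (α := α) (r + 1) (Wr.mk 1 a b) =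
    Prod.map id (Prod.map (ρ r a) (ρ r b)) := funext fun (_, _, _) => ρ_mk_one a b _ _ _

theorem ρ_neg_one_fun {r : ℕ} (a b : W r) : ρ (α := α) (r + 1) (Wr.mk (-1) a b) =
    Prod.map Neg.neg (Prod.map (ρ r a) (ρ r b) ∘ Prod.swap) :=
  funext fun (_, _, _) => ρ_mk_neg_one a b _ _ _

variable [CellComplex α] [SymmComplex α]

theorem ρ_compat : ∀ r (g : W r), (∀ t : Tr α r, d (cell (ρ r g t)) = act (ρ r g) (d (cell t))) ∧
    (∀ t : Tr α r, ε (cell (ρ r g t)) = ε (cell t)) ∧ ∀ t : Tr α r, deg (ρ r g t) = deg t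
  | 0, _ => ⟨fun _ => (act_id _).symm, fun _ => rfl, fun _ => rfl⟩
  | r + 1, g => by
    change Wr (W r) at g
    obtain ⟨a, b, rfl | rfl⟩ := Wr.cases g
    · obtain ⟨ha1, ha2, ha3⟩ := ρ_compat r a
      obtain ⟨hb1, hb2, hb3⟩ := ρ_compat r b
      rw [ρ_one_fun]
      exact ⟨d_act_prod (fun _ => (act_id _).symm) (d_act_prod ha1 hb1),
        ε_prod_map (fun _ => rfl) (ε_prod_map ha2 hb2),
        fun (x, t, u) => congrArg (deg x + ·) (congrArg₂ (· + ·) (ha3 t) (hb3 u))⟩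
    · obtain ⟨ha1, ha2, ha3⟩ := ρ_compat r a
      obtain ⟨hb1, hb2, hb3⟩ := ρ_compat r b
      rw [ρ_neg_one_fun]
      refine ⟨d_act_prod SymmComplex.d_neg fun x => ?_,
        ε_prod_map SymmComplex.ε_neg fun x => ?_, fun (x, t, u) => ?_⟩
      · rw [Function.comp_apply, d_act_prod ha1 hb1, d_swap, act_act]
      · rw [Function.comp_apply, ε_prod_map ha2 hb2, ε_swap]
      · exact congrArg₂ (· + ·) (SymmComplex.deg_neg x)
          ((congrArg₂ (· + ·) (ha3 u) (hb3 t)).trans (add_comm _ _))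

/-- The action of the iterated wreath product on the cells of a product indexed by a tree. -/
noncomputable def action (α : Type) [CellComplex α] [InvolutiveNeg α] [SymmComplex α] (r : ℕ) :
    CellAction (W r) (Tr α r) where
  ρ := ρ r
  one := ρ_one r
  mul := ρ_mul r
  d_cell g := (ρ_compat r g).1
  ε_cell g := (ρ_compat r g).2.1
  deg_eq g := (ρ_compat r g).2.2

/-- The action on a factor and a tree in which the signs act antipodally on everything. -/
noncomputable def sourceAction (α β : Type) [CellComplex α] [InvolutiveNeg α] [SymmComplex α]
    [CellComplex β] [InvolutiveNeg β] [SymmComplex β] (r : ℕ) :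
    CellAction (ℤˣ × W r) (α × Tr β r) :=
  (CellAction.antipodal (α × Tr β r)).join
    ((CellAction.ofInvolution id (fun _ => rfl) (fun _ => (act_id _).symm) (fun _ => rfl)
      fun _ => rfl : CellAction ℤˣ α).comap 1 |>.prod (action β r)) fun s g (x, t) => by
    rcases Int.units_eq_one_or s with rfl | rfl
    · simp [CellAction.antipodal]
    · refine Prod.ext ?_ (ρ_neg r g t)
      simp [CellAction.antipodal, CellAction.prod, CellAction.comap, CellAction.ofInvolution]

theorem sourceAction_one {α β : Type} [CellComplex α] [InvolutiveNeg α] [SymmComplex α]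
    [CellComplex β] [InvolutiveNeg β] [SymmComplex β] {r : ℕ} (g : W r) (x : α) (t : Tr β r) :
    (sourceAction α β r).ρ (1, g) (x, t) = (x, ρ r g t) := by
  simp [sourceAction, CellAction.antipodal, CellAction.prod, CellAction.comap,
    CellAction.ofInvolution, CellAction.join, action]

theorem sourceAction_neg_one {α β : Type} [CellComplex α] [InvolutiveNeg α] [SymmComplex α]
    [CellComplex β] [InvolutiveNeg β] [SymmComplex β] {r : ℕ} (g : W r) (x : α) (t : Tr β r) :
    (sourceAction α β r).ρ (-1, g) (x, t) = (-x, -ρ r g t) := by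
  simp [sourceAction, CellAction.antipodal, CellAction.prod, CellAction.comap,
    CellAction.ofInvolution, CellAction.join, action]

end Tr

/-- The cells of the infinite-dimensional sphere: two hemispheres in each dimension. -/
structure Hemi where
  /-- the side of the hemisphere -/
  s : ℤˣ
  /-- the dimension of the hemisphere -/
  i : ℕ

namespace Hemi

instance : InvolutiveNeg Hemi where
  neg b := ⟨-b.s, b.i⟩
  neg_neg b := by cases b; simp

theorem neg_mk (s : ℤˣ) (i : ℕ) : -(⟨s, i⟩ : Hemi) = ⟨-s, i⟩ := rfl

theorem neg_ne (b : Hemi) : -b ≠ b := fun h => by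
  have h := congrArg Hemi.s h
  change -b.s = b.s at h
  rcases Int.units_eq_one_or b.s with e | e <;> rw [e] at h <;> exact absurd h (by decide)

/-- The boundary of a hemisphere. -/
noncomputable def bd : Hemi → Chain Hemi
  | ⟨_, 0⟩ => 0
  | ⟨_, i + 1⟩ => cell ⟨1, i⟩ + cell ⟨-1, i⟩

/-- The augmentation. -/
def aug : Hemi → ZMod 2
  | ⟨_, 0⟩ => 1
  | ⟨_, _ + 1⟩ => 0

noncomputable instance : CellComplex Hemi where
  d := lift bd
  ε := lift aug
  deg := Hemi.i
  d_d := LinearMap.congr_fun (f := lift bd ∘ₗ lift bd) (g := 0) <| hom_ext fun b => by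
    obtain ⟨s, _ | _ | i⟩ := b <;> simp [bd, add_self]
  ε_d := LinearMap.congr_fun (f := lift aug ∘ₗ lift bd) (g := 0) <| hom_ext fun b => by
    obtain ⟨s, _ | _ | i⟩ := b <;> simp [bd, aug, add_self]
  d_cell b := by
    obtain ⟨s, _ | i⟩ := b
    · simp [bd]
    · rw [lift_cell]
      exact add_mem (cell_mem_on (Nat.lt_succ_self _)) (cell_mem_on (Nat.lt_succ_self _))

@[simp] theorem d_zero (s : ℤˣ) : d (cell (⟨s, 0⟩ : Hemi)) = 0 := lift_cell _ _

@[simp] theorem d_succ (s : ℤˣ) (i : ℕ) :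
    d (cell (⟨s, i + 1⟩ : Hemi)) = cell ⟨1, i⟩ + cell ⟨-1, i⟩ := lift_cell _ _

theorem d_succ' (s : ℤˣ) (i : ℕ) :
    d (cell (⟨s, i + 1⟩ : Hemi)) = cell ⟨s, i⟩ + cell ⟨-s, i⟩ := by
  rcases Int.units_eq_one_or s with rfl | rfl <;> simp [add_comm]

@[simp] theorem ε_zero (s : ℤˣ) : ε (cell (⟨s, 0⟩ : Hemi)) = 1 := lift_cell _ _

@[simp] theorem ε_succ (s : ℤˣ) (i : ℕ) : ε (cell (⟨s, i + 1⟩ : Hemi)) = 0 := lift_cell _ _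

@[simp] theorem deg_mk (s : ℤˣ) (i : ℕ) : deg (⟨s, i⟩ : Hemi) = i := rfl

instance : SymmComplex Hemi where
  d_neg b := by obtain ⟨s, _ | i⟩ := b <;> simp [neg_mk, add_comm]
  ε_neg b := by obtain ⟨s, _ | i⟩ := b <;> simp [neg_mk]
  deg_neg _ := rfl

theorem isAcyclicOn : IsAcyclicOn (Set.univ : Set Hemi) := by
  refine ⟨fun _ _ => mem_on_univ _, lift fun b => if b.s = 1 then 0 else cell ⟨1, b.i + 1⟩, ⟨1, 0⟩,
    trivial, d_zero _, ε_zero _, rfl, fun b _ => ⟨?_, ?_⟩⟩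
  · rw [lift_cell]
    split_ifs
    · exact zero_mem _
    · exact cell_mem_on ⟨trivial, Nat.lt_succ_self _⟩
  · obtain ⟨s, _ | i⟩ := b <;> rcases Int.units_eq_one_or s with rfl | rfl <;>
      simp [add_self, show ¬ (-1 : ℤˣ) = 1 by decide]
    · rw [add_comm]
    · rw [add_right_comm, add_self, zero_add]

end Hemi

/-- The cells of an interval. -/
inductive Ivl
  | pos
  | neg
  | mid

namespace Ivl

instance : InvolutiveNeg Ivl where
  neg
    | pos => neg
    | neg => pos
    | mid => mid
  neg_neg b := by cases b <;> rfl

@[simp] theorem neg_pos : -pos = neg := rfl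
@[simp] theorem neg_neg' : -neg = pos := rfl
@[simp] theorem neg_mid : -mid = mid := rfl

/-- The boundary. -/
noncomputable def bd : Ivl → Chain Ivl
  | pos => 0
  | neg => 0
  | mid => cell pos + cell neg

/-- The augmentation. -/
def aug : Ivl → ZMod 2
  | pos => 1
  | neg => 1
  | mid => 0

/-- The dimension. -/
def dim : Ivl → ℕ
  | pos => 0
  | neg => 0
  | mid => 1

noncomputable instance : CellComplex Ivl where
  d := lift bd
  ε := lift aug
  deg := dim
  d_d := LinearMap.congr_fun (f := lift bd ∘ₗ lift bd) (g := 0) <| hom_ext fun b => by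
    cases b <;> simp [bd]
  ε_d := LinearMap.congr_fun (f := lift aug ∘ₗ lift bd) (g := 0) <| hom_ext fun b => by
    cases b <;> simp [bd, aug, add_self]
  d_cell b := by
    cases b
    · simp [bd]
    · simp [bd]
    · rw [lift_cell]
      exact add_mem (cell_mem_on Nat.zero_lt_one) (cell_mem_on Nat.zero_lt_one)

@[simp] theorem d_pos : d (cell pos) = 0 := lift_cell _ _
@[simp] theorem d_neg : d (cell neg) = 0 := lift_cell _ _
@[simp] theorem d_mid : d (cell mid) = cell pos + cell neg := lift_cell _ _
@[simp] theorem ε_pos : ε (cell pos) = 1 := lift_cell _ _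
@[simp] theorem ε_neg : ε (cell neg) = 1 := lift_cell _ _
@[simp] theorem ε_mid : ε (cell mid) = 0 := lift_cell _ _
@[simp] theorem deg_pos : deg pos = 0 := rfl
@[simp] theorem deg_neg : deg neg = 0 := rfl
@[simp] theorem deg_mid : deg mid = 1 := rfl

instance : SymmComplex Ivl where
  d_neg b := by cases b <;> simp [add_comm]
  ε_neg b := by cases b <;> simp
  deg_neg b := by cases b <;> rfl

theorem isAcyclicOn : IsAcyclicOn (Set.univ : Set Ivl) := by
  refine ⟨fun _ _ => mem_on_univ _, lift fun b => match b with
    | neg => cell mid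
    | _ => 0, pos, trivial, d_pos, ε_pos, rfl, fun b _ => ⟨?_, ?_⟩⟩
  · rw [lift_cell]
    cases b
    · exact zero_mem _
    · exact cell_mem_on ⟨trivial, show (1 : ℕ) < 2 by decide⟩
    · exact zero_mem _
  · cases b <;> simp [add_self, add_comm]

theorem isAcyclicOn_singleton (v : Ivl) (hd : d (cell v) = 0) (hε : ε (cell v) = 1)
    (hdeg : deg v = 0) : IsAcyclicOn ({v} : Set Ivl) := by
  refine ⟨?_, 0, v, rfl, hd, hε, hdeg, ?_⟩
  · rintro b rfl
    rw [hd]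
    exact zero_mem _
  · rintro b rfl
    simp [hε, add_self]

/-- The coefficient of the open interval. -/
noncomputable def top : Chain Ivl →ₗ[ZMod 2] ZMod 2 := lift fun b => match b with
  | mid => 1
  | _ => 0

@[simp] theorem top_pos : top (cell pos) = 0 := lift_cell _ _
@[simp] theorem top_neg : top (cell neg) = 0 := lift_cell _ _
@[simp] theorem top_mid : top (cell mid) = 1 := lift_cell _ _

theorem top_d (x : Chain Ivl) : top (d x) = 0 :=
  LinearMap.congr_fun (f := top ∘ₗ d) (g := 0) (hom_ext fun b => by cases b <;> simp) x

theorem top_act_neg (x : Chain Ivl) : top (act Neg.neg x) = top x :=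
  LinearMap.congr_fun (f := top ∘ₗ act Neg.neg) (g := top)
    (hom_ext fun b => by cases b <;> simp) x

end Ivl

section Functional

variable {A B : Type} [CellComplex A] [CellComplex B]

theorem tfun_d {f : Chain A →ₗ[ZMod 2] ZMod 2} {g : Chain B →ₗ[ZMod 2] ZMod 2}
    (hf : ∀ x, f (d x) = 0) (hg : ∀ x, g (d x) = 0) (x : Chain (A × B)) : tfun f g (d x) = 0 :=
  LinearMap.congr_fun (f := tfun f g ∘ₗ d) (g := 0)
    (tens_hom_ext fun a b => by simp [hf, hg]) x

theorem tfun_act_map {f : Chain A →ₗ[ZMod 2] ZMod 2} {g : Chain B →ₗ[ZMod 2] ZMod 2}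
    {p : A → A} {q : B → B} (hf : ∀ x, f (act p x) = f x) (hg : ∀ x, g (act q x) = g x)
    (x : Chain (A × B)) : tfun f g (act (Prod.map p q) x) = tfun f g x :=
  LinearMap.congr_fun (f := tfun f g ∘ₗ act (Prod.map p q)) (g := tfun f g)
    (tens_hom_ext fun a b => by
      simp only [LinearMap.comp_apply, act_map_tens, tfun_tens, hf, hg]) x

theorem tfun_swap (g : Chain B →ₗ[ZMod 2] ZMod 2)
    (x : Chain (B × B)) : tfun g g (act Prod.swap x) = tfun g g x :=
  LinearMap.congr_fun (f := tfun g g ∘ₗ act Prod.swap) (g := tfun g g)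
    (tens_hom_ext fun a b => by simp [mul_comm]) x

/-- The power of a functional. -/
noncomputable def Pw.top (φ : Chain A →ₗ[ZMod 2] ZMod 2) : ∀ n, Chain (Pw A n) →ₗ[ZMod 2] ZMod 2
  | 0 => (ε : Chain Unit →ₗ[ZMod 2] ZMod 2)
  | n + 1 => tfun φ (Pw.top φ n)

/-- The power of a functional over the nodes of a tree. -/
noncomputable def Tr.top (φ : Chain A →ₗ[ZMod 2] ZMod 2) : ∀ r, Chain (Tr A r) →ₗ[ZMod 2] ZMod 2
  | 0 => (ε : Chain Unit →ₗ[ZMod 2] ZMod 2)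
  | r + 1 => tfun φ (tfun (Tr.top φ r) (Tr.top φ r))

variable {φ : Chain A →ₗ[ZMod 2] ZMod 2}

theorem Pw.top_d (hφ : ∀ x, φ (d x) = 0) : ∀ n x, Pw.top φ n (d x) = 0
  | 0, _ => map_zero _
  | n + 1, x => tfun_d hφ (Pw.top_d hφ n) x

theorem Tr.top_d (hφ : ∀ x, φ (d x) = 0) : ∀ r x, Tr.top φ r (d x) = 0
  | 0, _ => map_zero _
  | r + 1, x => tfun_d hφ (tfun_d (Tr.top_d hφ r) (Tr.top_d hφ r)) x

variable [InvolutiveNeg A]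

theorem Pw.top_act_neg (hφ : ∀ x, φ (act Neg.neg x) = φ x) :
    ∀ n x, Pw.top φ n (act Neg.neg x) = Pw.top φ n x
  | 0, x => congrArg _ (act_id x)
  | n + 1, x => tfun_act_map hφ (Pw.top_act_neg hφ n) x

theorem Tr.top_act_ρ (hφ : ∀ x, φ (act Neg.neg x) = φ x) :
    ∀ r (g : W r) x, Tr.top φ r (act (Tr.ρ r g) x) = Tr.top φ r x
  | 0, _, x => congrArg _ (act_id x)
  | r + 1, g, x => by
    change Wr (W r) at g
    obtain ⟨a, b, rfl | rfl⟩ := Wr.cases g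
    · rw [Tr.ρ_one_fun]
      exact tfun_act_map (fun y => by rw [act_id])
        (tfun_act_map (Tr.top_act_ρ hφ r a) (Tr.top_act_ρ hφ r b)) x
    · rw [Tr.ρ_neg_one_fun]
      refine tfun_act_map hφ (fun y => ?_) x
      rw [← act_act, tfun_act_map (Tr.top_act_ρ hφ r a) (Tr.top_act_ρ hφ r b), tfun_swap]

end Functional

section Const

theorem Tr.functional_d_const (n : ℕ) : ∀ r (f : Chain (Tr Hemi r) →ₗ[ZMod 2] ZMod 2),
    (∀ g x, f (act (Tr.ρ r g) x) = f x) → f (d (cell (Tr.const ⟨1, n⟩ r))) = 0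
  | 0, f, _ => map_zero f
  | r + 1, f, hf => by
    set t : Tr Hemi r := Tr.const ⟨1, n⟩ r with ht
    suffices h : ∀ f : Chain (Hemi × Tr Hemi r × Tr Hemi r) →ₗ[ZMod 2] ZMod 2,
        (∀ a b x, f (act (Prod.map id (Prod.map (Tr.ρ r a) (Tr.ρ r b))) x) = f x) →
        (f (cell (-⟨1, n - 1⟩, t, t)) = f (cell (⟨1, n - 1⟩, t, t))) →
        f (d (cell (⟨1, n⟩, t, t))) = 0 by
      refine h f (fun a b x => ?_) ?_
      · have := hf (Wr.mk 1 a b) x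
        rwa [Tr.ρ_one_fun] at this
      · have := hf (Wr.mk (-1) 1 1) (cell (⟨1, n - 1⟩, t, t))
        erw [act_cell, Tr.ρ_mk_neg_one, Tr.ρ_one] at this
        exact this
    intro f hf' hfs
    rw [← cell_tens_cell, ← cell_tens_cell, d_tens, d_tens]
    rw [map_add, map_add, map_add]
    have h1 : f (tens (d (cell ⟨1, n⟩)) (tens (cell t) (cell t))) = 0 := by
      cases n with
      | zero => simp
      | succ n =>
        rw [Hemi.d_succ, map_add, LinearMap.add_apply, map_add, cell_tens_cell, cell_tens_cell,
          cell_tens_cell]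
        exact (congrArg (_ + ·) hfs).trans (add_self _)
    have h2 := Tr.functional_d_const n r
      (f ∘ₗ tens (cell ⟨1, n⟩) ∘ₗ tens.flip (cell t)) fun g x => by
        have := hf' g 1 (tens (cell ⟨1, n⟩) (tens x (cell t)))
        rw [act_map_tens, act_map_tens] at this
        simpa [Tr.ρ_one] using this
    have h3 := Tr.functional_d_const n r
      (f ∘ₗ tens (cell ⟨1, n⟩) ∘ₗ tens (cell t)) fun g x => by
        have := hf' 1 g (tens (cell ⟨1, n⟩) (tens (cell t) x))
        rw [act_map_tens, act_map_tens] at this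
        simpa [Tr.ρ_one] using this
    simp only [LinearMap.comp_apply, LinearMap.flip_apply] at h2 h3
    rw [h1, h2, h3]
    rfl

theorem Tr.invariant_d_const {r : ℕ} (n : ℕ) (b : Hemi)
    {f : Chain (Hemi × Tr Hemi r) →ₗ[ZMod 2] ZMod 2}
    (hf : ∀ g x, f (act ((Tr.sourceAction Hemi Hemi r).ρ g) x) = f x) :
    f (d (cell (b, Tr.const ⟨1, n⟩ r))) = 0 := by
  rw [← cell_tens_cell, d_tens, map_add]
  have h1 : f (tens (cell b) (d (cell (Tr.const ⟨1, n⟩ r)))) = 0 := by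
    refine Tr.functional_d_const n r (f ∘ₗ tens (cell b)) fun g x => ?_
    have := hf (1, g) (tens (cell b) x)
    rw [show (Tr.sourceAction Hemi Hemi r).ρ (1, g) = Prod.map id (Tr.ρ r g) from
      funext fun (_, _) => Tr.sourceAction_one _ _ _, act_map_tens, act_id] at this
    exact this
  rw [h1, add_zero]
  obtain ⟨s, _ | i⟩ := b
  · simp
  · obtain ⟨g, hg⟩ := Tr.exists_ρ_const (⟨1, n⟩ : Hemi) r
    have := hf (-1, g) (cell (⟨1, i⟩, Tr.const ⟨1, n⟩ r))
    rw [act_cell, Tr.sourceAction_neg_one, hg, neg_neg, Hemi.neg_mk] at this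
    rw [Hemi.d_succ, map_add, LinearMap.add_apply, map_add, cell_tens_cell, cell_tens_cell, this]
    exact add_self _

end Const

/-- A linear map that does not raise dimensions. -/
def IsGraded {A B : Type} [CellComplex A] [CellComplex B] (f : Chain A →ₗ[ZMod 2] Chain B) : Prop :=
  ∀ a, f (cell a) ∈ on {b | deg b < deg a + 1}

theorem exists_on_deg_lt {B : Type} [CellComplex B] (x : Chain B) : ∃ n, x ∈ on {b | deg b < n} :=
  ⟨x.support.sup deg + 1, fun _ hy => Nat.lt_succ_of_le (Finset.le_sup (f := deg) hy)⟩

namespace CellAction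

variable {Γ A B Y : Type} [Group Γ] [CellComplex A] [CellComplex B] [CellComplex Y]

theorem exists_isChainMap (α : CellAction Γ B) (β : CellAction Γ Y)
    (free : ∀ g b, α.ρ g b = b → g = 1) (hY : IsAcyclicOn (Set.univ : Set Y)) :
    ∃ h : Chain B →ₗ[ZMod 2] Chain Y, Equivariant α β h ∧ IsChainMap h ∧ IsGraded h := by
  obtain ⟨h, heq, hsol⟩ := exists_equivariant α β (S := Set.univ) (fun _ _ _ => trivial)
    (fun g b _ => free g b) (fun _ _ => mem_on_univ _) (K := fun b => {y | deg y < deg b + 1})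
    (K' := fun b => {y | deg y < deg b})
    (fun g b _ y hy => by
      rw [Set.mem_ofPred_eq] at hy ⊢
      rwa [α.deg_eq, β.deg_eq])
    (fun b _ b' _ hb' y hy => by
      have : deg b' < deg b := CellComplex.d_cell b hb'
      rw [Set.mem_ofPred_eq] at hy ⊢
      omega)
    (θ := 0) (a := ε)
    (fun b _ z hz hdz hεz a => by
      simpa using hY.solve (n := deg b) (by simpa using hz) hdz hεz a)
    (fun g x => by simp) (α.ε_act) (fun _ _ => by simp) (fun _ _ => by simp)
    (fun _ _ => ε_d _) (fun _ _ => zero_mem _)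
  exact ⟨h, heq, .of_cell (fun b => by simpa using (hsol b trivial).1) fun b => (hsol b trivial).2.1,
    fun b => (hsol b trivial).2.2⟩

/-- The action on a power. -/
noncomputable def pw (α : CellAction Γ A) : ∀ n, CellAction Γ (Pw A n)
  | 0 =>
    { ρ := fun _ => id
      one := fun _ => rfl
      mul := fun _ _ _ => rfl
      d_cell := fun _ _ => (act_id _).symm
      ε_cell := fun _ _ => rfl
      deg_eq := fun _ _ => rfl }
  | n + 1 => α.prod (pw α n)

variable [InvolutiveNeg A] [SymmComplex A]

/-- Independent signs acting on the two factors of a square. -/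
noncomputable def bi (A : Type) [CellComplex A] [InvolutiveNeg A] [SymmComplex A] :
    CellAction (ℤˣ × ℤˣ) (A × A) :=
  ((antipodal A).comap (MonoidHom.fst _ _)).prod ((antipodal A).comap (MonoidHom.snd _ _))

/-- The second sign swaps the two factors of a square, and the first one swaps and negates. -/
noncomputable def pair (A : Type) [CellComplex A] [InvolutiveNeg A] [SymmComplex A] :
    CellAction (ℤˣ × ℤˣ) (A × A) :=
  join (ofInvolution (fun x : A × A => -x.swap) (fun x => by ext <;> simp)
      (fun x => by rw [SymmComplex.d_neg, d_swap, act_act]; rfl)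
      (fun x => by rw [SymmComplex.ε_neg, ε_swap])
      (fun x => by rw [SymmComplex.deg_neg]; exact add_comm _ _))
    (ofInvolution Prod.swap Prod.swap_swap d_swap ε_swap fun x => add_comm _ _) fun s t x => by
      rcases Int.units_eq_one_or s with rfl | rfl <;> rcases Int.units_eq_one_or t with rfl | rfl <;>
        simp [ofInvolution]

theorem bi_fst : (bi A).ρ (-1, 1) = Prod.map Neg.neg id := by
  funext ⟨x, y⟩; simp [bi, prod, comap, antipodal]

theorem bi_snd : (bi A).ρ (1, -1) = Prod.map id Neg.neg := by
  funext ⟨x, y⟩; simp [bi, prod, comap, antipodal]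

theorem pair_fst : (pair A).ρ (-1, 1) = fun x => -x.swap := by
  funext x; simp [pair, join, ofInvolution]

theorem pair_snd : (pair A).ρ (1, -1) = Prod.swap := by
  funext x; simp [pair, join, ofInvolution]

/-- The product of two signs acting antipodally. -/
noncomputable def mulAntipodal (A : Type) [CellComplex A] [InvolutiveNeg A] [SymmComplex A] :
    CellAction (ℤˣ × ℤˣ) A :=
  (antipodal A).comap (MonoidHom.fst _ _ * MonoidHom.snd _ _)

theorem mulAntipodal_fst : (mulAntipodal A).ρ (-1, 1) = Neg.neg := by
  funext x; simp [mulAntipodal, comap, antipodal]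

theorem mulAntipodal_snd : (mulAntipodal A).ρ (1, -1) = Neg.neg := by
  funext x; simp [mulAntipodal, comap, antipodal]

theorem bi_free (h : ∀ a : A, -a ≠ a) (g : ℤˣ × ℤˣ) (x : A × A) (hx : (bi A).ρ g x = x) :
    g = 1 := by
  obtain ⟨s, t⟩ := g
  obtain ⟨x, y⟩ := x
  rcases Int.units_eq_one_or s with rfl | rfl <;> rcases Int.units_eq_one_or t with rfl | rfl <;>
    simp [bi, prod, comap, antipodal, h] at hx ⊢

theorem Equivariant.of_signs {α : CellAction (ℤˣ × ℤˣ) B} {β : CellAction (ℤˣ × ℤˣ) Y}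
    {h : Chain B →ₗ[ZMod 2] Chain Y}
    (h1 : ∀ x, h (act (α.ρ (-1, 1)) x) = act (β.ρ (-1, 1)) (h x))
    (h2 : ∀ x, h (act (α.ρ (1, -1)) x) = act (β.ρ (1, -1)) (h x)) : Equivariant α β h := by
  have h0 : ∀ x, h (act (α.ρ 1) x) = act (β.ρ 1) (h x) := fun x => by
    rw [show α.ρ 1 = id from funext α.one, show β.ρ 1 = id from funext β.one, act_id, act_id]
  rintro ⟨s, t⟩ x
  rcases Int.units_eq_one_or s with rfl | rfl <;> rcases Int.units_eq_one_or t with rfl | rfl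
  · exact h0 x
  · exact h2 x
  · exact h1 x
  · rw [show ((-1, -1) : ℤˣ × ℤˣ) = (-1, 1) * (1, -1) by simp, act_mul, act_mul, h1, h2]

theorem bi_functional_d {f : Chain (Hemi × Hemi) →ₗ[ZMod 2] ZMod 2}
    (hf : ∀ g x, f (act ((bi Hemi).ρ g) x) = f x) (x : Hemi × Hemi) : f (d (cell x)) = 0 := by
  obtain ⟨x, y⟩ := x
  have key : ∀ (b : Hemi) (g : Chain Hemi →ₗ[ZMod 2] ZMod 2), (∀ c, g (cell (-c)) = g (cell c)) →
      g (d (cell b)) = 0 := fun b g hg => by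
    obtain ⟨s, _ | i⟩ := b
    · simp
    · rw [Hemi.d_succ, map_add, ← hg ⟨1, i⟩]
      exact add_self _
  rw [← cell_tens_cell, d_tens, map_add]
  have h1 := key x (f ∘ₗ tens.flip (cell y)) fun c => by
    have := hf (-1, 1) (cell (c, y))
    rw [bi_fst, act_cell] at this
    simpa [cell_tens_cell] using this
  have h2 := key y (f ∘ₗ tens (cell x)) fun c => by
    have := hf (1, -1) (cell (x, c))
    rw [bi_snd, act_cell] at this
    simpa [cell_tens_cell] using this
  simp only [LinearMap.comp_apply, LinearMap.flip_apply] at h1 h2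
  rw [h1, h2, add_zero]

end CellAction

namespace Ivl

/-- The end point of the interval with a given sign. -/
def pt (s : ℤˣ) : Ivl := if s = 1 then pos else neg

@[simp] theorem pt_one : pt 1 = pos := rfl
@[simp] theorem pt_neg_one : pt (-1) = neg := rfl

theorem pt_neg (s : ℤˣ) : pt (-s) = -pt s := by
  rcases Int.units_eq_one_or s with rfl | rfl <;> rfl

@[simp] theorem d_pt (s : ℤˣ) : d (cell (pt s)) = 0 := by
  rcases Int.units_eq_one_or s with rfl | rfl <;> simp

@[simp] theorem ε_pt (s : ℤˣ) : ε (cell (pt s)) = 1 := by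
  rcases Int.units_eq_one_or s with rfl | rfl <;> simp

@[simp] theorem top_pt (s : ℤˣ) : top (cell (pt s)) = 0 := by
  rcases Int.units_eq_one_or s with rfl | rfl <;> simp

end Ivl

section Split

variable {B : Type} [CellComplex B]

/-- Tensoring each cell with the end point of the interval given by its sign. -/
noncomputable def signTens (sgn : B → ℤˣ) : Chain B →ₗ[ZMod 2] Chain (Ivl × B) :=
  lift fun b => cell (Ivl.pt (sgn b), b)

/-- The chain map into the product with an interval given by a sign function and the part of the
boundary that changes the sign. -/
noncomputable def split (sgn : B → ℤˣ) (σ : Chain B →ₗ[ZMod 2] Chain B) :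
    Chain B →ₗ[ZMod 2] Chain (Ivl × B) :=
  signTens sgn + tens (cell Ivl.mid) ∘ₗ σ

theorem split_cell (sgn : B → ℤˣ) (σ : Chain B →ₗ[ZMod 2] Chain B) (b : B) :
    split sgn σ (cell b) =
      tens (cell (Ivl.pt (sgn b))) (cell b) + tens (cell Ivl.mid) (σ (cell b)) := by
  simp [split, signTens, cell_tens_cell]

theorem isChainMap_split {sgn : B → ℤˣ} {σ : Chain B →ₗ[ZMod 2] Chain B}
    (hσ : ∀ b, d (σ (cell b)) = σ (d (cell b)))
    (h : ∀ b, signTens sgn (d (cell b)) = tens (cell (Ivl.pt (sgn b))) (d (cell b)) +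
      tens (cell Ivl.pos + cell Ivl.neg) (σ (cell b))) :
    IsChainMap (split sgn σ) :=
  .of_cell
    (fun b => by
      rw [split_cell]
      simp only [map_add, d_tens, Ivl.d_pt, Ivl.d_mid, hσ, map_zero, LinearMap.zero_apply]
      simp only [split, LinearMap.add_apply, LinearMap.comp_apply, h]
      simp only [map_add, LinearMap.add_apply]
      module)
    fun b => by simp [split_cell]

theorem split_act {sgn : B → ℤˣ} {σ : Chain B →ₗ[ZMod 2] Chain B} {τ : B → B}
    (hσ : ∀ b, σ (cell (τ b)) = act τ (σ (cell b))) (h : ∀ b, sgn (τ b) = -sgn b) (x : Chain B) :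
    split sgn σ (act τ x) = act (Prod.map Neg.neg τ) (split sgn σ x) :=
  LinearMap.congr_fun (f := split sgn σ ∘ₗ act τ) (g := act (Prod.map Neg.neg τ) ∘ₗ split sgn σ)
    (hom_ext fun b => by
      simp only [LinearMap.comp_apply, act_cell, split_cell, map_add, act_map_tens, hσ, h,
        Ivl.pt_neg, Ivl.neg_mid]) x

theorem tfun_split (sgn : B → ℤˣ) (σ : Chain B →ₗ[ZMod 2] Chain B)
    (f : Chain B →ₗ[ZMod 2] ZMod 2) (x : Chain B) :
    tfun Ivl.top f (split sgn σ x) = f (σ x) :=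
  LinearMap.congr_fun (f := tfun Ivl.top f ∘ₗ split sgn σ) (g := f ∘ₗ σ)
    (hom_ext fun b => by simp [split_cell]) x

end Split

namespace Hemi

/-- The half of the boundary lying on the opposite side. -/
noncomputable def opp : Chain Hemi →ₗ[ZMod 2] Chain Hemi := lift fun b => match b with
  | ⟨_, 0⟩ => 0
  | ⟨s, i + 1⟩ => cell ⟨-s, i⟩

@[simp] theorem opp_zero (s : ℤˣ) : opp (cell ⟨s, 0⟩) = 0 := lift_cell _ _
@[simp] theorem opp_succ (s : ℤˣ) (i : ℕ) : opp (cell ⟨s, i + 1⟩) = cell ⟨-s, i⟩ := lift_cell _ _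

theorem d_opp (b : Hemi) : d (opp (cell b)) = opp (d (cell b)) := by
  obtain ⟨s, _ | _ | i⟩ := b
  · simp
  · simp
  · simp only [opp_succ, d_succ, map_add, neg_neg]
    exact add_comm _ _

theorem opp_neg (b : Hemi) : opp (cell (-b)) = act Neg.neg (opp (cell b)) := by
  obtain ⟨s, _ | i⟩ := b <;> simp [neg_mk]

theorem signTens_d (b : Hemi) : signTens Hemi.s (d (cell b)) =
    tens (cell (Ivl.pt b.s)) (d (cell b)) + tens (cell Ivl.pos + cell Ivl.neg) (opp (cell b)) := by
  obtain ⟨s, _ | i⟩ := b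
  · simp
  · rcases Int.units_eq_one_or s with rfl | rfl <;>
      simp only [d_succ, opp_succ, signTens, map_add, lift_cell, ← cell_tens_cell, Ivl.pt_one,
        Ivl.pt_neg_one, LinearMap.add_apply, neg_neg]
    · linear_combination (norm := module) -add_self (tens (cell Ivl.pos) (cell (⟨-1, i⟩ : Hemi)))
    · linear_combination (norm := module) -add_self (tens (cell Ivl.neg) (cell (⟨1, i⟩ : Hemi)))

/-- The splitting of a sphere. -/
noncomputable def split1 : Chain Hemi →ₗ[ZMod 2] Chain (Ivl × Hemi) := split Hemi.s opp

theorem isChainMap_split1 : IsChainMap split1 := isChainMap_split d_opp signTens_d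

theorem split1_act (x : Chain Hemi) : split1 (act Neg.neg x) =
    act (Prod.map Neg.neg Neg.neg) (split1 x) := split_act opp_neg (fun _ => rfl) x

/-- The half of the boundary of a product changing the product of the signs. -/
noncomputable def opp2 : Chain (Hemi × Hemi) →ₗ[ZMod 2] Chain (Hemi × Hemi) :=
  tmap opp .id + tmap .id opp

/-- The product of the signs. -/
def s2 (x : Hemi × Hemi) : ℤˣ := x.1.s * x.2.s

theorem opp2_tens (x y : Chain Hemi) : opp2 (tens x y) = tens (opp x) y + tens x (opp y) := by
  simp [opp2]

/-- The splitting of a product of two spheres along the product of the signs. -/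
noncomputable def split2 : Chain (Hemi × Hemi) →ₗ[ZMod 2] Chain (Ivl × Hemi × Hemi) :=
  split s2 opp2

theorem isChainMap_split2 : IsChainMap split2 := by
  have hd : ∀ b : Hemi, opp (d (cell b)) = d (opp (cell b)) := fun b => (d_opp b).symm
  refine isChainMap_split (fun ⟨a, b⟩ => ?_) fun ⟨a, b⟩ => ?_
  · simp only [← cell_tens_cell, opp2_tens, d_tens, map_add, hd]
    module
  · have e1 : signTens s2 (tens (d (cell a)) (cell b)) =
        tens (cell (Ivl.pt (s2 (a, b)))) (tens (d (cell a)) (cell b)) +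
        tens (cell Ivl.pos + cell Ivl.neg) (tens (opp (cell a)) (cell b)) := by
      obtain ⟨s, _ | i⟩ := a
      · simp
      · obtain ⟨t, j⟩ := b
        rw [d_succ' s, opp_succ]
        simp only [map_add, LinearMap.add_apply, cell_tens_cell, signTens, lift_cell, s2, neg_mul]
        rw [Ivl.pt_neg]
        rcases Int.units_eq_one_or (s * t) with h | h <;> rw [h] <;> simp only [Ivl.pt_one,
          Ivl.pt_neg_one, Ivl.neg_pos, Ivl.neg_neg']
        · linear_combination (norm := module)
            -add_self (cell (Ivl.pos, (⟨-s, i⟩ : Hemi), (⟨t, j⟩ : Hemi)))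
        · linear_combination (norm := module)
            -add_self (cell (Ivl.neg, (⟨-s, i⟩ : Hemi), (⟨t, j⟩ : Hemi)))
    have e2 : signTens s2 (tens (cell a) (d (cell b))) =
        tens (cell (Ivl.pt (s2 (a, b)))) (tens (cell a) (d (cell b))) +
        tens (cell Ivl.pos + cell Ivl.neg) (tens (cell a) (opp (cell b))) := by
      obtain ⟨t, _ | j⟩ := b
      · simp
      · obtain ⟨s, i⟩ := a
        rw [d_succ' t, opp_succ]
        simp only [map_add, LinearMap.add_apply, cell_tens_cell, signTens, lift_cell, s2, mul_neg]
        rw [Ivl.pt_neg]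
        rcases Int.units_eq_one_or (s * t) with h | h <;> rw [h] <;> simp only [Ivl.pt_one,
          Ivl.pt_neg_one, Ivl.neg_pos, Ivl.neg_neg']
        · linear_combination (norm := module)
            -add_self (cell (Ivl.pos, (⟨s, i⟩ : Hemi), (⟨-t, j⟩ : Hemi)))
        · linear_combination (norm := module)
            -add_self (cell (Ivl.neg, (⟨s, i⟩ : Hemi), (⟨-t, j⟩ : Hemi)))
    rw [← cell_tens_cell, d_tens, opp2_tens, map_add, e1, e2]
    simp only [map_add]
    module

theorem split2_act_fst (x : Chain (Hemi × Hemi)) : split2 (act (Prod.map Neg.neg id) x) =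
    act (Prod.map Neg.neg (Prod.map Neg.neg id)) (split2 x) :=
  split_act (fun (a, b) => by
      simp only [Prod.map_apply, ← cell_tens_cell, opp2_tens, map_add, act_map_tens, opp_neg,
        act_cell, id_eq, act_id])
    (fun (a, b) => neg_mul a.s b.s) x

theorem split2_act_snd (x : Chain (Hemi × Hemi)) : split2 (act (Prod.map id Neg.neg) x) =
    act (Prod.map Neg.neg (Prod.map id Neg.neg)) (split2 x) :=
  split_act (fun (a, b) => by
      simp only [Prod.map_apply, ← cell_tens_cell, opp2_tens, map_add, act_map_tens, opp_neg,
        act_cell, id_eq, act_id])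
    (fun (a, b) => mul_neg a.s b.s) x

end Hemi

section Maps

variable {A B C D A' B' : Type} [CellComplex A] [CellComplex B] [CellComplex C] [CellComplex D]
  [CellComplex A'] [CellComplex B']

/-- Interchanging the middle factors of a fourfold product. -/
def shuf (x : (A × B) × C × D) : (A × C) × B × D := ((x.1.1, x.2.1), x.1.2, x.2.2)

/-- Reassociating a threefold product. -/
def assocInv (x : A × B × C) : (A × B) × C := ((x.1, x.2.1), x.2.2)

@[simp] theorem act_shuf_tens (a : Chain A) (b : Chain B) (c : Chain C) (e : Chain D) :
    act shuf (tens (tens a b) (tens c e)) = tens (tens a c) (tens b e) := by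
  have h : ∀ (a : A) (b : B) (c : C) (e : D),
      act shuf (tens (tens (cell a) (cell b)) (tens (cell c) (cell e))) =
        tens (tens (cell a) (cell c)) (tens (cell b) (cell e)) := fun a b c e => by
    simp [cell_tens_cell, shuf]
  have h1 : ∀ (a : Chain A) (b : B) (c : C) (e : D),
      act shuf (tens (tens a (cell b)) (tens (cell c) (cell e))) =
        tens (tens a (cell c)) (tens (cell b) (cell e)) := fun a b c e =>
    LinearMap.congr_fun (f := act shuf ∘ₗ tens.flip (tens (cell c) (cell e)) ∘ₗ tens.flip (cell b))
      (g := tens.flip (tens (cell b) (cell e)) ∘ₗ tens.flip (cell c))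
      (hom_ext fun a => by simpa using h a b c e) a
  have h2 : ∀ (a : Chain A) (b : Chain B) (c : C) (e : D),
      act shuf (tens (tens a b) (tens (cell c) (cell e))) =
        tens (tens a (cell c)) (tens b (cell e)) := fun a b c e =>
    LinearMap.congr_fun (f := act shuf ∘ₗ tens.flip (tens (cell c) (cell e)) ∘ₗ tens a)
      (g := tens (tens a (cell c)) ∘ₗ tens.flip (cell e))
      (hom_ext fun b => by simpa using h1 a b c e) b
  have h3 : ∀ (a : Chain A) (b : Chain B) (c : Chain C) (e : D),
      act shuf (tens (tens a b) (tens c (cell e))) =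
        tens (tens a c) (tens b (cell e)) := fun a b c e =>
    LinearMap.congr_fun (f := act shuf ∘ₗ tens (tens a b) ∘ₗ tens.flip (cell e))
      (g := tens.flip (tens b (cell e)) ∘ₗ tens a)
      (hom_ext fun c => by simpa using h2 a b c e) c
  exact LinearMap.congr_fun (f := act shuf ∘ₗ tens (tens a b) ∘ₗ tens c)
      (g := tens (tens a c) ∘ₗ tens b)
      (hom_ext fun e => by simpa using h3 a b c e) e

@[simp] theorem act_assocInv_tens (a : Chain A) (b : Chain B) (c : Chain C) :
    act assocInv (tens a (tens b c)) = tens (tens a b) c := by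
  have h : ∀ (a : A) (b : B) (c : C),
      act assocInv (tens (cell a) (tens (cell b) (cell c))) =
        tens (tens (cell a) (cell b)) (cell c) := fun a b c => by
    simp [cell_tens_cell, assocInv]
  have h1 : ∀ (a : Chain A) (b : B) (c : C),
      act assocInv (tens a (tens (cell b) (cell c))) = tens (tens a (cell b)) (cell c) :=
    fun a b c =>
    LinearMap.congr_fun (f := act assocInv ∘ₗ tens.flip (tens (cell b) (cell c)))
      (g := tens.flip (cell c) ∘ₗ tens.flip (cell b))
      (hom_ext fun a => by simpa using h a b c) a
  have h2 : ∀ (a : Chain A) (b : Chain B) (c : C),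
      act assocInv (tens a (tens b (cell c))) = tens (tens a b) (cell c) := fun a b c =>
    LinearMap.congr_fun (f := act assocInv ∘ₗ tens a ∘ₗ tens.flip (cell c))
      (g := tens.flip (cell c) ∘ₗ tens a)
      (hom_ext fun b => by simpa using h1 a b c) b
  exact LinearMap.congr_fun (f := act assocInv ∘ₗ tens a ∘ₗ tens b)
      (g := tens (tens a b))
      (hom_ext fun c => by simpa using h2 a b c) c

theorem isChainMap_shuf : IsChainMap (act (shuf (A := A) (B := B) (C := C) (D := D))) :=
  .of_cell (fun ((a, b), c, e) => by
      simp only [← cell_tens_cell, d_tens, act_shuf_tens, map_add, LinearMap.add_apply]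
      module)
    fun ((a, b), c, e) => by
      simp only [← cell_tens_cell, act_shuf_tens, ε_tens]
      ring

theorem isChainMap_assocInv : IsChainMap (act (assocInv (A := A) (B := B) (C := C))) :=
  .of_cell (fun (a, b, c) => by
      simp only [← cell_tens_cell, d_tens, act_assocInv_tens, map_add, LinearMap.add_apply]
      module)
    fun (a, b, c) => by
      simp only [← cell_tens_cell, act_assocInv_tens, ε_tens]
      ring

theorem tmap_act {f : Chain A →ₗ[ZMod 2] Chain C} {g : Chain B →ₗ[ZMod 2] Chain D}
    {p : A → A'} {q : B → B'} {P : C → C} {f' : Chain A' →ₗ[ZMod 2] Chain C}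
    {g' : Chain B' →ₗ[ZMod 2] Chain D} {Q : D → D}
    (hf : ∀ x, f' (act p x) = act P (f x)) (hg : ∀ x, g' (act q x) = act Q (g x))
    (z : Chain (A × B)) : tmap f' g' (act (Prod.map p q) z) = act (Prod.map P Q) (tmap f g z) :=
  LinearMap.congr_fun (f := tmap f' g' ∘ₗ act (Prod.map p q))
    (g := act (Prod.map P Q) ∘ₗ tmap f g)
    (tens_hom_ext fun a b => by
      simp only [LinearMap.comp_apply, act_map_tens, tmap_tens, hf, hg]) z

theorem map_act_id (f : Chain A →ₗ[ZMod 2] Chain B) (x : Chain A) :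
    f (act id x) = act id (f x) := by
  rw [act_id, act_id]

theorem tmap_swap (f : Chain A →ₗ[ZMod 2] Chain C) (z : Chain (A × A)) :
    tmap f f (act Prod.swap z) = act Prod.swap (tmap f f z) :=
  LinearMap.congr_fun (f := tmap f f ∘ₗ act Prod.swap) (g := act Prod.swap ∘ₗ tmap f f)
    (tens_hom_ext fun a b => by simp) z

theorem tfun_tmap {f : Chain A →ₗ[ZMod 2] Chain C} {g : Chain B →ₗ[ZMod 2] Chain D}
    (φ : Chain C →ₗ[ZMod 2] ZMod 2) (ψ : Chain D →ₗ[ZMod 2] ZMod 2) (z : Chain (A × B)) :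
    tfun φ ψ (tmap f g z) = tfun (φ ∘ₗ f) (ψ ∘ₗ g) z :=
  LinearMap.congr_fun (f := tfun φ ψ ∘ₗ tmap f g) (g := tfun (φ ∘ₗ f) (ψ ∘ₗ g))
    (tens_hom_ext fun a b => by simp) z

theorem CellAction.Equivariant.tmap {Γ : Type} [Group Γ] {α : CellAction Γ A} {β : CellAction Γ B}
    {γ : CellAction Γ C} {δ : CellAction Γ D}
    {f : Chain A →ₗ[ZMod 2] Chain C} {g : Chain B →ₗ[ZMod 2] Chain D}
    (hf : Equivariant α γ f) (hg : Equivariant β δ g) :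
    Equivariant (α.prod β) (γ.prod δ) (tmap f g) := fun a => tmap_act (hf a) (hg a)

/-- The augmentation as a chain map to a point. -/
noncomputable def toUnit (B : Type) [CellComplex B] : Chain B →ₗ[ZMod 2] Chain Unit :=
  (ε : Chain B →ₗ[ZMod 2] ZMod 2).smulRight (cell ())

theorem isChainMap_toUnit : IsChainMap (toUnit B) :=
  .of_cell (fun b => by simp [toUnit, ε_d]) fun b => by simp [toUnit]

end Maps

namespace Hemi

open CellAction

/-- The splitting of both factors of a product of two spheres. -/
noncomputable def split11 : Chain (Hemi × Hemi) →ₗ[ZMod 2] Chain ((Ivl × Ivl) × Hemi × Hemi) :=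
  act shuf ∘ₗ tmap split1 split1

theorem isChainMap_split11 : IsChainMap split11 :=
  isChainMap_shuf.comp (isChainMap_split1.tmap isChainMap_split1)

theorem split11_bi : Equivariant (bi Hemi) ((bi Ivl).prod (bi Hemi)) split11 := by
  refine .of_signs (fun x => ?_) fun x => ?_
  · change _ = act (Prod.map ((bi Ivl).ρ (-1, 1)) ((bi Hemi).ρ (-1, 1))) _
    rw [bi_fst, bi_fst, split11, LinearMap.comp_apply, LinearMap.comp_apply,
      tmap_act split1_act (map_act_id split1), act_act, act_act]
    rfl
  · change _ = act (Prod.map ((bi Ivl).ρ (1, -1)) ((bi Hemi).ρ (1, -1))) _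
    rw [bi_snd, bi_snd, split11, LinearMap.comp_apply, LinearMap.comp_apply,
      tmap_act (map_act_id split1) split1_act, act_act, act_act]
    rfl

theorem split11_swap (x : Chain (Hemi × Hemi)) :
    split11 (act Prod.swap x) = act (Prod.map Prod.swap Prod.swap) (split11 x) := by
  rw [split11, LinearMap.comp_apply, LinearMap.comp_apply, tmap_swap, act_act, act_act]
  rfl

theorem split11_pair : Equivariant (pair Hemi) ((pair Ivl).prod (pair Hemi)) split11 := by
  refine .of_signs (fun x => ?_) fun x => ?_
  · change _ = act (Prod.map ((pair Ivl).ρ (-1, 1)) ((pair Hemi).ρ (-1, 1))) _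
    rw [pair_fst, pair_fst, show (fun x : Hemi × Hemi => -x.swap) =
      Prod.map Neg.neg Neg.neg ∘ Prod.swap from rfl, ← act_act, split11, LinearMap.comp_apply,
      tmap_act split1_act split1_act, act_act, tmap_swap, act_act, LinearMap.comp_apply, act_act]
    rfl
  · change _ = act (Prod.map ((pair Ivl).ρ (1, -1)) ((pair Hemi).ρ (1, -1))) _
    rw [pair_snd, pair_snd, split11_swap]

/-- The iterated splitting of both factors of a product of two spheres. -/
noncomputable def iter (l : Chain (Ivl × Ivl) →ₗ[ZMod 2] Chain (Ivl × Ivl)) :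
    ∀ e, Chain (Hemi × Hemi) →ₗ[ZMod 2] Chain (Pw (Ivl × Ivl) e)
  | 0 => toUnit (Hemi × Hemi)
  | e + 1 => tmap l (iter l e) ∘ₗ split11

variable {l : Chain (Ivl × Ivl) →ₗ[ZMod 2] Chain (Ivl × Ivl)}

theorem isChainMap_iter (hl : IsChainMap l) : ∀ e, IsChainMap (iter l e)
  | 0 => isChainMap_toUnit
  | e + 1 => (hl.tmap (isChainMap_iter hl e)).comp isChainMap_split11

theorem iter_equivariant {Γ : Type} [Group Γ] {α : CellAction Γ (Hemi × Hemi)}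
    {β γ : CellAction Γ (Ivl × Ivl)} (hs : Equivariant α (β.prod α) split11)
    (hl : Equivariant β γ l) : ∀ e, Equivariant α (γ.pw e) (iter l e)
  | 0 => fun g x => by
    have : (ε (act (α.ρ g) x)) • (cell () : Chain Unit) = act id (ε x • cell ()) := by
      rw [act_id, α.ε_act]
    exact this
  | e + 1 => (hl.tmap (iter_equivariant hs hl e)).comp hs

/-- The coefficient of the open square. -/
noncomputable def top2 : Chain (Ivl × Ivl) →ₗ[ZMod 2] ZMod 2 := tfun Ivl.top Ivl.top

theorem tfun_split11 (f : Chain (Hemi × Hemi) →ₗ[ZMod 2] ZMod 2) (x : Chain (Hemi × Hemi)) :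
    tfun top2 f (split11 x) = f (tmap opp opp x) :=
  LinearMap.congr_fun (f := tfun top2 f ∘ₗ split11) (g := f ∘ₗ tmap opp opp)
    (hom_ext fun (a, b) => by
      change tfun _ f (act shuf (tmap split1 split1 (cell (a, b)))) =
        f (tmap opp opp (cell (a, b)))
      rw [← cell_tens_cell, tmap_tens, tmap_tens, split1, split_cell, split_cell]
      simp only [map_add, LinearMap.add_apply, act_shuf_tens, tfun_tens, top2, Ivl.top_pt,
        Ivl.top_mid]
      ring) x

theorem top_iter (hl : ∀ x, top2 (l x) = top2 x) : ∀ (e : ℕ) (x y : Hemi),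
    Pw.top top2 e (iter l e (cell (x, y))) = if x.i = e ∧ y.i = e then 1 else 0
  | 0, ⟨s, i⟩, ⟨t, j⟩ => by
    change ε (ε (cell _) • (cell () : Chain Unit)) = _
    rw [← cell_tens_cell, ε_tens, map_smul, ε_unit]
    cases i <;> cases j <;> simp
  | e + 1, ⟨s, i⟩, ⟨t, j⟩ => by
    change tfun top2 (Pw.top top2 e) (tmap l (iter l e) (split11 _)) = _
    rw [tfun_tmap, show top2 ∘ₗ l = top2 from LinearMap.ext hl, tfun_split11, ← cell_tens_cell,
      tmap_tens]
    cases i <;> cases j <;>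
      simp [cell_tens_cell, top_iter hl e]

end Hemi

namespace Ivl

open CellAction

/-- A chain map of the square intertwining the independent negations of the two factors with the
symmetries interchanging the factors. -/
noncomputable def diag : Chain (Ivl × Ivl) →ₗ[ZMod 2] Chain (Ivl × Ivl) := lift fun x => match x with
  | (pos, pos) => cell (pos, pos)
  | (pos, neg) => cell (pos, pos)
  | (neg, pos) => cell (neg, neg)
  | (neg, neg) => cell (neg, neg)
  | (mid, pos) => cell (mid, neg) + cell (pos, mid)
  | (mid, neg) => cell (neg, mid) + cell (mid, pos)
  | (pos, mid) => 0
  | (neg, mid) => 0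
  | (mid, mid) => cell (mid, mid)

theorem d_cell_prod {A B : Type} [CellComplex A] [CellComplex B] (a : A) (b : B) :
    d (cell (a, b)) = tens (d (cell a)) (cell b) + tens (cell a) (d (cell b)) := by
  rw [← cell_tens_cell, d_tens]

theorem ε_cell_prod {A B : Type} [CellComplex A] [CellComplex B] (a : A) (b : B) :
    ε (cell (a, b)) = ε (cell a) * ε (cell b) := by
  rw [← cell_tens_cell, ε_tens]

theorem isChainMap_diag : IsChainMap diag := by
  refine .of_cell (fun (x, y) => ?_) fun (x, y) => ?_
  · cases x <;> cases y <;>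
      simp [diag, d_cell_prod, cell_tens_cell, add_self]
    all_goals
      first
        | module
        | linear_combination (norm := module) add_self (cell (pos, neg))
        | linear_combination (norm := module) add_self (cell (neg, pos))
  · cases x <;> cases y <;> simp [diag, ε_cell_prod]

theorem diag_equivariant : Equivariant (bi Ivl) (pair Ivl) diag := by
  have hn : ∀ x : Ivl × Ivl, -x = (-x.1, -x.2) := fun _ => rfl
  refine .of_signs (fun x => ?_) fun x => ?_
  · rw [bi_fst, pair_fst]
    refine LinearMap.congr_fun (f := diag ∘ₗ act (Prod.map Neg.neg id))
      (g := act (fun x => -x.swap) ∘ₗ diag) (hom_ext fun (x, y) => ?_) x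
    cases x <;> cases y <;> simp [diag, hn, add_comm]
  · rw [bi_snd, pair_snd]
    refine LinearMap.congr_fun (f := diag ∘ₗ act (Prod.map id Neg.neg))
      (g := act Prod.swap ∘ₗ diag) (hom_ext fun (x, y) => ?_) x
    cases x <;> cases y <;> simp [diag, add_comm]

theorem top2_cell (x y : Ivl) : Hemi.top2 (cell (x, y)) = top (cell x) * top (cell y) := by
  rw [← cell_tens_cell, Hemi.top2, tfun_tens]

theorem top2_diag (x : Chain (Ivl × Ivl)) : Hemi.top2 (diag x) = Hemi.top2 x := by
  refine LinearMap.congr_fun (f := Hemi.top2 ∘ₗ diag) (g := Hemi.top2) (hom_ext fun (x, y) => ?_) x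
  rw [LinearMap.comp_apply, diag, lift_cell]
  cases x <;> cases y <;> simp [top2_cell]

end Ivl

namespace Hemi

open CellAction

/-- The iterated splitting of a product of two spheres along the product of the signs, followed by
the splitting of both factors. -/
noncomputable def full (e : ℕ) :
    ∀ N, Chain (Hemi × Hemi) →ₗ[ZMod 2] Chain (Pw Ivl N × Pw (Ivl × Ivl) e)
  | 0 => tens (cell ()) ∘ₗ iter Ivl.diag e
  | N + 1 => act assocInv ∘ₗ tmap .id (full e N) ∘ₗ split2

theorem isChainMap_full (e : ℕ) : ∀ N, IsChainMap (full e N)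
  | 0 => by
    have h := isChainMap_iter Ivl.isChainMap_diag e
    have : IsChainMap (tens (A := Unit) (B := Pw (Ivl × Ivl) e) (cell ())) :=
      .of_cell (fun b => by simp) fun b => by simp
    exact this.comp h
  | N + 1 => isChainMap_assocInv.comp ((IsChainMap.id.tmap (isChainMap_full e N)).comp
      isChainMap_split2)

theorem tmap_split2_act {P C : Type} [CellComplex P] [CellComplex C]
    {h : Chain (Hemi × Hemi) →ₗ[ZMod 2] Chain (P × C)}
    {τ : Hemi × Hemi → Hemi × Hemi} {p : P → P} {c : C → C}
    (hs : ∀ x, split2 (act τ x) = act (Prod.map Neg.neg τ) (split2 x))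
    (hh : ∀ x, h (act τ x) = act (Prod.map p c) (h x)) (x : Chain (Hemi × Hemi)) :
    act assocInv (tmap .id h (split2 (act τ x))) =
      act (Prod.map (Prod.map Neg.neg p) c) (act assocInv (tmap .id h (split2 x))) := by
  rw [hs, tmap_act (P := Neg.neg) (f := .id) (fun _ => rfl) hh, act_act, act_act]
  rfl

theorem full_equivariant (e : ℕ) :
    ∀ N, Equivariant (bi Hemi) ((mulAntipodal (Pw Ivl N)).prod ((pair Ivl).pw e)) (full e N)
  | 0 => fun g x => by
    have h := iter_equivariant split11_bi Ivl.diag_equivariant e g x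
    have h2 := act_map_tens ((mulAntipodal (Pw Ivl 0)).ρ g) (((pair Ivl).pw e).ρ g) (cell ())
      (iter Ivl.diag e x)
    rw [← h] at h2
    exact (h2.trans (congrArg (fun z => tens z _) (act_cell _ _))).symm
  | N + 1 => by
    have ih := full_equivariant e N
    refine .of_signs (fun x => ?_) fun x => ?_
    · have h2 := tmap_split2_act (h := full e N) (p := (mulAntipodal (Pw Ivl N)).ρ (-1, 1))
        (c := ((pair Ivl).pw e).ρ (-1, 1)) split2_act_fst (fun x => by
          rw [← bi_fst]
          exact ih (-1, 1) x) x
      rw [bi_fst]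
      refine h2.trans (congrArg (fun p => act p _) ?_)
      change Prod.map _ _ = Prod.map ((mulAntipodal (Pw Ivl (N + 1))).ρ (-1, 1)) _
      rw [mulAntipodal_fst, mulAntipodal_fst]
      rfl
    · have h2 := tmap_split2_act (h := full e N) (p := (mulAntipodal (Pw Ivl N)).ρ (1, -1))
        (c := ((pair Ivl).pw e).ρ (1, -1)) split2_act_snd (fun x => by
          rw [← bi_snd]
          exact ih (1, -1) x) x
      rw [bi_snd]
      refine h2.trans (congrArg (fun p => act p _) ?_)
      change Prod.map _ _ = Prod.map ((mulAntipodal (Pw Ivl (N + 1))).ρ (1, -1)) _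
      rw [mulAntipodal_snd, mulAntipodal_snd]
      rfl

theorem tfun_assocInv {A B C : Type} [CellComplex A] [CellComplex B] [CellComplex C]
    (f : Chain A →ₗ[ZMod 2] ZMod 2)
    (g : Chain B →ₗ[ZMod 2] ZMod 2) (h : Chain C →ₗ[ZMod 2] ZMod 2) (x : Chain (A × B × C)) :
    tfun (tfun f g) h (act assocInv x) = tfun f (tfun g h) x :=
  LinearMap.congr_fun (f := tfun (tfun f g) h ∘ₗ act assocInv) (g := tfun f (tfun g h))
    (hom_ext fun (a, b, c) => by
      simp [← cell_tens_cell, mul_assoc]) x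

/-- The functional on products of two spheres given by binomial coefficients. -/
theorem top_full (e : ℕ) : ∀ (N : ℕ) (x y : Hemi),
    tfun (Pw.top Ivl.top N) (Pw.top top2 e) (full e N (cell (x, y))) =
      if x.i + y.i = N + 2 * e ∧ e ≤ x.i then (N.choose (x.i - e) : ZMod 2) else 0
  | 0, ⟨s, i⟩, ⟨t, j⟩ => by
    change tfun ε (Pw.top top2 e) (tens (cell ()) (iter Ivl.diag e (cell _))) = _
    rw [tfun_tens, top_iter Ivl.top2_diag, ε_unit, one_mul]
    simp only [zero_add]
    by_cases h : i = e ∧ j = e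
    · obtain ⟨rfl, rfl⟩ := h
      simp [two_mul]
    · rw [if_neg h]
      split_ifs with h2
      · rw [Nat.choose_eq_zero_of_lt (by omega), Nat.cast_zero]
      · rfl
  | N + 1, ⟨s, i⟩, ⟨t, j⟩ => by
    change tfun (tfun Ivl.top (Pw.top Ivl.top N)) (Pw.top top2 e)
      (act assocInv (tmap .id (full e N) (split2 (cell _)))) = _
    rw [tfun_assocInv, tfun_tmap, show Ivl.top ∘ₗ LinearMap.id = Ivl.top from rfl, split2,
      tfun_split, ← cell_tens_cell, opp2_tens, map_add, LinearMap.comp_apply, LinearMap.comp_apply]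
    have ih := top_full e N
    have e1 : tfun (Pw.top Ivl.top N) (Pw.top top2 e) (full e N (tens (opp (cell ⟨s, i⟩))
        (cell ⟨t, j⟩))) = if i + j = N + 1 + 2 * e ∧ e + 1 ≤ i then
          (N.choose (i - (e + 1)) : ZMod 2) else 0 := by
      rcases i with _ | i
      · simp
      · rw [opp_succ, cell_tens_cell, ih]
        simp only [Nat.add_sub_add_right]
        congr 1
        simp only [eq_iff_iff]
        omega
    have e2 : tfun (Pw.top Ivl.top N) (Pw.top top2 e) (full e N (tens (cell ⟨s, i⟩)
        (opp (cell ⟨t, j⟩)))) = if i + j = N + 1 + 2 * e ∧ e ≤ i then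
          (N.choose (i - e) : ZMod 2) else 0 := by
      rcases j with _ | j
      · rw [opp_zero, map_zero, map_zero, map_zero]
        split_ifs with h
        · rw [Nat.choose_eq_zero_of_lt (by omega), Nat.cast_zero]
        · rfl
      · rw [opp_succ, cell_tens_cell, ih]
        congr 1
        simp only [eq_iff_iff]
        omega
    rw [e1, e2]
    simp only
    by_cases h1 : i + j = N + 1 + 2 * e
    · simp only [h1, true_and]
      obtain h2 | rfl | h2 := lt_trichotomy e i
      · obtain ⟨k, rfl⟩ := Nat.exists_eq_add_of_lt h2
        rw [if_pos (by omega), if_pos (by omega), if_pos (by omega),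
          show e + k + 1 - (e + 1) = k by omega, show e + k + 1 - e = k + 1 by omega,
          Nat.choose_succ_succ, Nat.cast_add]
      · simp
      · rw [if_neg (by omega), if_neg (by omega), if_neg (by omega), add_zero]
    · simp [h1]

/-- The functional detecting cells of a given dimension. -/
noncomputable def inDim (e : ℕ) : Chain Hemi →ₗ[ZMod 2] ZMod 2 :=
  lift fun b => if b.i = e then 1 else 0

theorem acyclic_target (N e : ℕ) :
    IsAcyclicOn (Set.univ : Set (Pw Ivl N × Pw (Ivl × Ivl) e)) := by
  have h2 := Ivl.isAcyclicOn.prod Ivl.isAcyclicOn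
  rw [Set.univ_prod_univ] at h2
  have h1 := (Pw.isAcyclicOn Ivl.isAcyclicOn N).prod (Pw.isAcyclicOn h2 e)
  rwa [Set.univ_prod_univ] at h1

theorem top_sg (N : ℕ) (s : ℤˣ) (x : Chain (Pw Ivl N)) :
    Pw.top Ivl.top N (act (sg s) x) = Pw.top Ivl.top N x := by
  rcases Int.units_eq_one_or s with rfl | rfl
  · rw [show sg (1 : ℤˣ) = (id : Pw Ivl N → _) from funext sg_one, act_id]
  · rw [show sg (-1 : ℤˣ) = (Neg.neg : Pw Ivl N → _) from funext sg_neg_one]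
    exact Pw.top_act_neg Ivl.top_act_neg N x

theorem top2_pair (g : ℤˣ × ℤˣ) (x : Chain (Ivl × Ivl)) :
    top2 (act ((pair Ivl).ρ g) x) = top2 x := by
  have h1 : ∀ x, top2 (act (fun x : Ivl × Ivl => -x.swap) x) = top2 x := fun x => by
    rw [show (fun x : Ivl × Ivl => -x.swap) = Prod.map Neg.neg Neg.neg ∘ Prod.swap from rfl,
      ← act_act]
    exact (tfun_act_map Ivl.top_act_neg Ivl.top_act_neg _).trans (tfun_swap _ _)
  have h2 : ∀ x, top2 (act Prod.swap x) = top2 x := tfun_swap _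
  obtain ⟨s, t⟩ := g
  rcases Int.units_eq_one_or s with rfl | rfl <;> rcases Int.units_eq_one_or t with rfl | rfl
  · rw [show (pair Ivl).ρ (1, 1) = id from funext (pair Ivl).one, act_id]
  · rw [pair_snd, h2]
  · rw [pair_fst, h1]
  · rw [show ((-1, -1) : ℤˣ × ℤˣ) = (-1, 1) * (1, -1) by simp, act_mul, pair_snd, pair_fst,
      h1, h2]

theorem top2_pw (g : ℤˣ × ℤˣ) : ∀ n (x : Chain (Pw (Ivl × Ivl) n)),
    Pw.top top2 n (act (((pair Ivl).pw n).ρ g) x) = Pw.top top2 n x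
  | 0 => fun x => congrArg _ (act_id x)
  | n + 1 => tfun_act_map (top2_pair g) (top2_pw g n)

theorem top_tmap_iter {N e : ℕ} (z : Chain (Pw Ivl N × Hemi × Hemi)) :
    tfun (Pw.top Ivl.top N) (Pw.top top2 e) (tmap .id (iter .id e) z) =
      tfun (Pw.top Ivl.top N) (tfun (inDim e) (inDim e)) z := by
  have e1 : Pw.top top2 e ∘ₗ iter .id e = tfun (inDim e) (inDim e) := hom_ext fun (a, b) => by
    rw [LinearMap.comp_apply, top_iter (l := .id) (fun _ => rfl), ← cell_tens_cell, tfun_tens, inDim,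
      lift_cell, lift_cell]
    split_ifs <;> simp_all
  rw [tfun_tmap, e1]
  rfl

theorem coefficient {N e : ℕ} {G : Chain (Hemi × Hemi) →ₗ[ZMod 2] Chain (Pw Ivl N × Hemi × Hemi)}
    (hG : IsChainMap G)
    (hG' : Equivariant (bi Hemi) ((mulAntipodal (Pw Ivl N)).prod (pair Hemi)) G) (x y : Hemi) :
    tfun (Pw.top Ivl.top N) (tfun (inDim e) (inDim e)) (G (cell (x, y))) =
      if x.i + y.i = N + 2 * e ∧ e ≤ x.i then (N.choose (x.i - e) : ZMod 2) else 0 := by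
  rw [← top_full, ← top_tmap_iter]
  have hid : Equivariant (mulAntipodal (Pw Ivl N)) (mulAntipodal (Pw Ivl N)) .id := fun _ _ => rfl
  have hid2 : Equivariant (pair Ivl) (pair Ivl) .id := fun _ _ => rfl
  have hm : IsChainMap (tmap .id (iter .id e) ∘ₗ G) :=
    IsChainMap.comp (.tmap .id (isChainMap_iter .id e)) hG
  have hm' := isChainMap_full e N
  have hE : Equivariant (bi Hemi) ((mulAntipodal (Pw Ivl N)).prod ((pair Ivl).pw e))
      (tmap .id (iter .id e) ∘ₗ G) := (hid.tmap (iter_equivariant split11_pair hid2 e)).comp hG'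
  have h1 : ∀ g (x : Chain (Pw Ivl N × Pw (Ivl × Ivl) e)),
      tfun (Pw.top Ivl.top N) (Pw.top top2 e)
        (act (((mulAntipodal (Pw Ivl N)).prod ((pair Ivl).pw e)).ρ g) x) =
      tfun (Pw.top Ivl.top N) (Pw.top top2 e) x :=
    fun g => tfun_act_map (top_sg N _) (top2_pw g e)
  have h2 : ∀ x : Chain (Pw Ivl N × Pw (Ivl × Ivl) e),
      tfun (Pw.top Ivl.top N) (Pw.top top2 e) (d x) = 0 :=
    tfun_d (Pw.top_d Ivl.top_d N) (Pw.top_d (tfun_d Ivl.top_d Ivl.top_d) e)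
  exact functional_eq (bi Hemi) ((mulAntipodal (Pw Ivl N)).prod ((pair Ivl).pw e))
    (S := Set.univ) (fun _ _ _ => Set.mem_univ _) (fun g x _ => bi_free neg_ne g x)
    (fun _ _ => mem_on_univ _) (acyclic_target N e) hE
    (full_equivariant e N) (fun b _ => ⟨hm.d_map _, hm.ε_map _⟩)
    (fun b _ => ⟨hm'.d_map _, hm'.ε_map _⟩) h1 h2 (mem_on_univ _)
    fun f hf => bi_functional_d hf _

end Hemi

section TreeConstruction

open CellAction

/-- Distributing the last two factors of a fivefold product. -/
def distrib {P A B C D : Type} (x : (P × A × B) × C × D) : P × (A × C) × B × D :=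
  (x.1.1, shuf (x.1.2, x.2))

section Distrib

variable {P A B C D : Type} [CellComplex P] [CellComplex A] [CellComplex B] [CellComplex C]
  [CellComplex D]

theorem isChainMap_distrib :
    IsChainMap (act (distrib (P := P) (A := A) (B := B) (C := C) (D := D))) := by
  have h : ∀ (p : Chain P) (z : Chain ((A × B))) (w : Chain (C × D)),
      act distrib (tens (tens p z) w) = tens p (act shuf (tens z w)) := fun p z w => by
    have h3 : ∀ (p : P) (z : A × B) (w : C × D),
        act distrib (tens (tens (cell p) (cell z)) (cell w)) =
          tens (cell p) (act shuf (tens (cell z) (cell w))) := fun p z w => by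
      simp [cell_tens_cell, distrib]
    have h2 : ∀ (p : Chain P) (z : A × B) (w : C × D),
        act distrib (tens (tens p (cell z)) (cell w)) =
          tens p (act shuf (tens (cell z) (cell w))) := fun p z w =>
      LinearMap.congr_fun (f := act distrib ∘ₗ tens.flip (cell w) ∘ₗ tens.flip (cell z))
        (g := tens.flip (act shuf (tens (cell z) (cell w))))
        (hom_ext fun p => by simpa using h3 p z w) p
    have h1 : ∀ (p : Chain P) (z : Chain (A × B)) (w : C × D),
        act distrib (tens (tens p z) (cell w)) =
          tens p (act shuf (tens z (cell w))) := fun p z w =>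
      LinearMap.congr_fun (f := act distrib ∘ₗ tens.flip (cell w) ∘ₗ tens p)
        (g := tens p ∘ₗ act shuf ∘ₗ tens.flip (cell w))
        (hom_ext fun z => by simpa using h2 p z w) z
    exact LinearMap.congr_fun (f := act distrib ∘ₗ tens (tens p z))
        (g := tens p ∘ₗ act shuf ∘ₗ tens z)
        (hom_ext fun w => by simpa using h1 p z w) w
  refine .of_cell (fun ((p, z), w) => ?_) fun ((p, z), w) => ?_
  · simp only [← cell_tens_cell, h, d_tens, isChainMap_shuf.d_map, map_add, LinearMap.add_apply]
    module
  · rw [← cell_tens_cell, ← cell_tens_cell, h, ε_tens, isChainMap_shuf.ε_map, ε_tens, ε_tens,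
      ε_tens, mul_assoc]

theorem tfun_distrib (f : Chain P →ₗ[ZMod 2] ZMod 2) (g : Chain (A × C) →ₗ[ZMod 2] ZMod 2)
    (h : Chain (B × D) →ₗ[ZMod 2] ZMod 2) (z : Chain (P × A × B)) (c : C) (e : D) :
    tfun f (tfun g h) (act distrib (tens z (cell (c, e)))) =
      tfun f (tfun (g ∘ₗ tens.flip (cell c)) (h ∘ₗ tens.flip (cell e))) z :=
  LinearMap.congr_fun
    (f := tfun f (tfun g h) ∘ₗ act distrib ∘ₗ tens.flip (cell (c, e)))
    (g := tfun f (tfun (g ∘ₗ tens.flip (cell c)) (h ∘ₗ tens.flip (cell e))))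
    (hom_ext fun (p, a, b) => by
      simp only [LinearMap.comp_apply, LinearMap.flip_apply, cell_tens_cell, act_cell, distrib,
        shuf]
      simp only [← cell_tens_cell, tfun_tens, LinearMap.comp_apply, LinearMap.flip_apply]) z

end Distrib

theorem Pw.deg_of_top_ne_zero : ∀ N (p : Pw Ivl N), Pw.top Ivl.top N (cell p) ≠ 0 → deg p = N
  | 0, _, _ => rfl
  | N + 1, (a, p), h => by
    have e : Pw.top Ivl.top (N + 1) (cell (B := Ivl × Pw Ivl N) (a, p)) =
        Ivl.top (cell a) * Pw.top Ivl.top N (cell p) := by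
      rw [← cell_tens_cell]
      exact tfun_tens _ _ _ _
    have h' : Ivl.top (cell a) * Pw.top Ivl.top N (cell p) ≠ 0 := fun h0 => h (e.trans h0)
    have h1 := Pw.deg_of_top_ne_zero N p (right_ne_zero_of_mul h')
    have h2 := left_ne_zero_of_mul h'
    change deg a + deg p = N + 1
    rw [h1]
    cases a
    · simp at h2
    · simp at h2
    · exact add_comm _ _

/-- Chain maps into the tree power compatible with all symmetries. -/
structure IsTreeMap (N r : ℕ) (Φ : Chain (Hemi × Tr Hemi r) →ₗ[ZMod 2] Chain (Tr (Pw Ivl N) r)) :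
    Prop where
  chain : IsChainMap Φ
  tree : ∀ g x, Φ (act (Prod.map id (Tr.ρ r g)) x) = act (Tr.ρ r g) (Φ x)
  neg : ∀ x, Φ (act (Prod.map Neg.neg Neg.neg) x) = Φ x

section Step

variable {P T : Type} [CellComplex P] [CellComplex T]

/-- The first part of the recursion for tree maps. -/
noncomputable def spread (G : Chain (Hemi × Hemi) →ₗ[ZMod 2] Chain (P × Hemi × Hemi)) :
    Chain (Hemi × Hemi × T × T) →ₗ[ZMod 2] Chain (P × (Hemi × T) × Hemi × T) :=
  act distrib ∘ₗ tmap G .id ∘ₗ act assocInv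

theorem spread_act {G : Chain (Hemi × Hemi) →ₗ[ZMod 2] Chain (P × Hemi × Hemi)}
    {τ : Hemi × Hemi → Hemi × Hemi} {σ : P × Hemi × Hemi → P × Hemi × Hemi}
    (hG : ∀ x, G (act τ x) = act σ (G x)) (κ : T × T → T × T)
    {α : Hemi × Hemi × T × T → Hemi × Hemi × T × T}
    {β : P × (Hemi × T) × Hemi × T → P × (Hemi × T) × Hemi × T}
    (hα : assocInv ∘ α = Prod.map τ κ ∘ assocInv)
    (hβ : distrib ∘ Prod.map σ κ = β ∘ distrib) (x : Chain (Hemi × Hemi × T × T)) :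
    spread G (act α x) = act β (spread G x) := by
  rw [spread, LinearMap.comp_apply, LinearMap.comp_apply, act_act, hα, ← act_act,
    tmap_act (Q := κ) (g := .id) (g' := .id) hG (fun _ => rfl), act_act, hβ, ← act_act]
  rfl

end Step

/-- The recursion for tree maps. -/
noncomputable def nextMap {P T U : Type} [CellComplex P] [CellComplex T] [CellComplex U]
    (G : Chain (Hemi × Hemi) →ₗ[ZMod 2] Chain (P × Hemi × Hemi))
    (Φ : Chain (Hemi × T) →ₗ[ZMod 2] Chain U) :
    Chain (Hemi × Hemi × T × T) →ₗ[ZMod 2] Chain (P × U × U) :=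
  tmap .id (tmap Φ Φ) ∘ₗ spread G

theorem isTreeMap_nextMap {N r : ℕ}
    {G : Chain (Hemi × Hemi) →ₗ[ZMod 2] Chain (Pw Ivl N × Hemi × Hemi)} (hG : IsChainMap G)
    (hG' : Equivariant (bi Hemi) ((mulAntipodal (Pw Ivl N)).prod (pair Hemi)) G)
    {Φ : Chain (Hemi × Tr Hemi r) →ₗ[ZMod 2] Chain (Tr (Pw Ivl N) r)} (hΦ : IsTreeMap N r Φ) :
    IsTreeMap N (r + 1) (nextMap G Φ) where
  chain := (IsChainMap.id.tmap (hΦ.chain.tmap hΦ.chain)).comp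
    (isChainMap_distrib.comp ((hG.tmap .id).comp isChainMap_assocInv))
  tree g x := by
    change Wr (W r) at g
    obtain ⟨a, b, rfl | rfl⟩ := Wr.cases g
    · rw [Tr.ρ_one_fun, Tr.ρ_one_fun]
      have h : ∀ x, nextMap G Φ (act (Prod.map id (Prod.map id (Prod.map (Tr.ρ r a) (Tr.ρ r b)))) x)
          = act (Prod.map id (Prod.map (Tr.ρ r a) (Tr.ρ r b))) (nextMap G Φ x) := fun x => by
        rw [nextMap, LinearMap.comp_apply,
          spread_act (τ := id) (σ := id) (fun x => map_act_id G x)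
            (Prod.map (Tr.ρ r a) (Tr.ρ r b)) (β := Prod.map id (Prod.map
              (Prod.map id (Tr.ρ r a)) (Prod.map id (Tr.ρ r b)))) rfl rfl,
          tmap_act (P := id) (Q := Prod.map (Tr.ρ r a) (Tr.ρ r b)) (f := .id) (f' := .id) (fun _ => rfl)
            (tmap_act (hΦ.tree a) (hΦ.tree b))]
        rfl
      exact h x
    · rw [Tr.ρ_neg_one_fun, Tr.ρ_neg_one_fun]
      have hg : ∀ x, G (act (Prod.map id Neg.neg) x) = act (Prod.map Neg.neg Prod.swap) (G x) :=
        fun x => by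
          have := hG' (1, -1) x
          rw [bi_snd] at this
          rw [this]
          change act (Prod.map _ _) _ = _
          rw [mulAntipodal_snd, pair_snd]
      have h : ∀ x, nextMap G Φ (act (Prod.map id (Prod.map Neg.neg
            (Prod.map (Tr.ρ r a) (Tr.ρ r b) ∘ Prod.swap))) x)
          = act (Prod.map Neg.neg (Prod.map (Tr.ρ r a) (Tr.ρ r b) ∘ Prod.swap))
            (nextMap G Φ x) := fun x => by
        rw [nextMap, LinearMap.comp_apply,
          spread_act hg
            (Prod.map (Tr.ρ r a) (Tr.ρ r b) ∘ Prod.swap) (β := Prod.map Neg.neg (Prod.map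
              (Prod.map id (Tr.ρ r a)) (Prod.map id (Tr.ρ r b)) ∘ Prod.swap)) rfl rfl,
          tmap_act (P := Neg.neg) (Q := Prod.map (Tr.ρ r a) (Tr.ρ r b) ∘ Prod.swap) (f := .id) (f' := .id)
            (fun _ => rfl) fun x => by
              rw [← act_act, tmap_act (hΦ.tree a) (hΦ.tree b), tmap_swap, act_act]]
        rfl
      exact h x
  neg x := by
    have hg : ∀ x, G (act (Prod.map Neg.neg Neg.neg) x) =
        act (Prod.map id (Prod.map Neg.neg Neg.neg)) (G x) := fun x => by
      have h1 := hG' (1, -1)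
      have h2 := hG' (-1, 1)
      change ∀ x, _ = act (Prod.map _ _) _ at h1 h2
      rw [bi_snd, mulAntipodal_snd, pair_snd] at h1
      rw [bi_fst, mulAntipodal_fst, pair_fst] at h2
      rw [show (Prod.map Neg.neg Neg.neg : Hemi × Hemi → _) =
        Prod.map Neg.neg id ∘ Prod.map id Neg.neg from rfl, ← act_act, h2, h1, act_act]
      congr 2
      funext ⟨p, a, b⟩
      simp only [Function.comp_apply, Prod.map_apply, neg_neg, Prod.swap_prod_mk, id_eq]
      rfl
    have h : ∀ x, nextMap G Φ (act (Prod.map Neg.neg (Prod.map Neg.neg (Prod.map Neg.neg Neg.neg))) x)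
        = nextMap G Φ x := fun x => by
      rw [nextMap, LinearMap.comp_apply,
        spread_act hg (Prod.map Neg.neg Neg.neg) (β := Prod.map id (Prod.map
            (Prod.map Neg.neg Neg.neg) (Prod.map Neg.neg Neg.neg))) rfl rfl,
        tmap_act (P := id) (Q := Prod.map id id) (f := .id) (f' := .id) (fun _ => rfl)
          (tmap_act (P := id) (Q := id) (fun x => by rw [hΦ.neg, act_id])
            fun x => by rw [hΦ.neg, act_id])]
      rw [Prod.map_id, Prod.map_id, act_id]
      rfl
    exact h x

/-- The functional on spheres given by a tree map. -/
noncomputable def branch {N r : ℕ} (n : ℕ)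
    (Φ : Chain (Hemi × Tr Hemi r) →ₗ[ZMod 2] Chain (Tr (Pw Ivl N) r)) :
    Chain Hemi →ₗ[ZMod 2] ZMod 2 :=
  (Tr.top (Pw.top Ivl.top N) r ∘ₗ Φ) ∘ₗ tens.flip (cell (Tr.const ⟨1, n⟩ r))

theorem branch_apply {N r : ℕ} (n : ℕ)
    (Φ : Chain (Hemi × Tr Hemi r) →ₗ[ZMod 2] Chain (Tr (Pw Ivl N) r)) (x : Chain Hemi) :
    branch n Φ x = Tr.top (Pw.top Ivl.top N) r (Φ (tens x (cell (Tr.const ⟨1, n⟩ r)))) := rfl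




theorem nextMap_top {N r : ℕ}
    (G : Chain (Hemi × Hemi) →ₗ[ZMod 2] Chain (Pw Ivl N × Hemi × Hemi))
    (Φ : Chain (Hemi × Tr Hemi r) →ₗ[ZMod 2] Chain (Tr (Pw Ivl N) r))
    (b y : Hemi) (t u : Tr Hemi r) :
    tfun (Pw.top Ivl.top N)
      (tfun (Tr.top (Pw.top Ivl.top N) r) (Tr.top (Pw.top Ivl.top N) r))
      (nextMap G Φ (cell (b, y, t, u))) = tfun (Pw.top Ivl.top N)
      (tfun ((Tr.top (Pw.top Ivl.top N) r ∘ₗ Φ) ∘ₗ tens.flip (cell t))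
      ((Tr.top (Pw.top Ivl.top N) r ∘ₗ Φ) ∘ₗ tens.flip (cell u))) (G (cell (b, y))) := by
  have e : tfun (Tr.top (Pw.top Ivl.top N) r) (Tr.top (Pw.top Ivl.top N) r) ∘ₗ tmap Φ Φ =
      tfun (Tr.top (Pw.top Ivl.top N) r ∘ₗ Φ) (Tr.top (Pw.top Ivl.top N) r ∘ₗ Φ) :=
    LinearMap.ext fun x => tfun_tmap _ _ x
  rw [nextMap, LinearMap.comp_apply, tfun_tmap, e, spread, LinearMap.comp_apply,
    LinearMap.comp_apply, act_cell, assocInv, ← cell_tens_cell, tmap_tens]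
  exact tfun_distrib _ _ _ _ _ _

/-- The recursion for tree maps. -/
noncomputable def nextTree {N r : ℕ}
    (G : Chain (Hemi × Hemi) →ₗ[ZMod 2] Chain (Pw Ivl N × Hemi × Hemi))
    (Φ : Chain (Hemi × Tr Hemi r) →ₗ[ZMod 2] Chain (Tr (Pw Ivl N) r)) :
    Chain (Hemi × Tr Hemi (r + 1)) →ₗ[ZMod 2] Chain (Tr (Pw Ivl N) (r + 1)) :=
  nextMap G Φ


theorem Tr.top_succ {A : Type} [CellComplex A] (φ : Chain A →ₗ[ZMod 2] ZMod 2) (r) : Tr.top φ (r+1) = tfun φ (tfun (Tr.top φ r) (Tr.top φ r)) := rfl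

theorem cell_const_succ (b n r) : (cell (b, Tr.const ⟨1, n⟩ (r+1)) : Chain (Hemi × Tr Hemi (r+1))) = (cell (b, (⟨1,n⟩ : Hemi), Tr.const ⟨1, n⟩ r, Tr.const ⟨1, n⟩ r) : Chain (Hemi × Hemi × Tr Hemi r × Tr Hemi r)) := rfl

theorem branch_nextTree {N r n : ℕ}
    (G : Chain (Hemi × Hemi) →ₗ[ZMod 2] Chain (Pw Ivl N × Hemi × Hemi))
    (Φ : Chain (Hemi × Tr Hemi r) →ₗ[ZMod 2] Chain (Tr (Pw Ivl N) r)) (b : Hemi) :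
    branch n (nextTree G Φ) (cell b) = tfun (Pw.top Ivl.top N)
      (tfun (branch n Φ) (branch n Φ)) (G (cell (b, ⟨1, n⟩))) := by
  have h := nextMap_top G Φ b ⟨1, n⟩ (Tr.const ⟨1, n⟩ r) (Tr.const ⟨1, n⟩ r)
  rw [branch_apply, cell_tens_cell]
  refine Eq.trans ?_ h
  rw [Tr.top_succ]
  refine congrArg (tfun (Pw.top Ivl.top N) (tfun (Tr.top (Pw.top Ivl.top N) r) (Tr.top (Pw.top Ivl.top N) r))) ?_
  refine congrArg (nextMap G Φ) ?_
  exact cell_const_succ b n r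

theorem exists_isTreeMap (n : ℕ) : ∀ r : ℕ, (∀ j ≤ r, Odd ((n + 2).choose (2 ^ j))) →
    ∃ Φ, IsTreeMap (n + 2) r Φ ∧ ∀ b : Hemi, b.i ≤ 2 * (2 ^ r - 1) →
      branch n Φ (cell b) = if b.i = 2 * (2 ^ r - 1) then 1 else 0
  | 0, _ => by
    refine ⟨toUnit (Hemi × Unit), ⟨isChainMap_toUnit, fun g x => ?_, fun x => ?_⟩,
      fun ⟨s, i⟩ hi => ?_⟩
    · exact (map_act_id (toUnit (Hemi × Unit)) x)
    · have h : ∀ x : Hemi × Unit, ε (cell (Prod.map Neg.neg Neg.neg x)) = ε (cell x) :=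
        fun (b, _) => by
          rw [Prod.map_apply, ← cell_tens_cell, ← cell_tens_cell, ε_tens, ε_tens, SymmComplex.ε_neg]
      have h2 : ∀ x : Chain (Hemi × Unit), ε (act (Prod.map Neg.neg Neg.neg) x) = ε x :=
        LinearMap.congr_fun (f := ε ∘ₗ act (Prod.map Neg.neg Neg.neg : Hemi × Unit → _))
          (hom_ext fun b => by rw [LinearMap.comp_apply, act_cell, h])
      exact congrArg (· • (cell () : Chain Unit)) (h2 x)
    · obtain rfl : i = 0 := by simpa using hi
      change ε (ε (tens (cell (⟨s, 0⟩ : Hemi)) (cell ())) • (cell () : Chain Unit)) = _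
      simp
  | r + 1, hr => by
    obtain ⟨Φ, hΦ, hb⟩ := exists_isTreeMap n r fun j hj => hr j (by omega)
    have hac : IsAcyclicOn (Set.univ : Set (Pw Ivl (n + 2) × Hemi × Hemi)) := by
      have h1 := Hemi.isAcyclicOn.prod Hemi.isAcyclicOn
      have := (Pw.isAcyclicOn Ivl.isAcyclicOn (n + 2)).prod h1
      rwa [Set.univ_prod_univ, Set.univ_prod_univ] at this
    obtain ⟨G, hG', hG, hgr⟩ := exists_isChainMap (bi Hemi)
      ((mulAntipodal (Pw Ivl (n + 2))).prod (pair Hemi)) (bi_free Hemi.neg_ne) hac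
    refine ⟨nextTree G Φ, isTreeMap_nextMap hG hG' hΦ, fun b hbi => ?_⟩
    have hpow : 1 ≤ 2 ^ r := Nat.one_le_two_pow
    have hd : 2 * (2 ^ (r + 1) - 1) = 2 * (2 * (2 ^ r - 1)) + 2 := by
      rw [pow_succ]; omega
    rw [hd] at hbi ⊢
    generalize hdd : 2 * (2 ^ r - 1) = e at hb hbi
    have e1 : tfun (Pw.top Ivl.top (n + 2)) (tfun (branch n Φ) (branch n Φ))
        (G (cell (b, ⟨1, n⟩))) = tfun (Pw.top Ivl.top (n + 2))
          (tfun (Hemi.inDim e) (Hemi.inDim e)) (G (cell (b, ⟨1, n⟩))) := by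
      refine eq_on (fun ⟨p, x, y⟩ hp => ?_) (hgr (b, ⟨1, n⟩))
      rw [← cell_tens_cell, ← cell_tens_cell, tfun_tens, tfun_tens, tfun_tens, tfun_tens]
      by_cases h0 : Pw.top Ivl.top (n + 2) (cell p) = 0
      · rw [h0, zero_mul, zero_mul]
      · have h1 := Pw.deg_of_top_ne_zero _ p h0
        have h2 : deg p + (x.i + y.i) < b.i + n + 1 := hp
        rw [h1] at h2
        congr 1
        simp only [Hemi.inDim, lift_cell]
        by_cases hx : x.i ≤ e
        · by_cases hy : y.i ≤ e
          · rw [hb x hx, hb y hy]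
          · rw [hb x hx, if_neg (by omega), zero_mul, zero_mul]
        · rw [hb y (by omega), if_neg (by omega), mul_zero, mul_zero]
    rw [branch_nextTree, e1, Hemi.coefficient hG hG']
    by_cases h : b.i = 2 * e + 2
    · rw [if_pos h, if_pos ⟨by simp only; omega, by omega⟩, h,
        show 2 * e + 2 - e = 2 ^ (r + 1) by rw [pow_succ]; omega]
      exact (ZMod.natCast_eq_one_iff_odd).2 (hr (r + 1) le_rfl)
    · rw [if_neg h, if_neg]
      simp only
      omega

end TreeConstruction

/-- The cells of the subdivision of the real line at the integers. -/
inductive Lin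
  | vert (j : ℤ)
  | edge (j : ℤ)

namespace Lin

instance : InvolutiveNeg Lin where
  neg
    | vert j => vert (-j)
    | edge j => edge (-j - 1)
  neg_neg b := by cases b <;> simp [Neg.neg] <;> grind

theorem neg_vert (j : ℤ) : -vert j = vert (-j) := rfl

theorem neg_edge (j : ℤ) : -edge j = edge (-j - 1) := rfl

/-- The boundary. -/
noncomputable def bd : Lin → Chain Lin
  | vert _ => 0
  | edge j => cell (vert j) + cell (vert (j + 1))

/-- The augmentation. -/
def aug : Lin → ZMod 2
  | vert _ => 1
  | edge _ => 0

/-- The dimension. -/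
def dim : Lin → ℕ
  | vert _ => 0
  | edge _ => 1

noncomputable instance : CellComplex Lin where
  d := lift bd
  ε := lift aug
  deg := dim
  d_d := LinearMap.congr_fun (f := lift bd ∘ₗ lift bd) (g := 0) <| hom_ext fun b => by
    cases b <;> simp [bd]
  ε_d := LinearMap.congr_fun (f := lift aug ∘ₗ lift bd) (g := 0) <| hom_ext fun b => by
    cases b <;> simp [bd, aug, add_self]
  d_cell b := by
    cases b
    · rw [lift_cell]; exact zero_mem _
    · rw [lift_cell]
      exact add_mem (cell_mem_on Nat.zero_lt_one) (cell_mem_on Nat.zero_lt_one)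

@[simp] theorem d_vert (j : ℤ) : d (cell (vert j)) = 0 := lift_cell _ _
@[simp] theorem d_edge (j : ℤ) : d (cell (edge j)) = cell (vert j) + cell (vert (j + 1)) :=
  lift_cell _ _
@[simp] theorem ε_vert (j : ℤ) : ε (cell (vert j)) = 1 := lift_cell _ _
@[simp] theorem ε_edge (j : ℤ) : ε (cell (edge j)) = 0 := lift_cell _ _

instance : SymmComplex Lin where
  d_neg b := by
    cases b
    · simp [neg_vert]
    · simp [neg_vert, neg_edge, add_comm, sub_eq_add_neg]
  ε_neg b := by cases b <;> simp [neg_vert, neg_edge]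
  deg_neg b := by cases b <;> rfl

/-- The path from `0` to `L`. -/
noncomputable def half (L : ℕ) : Chain Lin := ∑ j ∈ Finset.range L, cell (edge j)

theorem d_half (L : ℕ) : d (half L) = cell (vert L) + cell (vert 0) := by
  induction L with
  | zero => simp [half, add_self]
  | succ L ih =>
    rw [half] at ih
    rw [half, Finset.sum_range_succ, map_add, ih, d_edge]
    push_cast
    linear_combination (norm := module) add_self (cell (vert L))

theorem ε_half (L : ℕ) : ε (half L) = 0 := by simp [half]

/-- The cells of the interval from `-L` to `L`. -/
def within (L : ℕ) : Set Lin
  | vert j => -(L : ℤ) ≤ j ∧ j ≤ L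
  | edge j => -(L : ℤ) ≤ j ∧ j < L

/-- The end points of the interval from `-L` to `L`. -/
def ends (L : ℕ) : Set Lin
  | vert j => j = L ∨ j = -(L : ℤ)
  | edge _ => False

theorem vert_mem_within {L : ℕ} {j : ℤ} : vert j ∈ within L ↔ -(L : ℤ) ≤ j ∧ j ≤ L := Iff.rfl
theorem edge_mem_within {L : ℕ} {j : ℤ} : edge j ∈ within L ↔ -(L : ℤ) ≤ j ∧ j < L := Iff.rfl
theorem vert_mem_ends {L : ℕ} {j : ℤ} : vert j ∈ ends L ↔ j = L ∨ j = -(L : ℤ) := Iff.rfl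
theorem edge_mem_ends {L : ℕ} {j : ℤ} : edge j ∈ ends L ↔ False := Iff.rfl

theorem neg_mem_within {L : ℕ} {c : Lin} (h : c ∈ within L) : -c ∈ within L := by
  cases c
  · simp only [neg_vert, vert_mem_within] at *; omega
  · simp only [neg_edge, edge_mem_within] at *; omega

theorem neg_mem_ends {L : ℕ} {c : Lin} (h : c ∈ ends L) : -c ∈ ends L := by
  cases c
  · simp only [neg_vert, vert_mem_ends] at *; omega
  · simp only [edge_mem_ends] at h

theorem d_mem_within {L : ℕ} {c : Lin} (h : c ∈ within L) : d (cell c) ∈ on (within L) := by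
  cases c with
  | vert j => rw [d_vert]; exact zero_mem _
  | edge j =>
    rw [d_edge]
    simp only [edge_mem_within] at h
    exact add_mem (cell_mem_on (by simp only [vert_mem_within]; omega))
      (cell_mem_on (by simp only [vert_mem_within]; omega))

theorem d_ends {L : ℕ} {c : Lin} (h : c ∈ ends L) : d (cell c) = 0 := by
  cases c
  · exact d_vert _
  · simp only [edge_mem_ends] at h

theorem half_mem (L : ℕ) : half L ∈ on (within L) :=
  sum_mem fun j hj => cell_mem_on (by
    rw [Finset.mem_range] at hj; simp only [edge_mem_within]; omega)

theorem act_sg_mem {K : Set Lin} (hK : ∀ c ∈ K, -c ∈ K) (s : ℤˣ) {x : Chain Lin}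
    (hx : x ∈ on K) : act (sg s) x ∈ on K := by
  refine map_on_le (fun b hb => ?_) hx
  rw [act_cell]
  rcases Int.units_eq_one_or s with rfl | rfl
  · simpa using cell_mem_on hb
  · simpa using cell_mem_on (hK b hb)

end Lin

namespace Pw

variable {α : Type}

/-- The vectors all of whose entries lie in a set. -/
def all (s : Set α) : ∀ n, Set (Pw α n)
  | 0 => (Set.univ : Set Unit)
  | n + 1 => s ×ˢ all s n

/-- The vectors all of whose entries lie in `s` and at least one in `k`. -/
def bdry (s k : Set α) : ∀ n, Set (Pw α n)
  | 0 => (∅ : Set Unit)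
  | n + 1 => k ×ˢ all s n ∪ s ×ˢ bdry s k n

section

variable [InvolutiveNeg α] {s k : Set α}

theorem neg_mem_all (hs : ∀ x ∈ s, -x ∈ s) : ∀ {n} {p : Pw α n}, p ∈ all s n → -p ∈ all s n
  | 0, _, _ => trivial
  | n + 1, (x, p), h => ⟨hs x h.1, neg_mem_all hs h.2⟩

theorem neg_mem_bdry (hs : ∀ x ∈ s, -x ∈ s) (hk : ∀ x ∈ k, -x ∈ k) :
    ∀ {n} {p : Pw α n}, p ∈ bdry s k n → -p ∈ bdry s k n
  | 0, _, h => h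
  | n + 1, (x, p), h => Or.imp (fun h => ⟨hk x h.1, neg_mem_all hs h.2⟩)
      (fun h => ⟨hs x h.1, neg_mem_bdry hs hk h.2⟩) h

end

variable [CellComplex α] {s k : Set α}

theorem d_mem_all (hs : ∀ c ∈ s, d (cell c) ∈ on s) :
    ∀ {n} {p : Pw α n}, p ∈ all s n → d (cell p) ∈ on (all s n)
  | 0, _, _ => zero_mem _
  | n + 1, (x, p), h => by
    have : d (cell (x, p)) ∈ on (s ×ˢ all s n) := by
      rw [← cell_tens_cell, d_tens]
      exact add_mem (tens_mem_on (hs x h.1) (cell_mem_on h.2))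
        (tens_mem_on (cell_mem_on h.1) (d_mem_all hs h.2))
    exact this

theorem d_mem_bdry (hs : ∀ c ∈ s, d (cell c) ∈ on s) (hk : ∀ c ∈ k, d (cell c) = 0) :
    ∀ {n} {p : Pw α n}, p ∈ bdry s k n → d (cell p) ∈ on (bdry s k n)
  | 0, _, h => h.elim
  | n + 1, (x, p), h => by
    have : d (cell (x, p)) ∈ on (k ×ˢ all s n ∪ s ×ˢ bdry s k n) := by
      rw [← cell_tens_cell, d_tens]
      obtain ⟨h1, h2⟩ | ⟨h1, h2⟩ := h
      · rw [hk x h1, map_zero, LinearMap.zero_apply, zero_add]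
        exact on_mono Set.subset_union_left (tens_mem_on (cell_mem_on h1) (d_mem_all hs h2))
      · exact on_mono Set.subset_union_right (add_mem (tens_mem_on (hs x h1) (cell_mem_on h2))
          (tens_mem_on (cell_mem_on h1) (d_mem_bdry hs hk h2)))
    exact this

/-- The tensor product with an additional factor. -/
noncomputable def cons {n : ℕ} : Chain α →ₗ[ZMod 2] Chain (Pw α n) →ₗ[ZMod 2] Chain (Pw α (n + 1)) :=
  tens

theorem d_cons {n : ℕ} (x : Chain α) (y : Chain (Pw α n)) :
    d (cons x y) = cons (d x) y + cons x (d y) := d_tens x y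

theorem ε_cons {n : ℕ} (x : Chain α) (y : Chain (Pw α n)) : ε (cons x y) = ε x * ε y :=
  ε_tens x y

theorem act_neg_cons [InvolutiveNeg α] {n : ℕ} (x : Chain α) (y : Chain (Pw α n)) :
    act Neg.neg (cons x y) = cons (act Neg.neg x) (act Neg.neg y) := act_map_tens _ _ _ _

theorem cons_mem_all {n : ℕ} {x : Chain α} {y : Chain (Pw α n)} (hx : x ∈ on s)
    (hy : y ∈ on (all s n)) : cons x y ∈ on (all s (n + 1)) := tens_mem_on hx hy

theorem cons_mem_bdry_left {n : ℕ} {x : Chain α} {y : Chain (Pw α n)} (hx : x ∈ on k)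
    (hy : y ∈ on (all s n)) : cons x y ∈ on (bdry s k (n + 1)) :=
  on_mono (B := α × Pw α n) Set.subset_union_left (tens_mem_on hx hy)

theorem cons_mem_bdry_right {n : ℕ} {x : Chain α} {y : Chain (Pw α n)} (hx : x ∈ on s)
    (hy : y ∈ on (bdry s k n)) : cons x y ∈ on (bdry s k (n + 1)) :=
  on_mono (B := α × Pw α n) Set.subset_union_right (tens_mem_on hx hy)

/-- The power of a chain. -/
noncomputable def chain (x : Chain α) : ∀ n, Chain (Pw α n)
  | 0 => (cell () : Chain Unit)
  | n + 1 => cons x (chain x n)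

theorem chain_mem {x : Chain α} (hx : x ∈ on s) : ∀ n, chain x n ∈ on (all s n)
  | 0 => cell_mem_on trivial
  | n + 1 => cons_mem_all hx (chain_mem hx n)

theorem act_neg_chain [InvolutiveNeg α] {x : Chain α} (hx : act Neg.neg x = x) :
    ∀ n, act Neg.neg (chain x n) = chain x n
  | 0 => act_cell _ _
  | n + 1 => by rw [chain, act_neg_cons, hx, act_neg_chain hx n]

theorem d_chain_mem {x : Chain α} (hs : ∀ c ∈ s, d (cell c) ∈ on s) (hx : x ∈ on s)
    (hdx : d x ∈ on k) : ∀ n, d (chain x n) ∈ on (bdry s k n)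
  | 0 => zero_mem _
  | n + 1 => by
    rw [chain, d_cons]
    exact add_mem (cons_mem_bdry_left hdx (chain_mem hx n))
      (cons_mem_bdry_right hx (d_chain_mem hs hx hdx n))

end Pw

namespace Lin

/-- The path from `-L` to `L`. -/
noncomputable def whole (L : ℕ) : Chain Lin := half L + act Neg.neg (half L)

theorem act_neg_neg (x : Chain Lin) : act Neg.neg (act Neg.neg x) = x := by
  rw [act_act, show (Neg.neg ∘ Neg.neg : Lin → Lin) = id from funext neg_neg, act_id]

theorem d_act_neg (x : Chain Lin) : d (act Neg.neg x) = act Neg.neg (d x) := by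
  have h : d ∘ₗ act (Neg.neg : Lin → Lin) = act Neg.neg ∘ₗ d := hom_ext fun b => by
    rw [LinearMap.comp_apply, LinearMap.comp_apply, act_cell, SymmComplex.d_neg]
  exact LinearMap.congr_fun h x

theorem act_neg_whole (L : ℕ) : act Neg.neg (whole L) = whole L := by
  rw [whole, map_add, act_neg_neg, add_comm]

theorem d_whole (L : ℕ) : d (whole L) = cell (vert L) + cell (vert (-L)) := by
  rw [whole, map_add, d_act_neg, d_half, map_add, act_cell, act_cell, neg_vert, neg_vert, neg_zero]
  linear_combination (norm := module) add_self (cell (vert 0))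

theorem whole_mem (L : ℕ) : whole L ∈ on (within L) := by
  refine add_mem (half_mem L) ?_
  simpa [show (sg (-1) : Lin → Lin) = Neg.neg from funext sg_neg_one] using
    act_sg_mem (fun c => neg_mem_within) (-1) (half_mem L)

theorem d_whole_mem (L : ℕ) : d (whole L) ∈ on (ends L) := by
  rw [d_whole]
  exact add_mem (cell_mem_on (.inl rfl)) (cell_mem_on (.inr rfl))

end Lin

namespace Hemi

open Lin

/-- The chain in the subdivided boundary of a cube corresponding to a hemisphere. -/
noncomputable def cubeCell (L : ℕ) : ∀ n, Hemi → Chain (Pw Lin n)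
  | 0, _ => 0
  | n + 1, b =>
    if b.i < n then Pw.cons (cell (vert 0)) (cubeCell L n b)
    else if b.i = n then Pw.cons (act (sg b.s) (half L)) (d (Pw.chain (whole L) n)) +
      Pw.cons (cell (sg b.s (vert L))) (Pw.chain (whole L) n)
    else 0

/-- The map from the sphere to the subdivided boundary of a cube. -/
noncomputable def cube (L n : ℕ) : Chain Hemi →ₗ[ZMod 2] Chain (Pw Lin n) := lift (cubeCell L n)

theorem cube_cell (L n : ℕ) (b : Hemi) : cube L n (cell b) = cubeCell L n b := lift_cell _ _

theorem cubeCell_lt {L n : ℕ} {b : Hemi} (h : b.i < n) :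
    cubeCell L (n + 1) b = Pw.cons (cell (vert 0)) (cubeCell L n b) := if_pos h

theorem cubeCell_eq (L n : ℕ) (s : ℤˣ) :
    cubeCell L (n + 1) ⟨s, n⟩ = Pw.cons (act (sg s) (half L)) (d (Pw.chain (whole L) n)) +
      Pw.cons (cell (sg s (vert L))) (Pw.chain (whole L) n) := by
  rw [cubeCell, if_neg (lt_irrefl _), if_pos rfl]

theorem cubeCell_gt {L n : ℕ} {b : Hemi} (h : n < b.i) : cubeCell L (n + 1) b = 0 := by
  rw [cubeCell, if_neg (by omega), if_neg (by omega)]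

theorem act_neg_d {A : Type} [CellComplex A] [InvolutiveNeg A] [SymmComplex A] (x : Chain A) :
    act Neg.neg (d x) = d (act Neg.neg x) := by
  have h : d ∘ₗ act (Neg.neg : A → A) = act Neg.neg ∘ₗ d := hom_ext fun b => by
    rw [LinearMap.comp_apply, LinearMap.comp_apply, act_cell, SymmComplex.d_neg]
  exact (LinearMap.congr_fun h x).symm

theorem sg_neg {α : Type} [InvolutiveNeg α] (s : ℤˣ) (x : α) : sg (-s) x = -sg s x := by
  rcases Int.units_eq_one_or s with rfl | rfl <;> simp

theorem cubeCell_neg (L : ℕ) : ∀ n (b : Hemi), cubeCell L n (-b) = act Neg.neg (cubeCell L n b)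
  | 0, _ => (map_zero _).symm
  | n + 1, ⟨s, i⟩ => by
    rcases lt_trichotomy i n with h | rfl | h
    · rw [cubeCell_lt (b := ⟨s, i⟩) h, cubeCell_lt (b := -⟨s, i⟩) h, cubeCell_neg L n,
        Pw.act_neg_cons, act_cell, neg_vert, neg_zero]
    · rw [neg_mk, cubeCell_eq, cubeCell_eq, map_add, Pw.act_neg_cons, Pw.act_neg_cons,
        act_neg_d, Pw.act_neg_chain (act_neg_whole L), act_cell, act_act, sg_neg,
        show Neg.neg ∘ sg s = (sg (-s) : Lin → Lin) from funext fun x => (sg_neg s x).symm]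
    · rw [cubeCell_gt (b := ⟨s, i⟩) h, cubeCell_gt (b := -⟨s, i⟩) h, map_zero]

theorem half_add_half (L : ℕ) (s : ℤˣ) :
    act (sg s) (half L) + act (sg (-s)) (half L) = whole L := by
  have h1 : (sg 1 : Lin → Lin) = id := funext sg_one
  have h2 : (sg (-1) : Lin → Lin) = Neg.neg := funext sg_neg_one
  rcases Int.units_eq_one_or s with rfl | rfl
  · rw [h1, h2, act_id, whole]
  · rw [neg_neg, h1, h2, act_id, add_comm, whole]

theorem d_act_sg_half (L : ℕ) (s : ℤˣ) :
    d (act (sg s) (half L)) = cell (sg s (vert L)) + cell (vert 0) := by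
  have h1 : (sg 1 : Lin → Lin) = id := funext sg_one
  have h2 : (sg (-1) : Lin → Lin) = Neg.neg := funext sg_neg_one
  rcases Int.units_eq_one_or s with rfl | rfl
  · rw [h1, act_id, d_half]; rfl
  · rw [h2, d_act_neg, d_half, map_add, act_cell, act_cell, neg_vert, neg_vert, neg_zero]

theorem cubeCell_top (L n : ℕ) (s : ℤˣ) :
    cubeCell L (n + 1) ⟨s, n⟩ + cubeCell L (n + 1) ⟨-s, n⟩ = d (Pw.chain (whole L) (n + 1)) := by
  rw [cubeCell_eq, cubeCell_eq, Pw.chain, Pw.d_cons]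
  generalize Pw.chain (whole L) n = y
  rw [← half_add_half L s, map_add, map_add, d_act_sg_half, d_act_sg_half]
  simp only [map_add, LinearMap.add_apply]
  linear_combination (norm := module) -add_self (Pw.cons (cell (vert 0)) y)

theorem d_cubeCell (L : ℕ) : ∀ {n} {b : Hemi}, b.i < n →
    d (cubeCell L n b) = cube L n (d (cell b))
  | n + 1, ⟨s, i⟩, h => by
    obtain h | rfl := Nat.lt_succ_iff_lt_or_eq.1 h
    · rw [cubeCell_lt (b := ⟨s, i⟩) h]
      refine (Pw.d_cons _ _).trans ?_
      rw [d_cubeCell L (b := ⟨s, i⟩) h, d_vert, map_zero, LinearMap.zero_apply, zero_add]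
      cases i with
      | zero => rw [d_zero, map_zero, map_zero, map_zero]
      | succ i =>
        rw [d_succ, map_add, map_add, map_add, cube_cell, cube_cell, cube_cell, cube_cell,
          cubeCell_lt (b := ⟨1, i⟩) (Nat.lt_of_succ_lt h),
          cubeCell_lt (b := ⟨-1, i⟩) (Nat.lt_of_succ_lt h)]
    · rw [cubeCell_eq]
      have e : d (Pw.cons (act (sg s) (half L)) (d (Pw.chain (whole L) i)) +
          Pw.cons (cell (sg s (vert L))) (Pw.chain (whole L) i)) =
          Pw.cons (cell (vert 0)) (d (Pw.chain (whole L) i)) := by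
        have h : d (cell (sg s (vert L))) = 0 := by
          rcases Int.units_eq_one_or s with rfl | rfl <;> simp [neg_vert]
        rw [map_add, Pw.d_cons, Pw.d_cons, d_d, map_zero, d_act_sg_half, h, map_zero,
          LinearMap.zero_apply, map_add, LinearMap.add_apply]
        linear_combination (norm := module)
          add_self (Pw.cons (cell (sg s (vert L))) (d (Pw.chain (whole L) i)))
      refine e.trans ?_
      cases i with
      | zero =>
        rw [d_zero, map_zero]
        exact map_zero (Pw.cons (cell (vert 0)))
      | succ i =>
        rw [d_succ, map_add, cube_cell, cube_cell, cubeCell_lt (b := ⟨1, i⟩) (Nat.lt_succ_self i),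
          cubeCell_lt (b := ⟨-1, i⟩) (Nat.lt_succ_self i), ← cubeCell_top L i 1]
        exact map_add (Pw.cons (cell (vert 0))) _ _

theorem ε_cubeCell (L : ℕ) : ∀ {n} {b : Hemi}, b.i < n → ε (cubeCell L n b) = ε (cell b)
  | n + 1, ⟨s, i⟩, h => by
    obtain h | rfl := Nat.lt_succ_iff_lt_or_eq.1 h
    · rw [cubeCell_lt (b := ⟨s, i⟩) h]
      refine (Pw.ε_cons _ _).trans ?_
      rw [ε_vert, one_mul, ε_cubeCell L h]
    · rw [cubeCell_eq]
      have h1 : ε (cell (sg s (vert L))) = 1 := by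
        rcases Int.units_eq_one_or s with rfl | rfl <;> simp [neg_vert]
      have e : ε (Pw.cons (act (sg s) (half L)) (d (Pw.chain (whole L) i)) +
          Pw.cons (cell (sg s (vert L))) (Pw.chain (whole L) i)) = ε (Pw.chain (whole L) i) := by
        rw [map_add, Pw.ε_cons, Pw.ε_cons, ε_d, mul_zero, h1, one_mul, zero_add]
      refine e.trans ?_
      cases i with
      | zero => rw [ε_zero]; exact ε_unit ()
      | succ i =>
        rw [ε_succ]
        refine (Pw.ε_cons _ _).trans ?_
        have h2 : ε (whole L) = 0 := by
          rw [whole, map_add, ε_half, zero_add]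
          have h : ε ∘ₗ act (Neg.neg : Lin → Lin) = ε := hom_ext fun b => by
            rw [LinearMap.comp_apply, act_cell, SymmComplex.ε_neg]
          exact (LinearMap.congr_fun h _).trans (ε_half L)
        rw [h2, zero_mul]

theorem cubeCell_mem (L : ℕ) : ∀ n (b : Hemi),
    cubeCell L n b ∈ on (Pw.bdry (within L) (ends L) n)
  | 0, _ => zero_mem _
  | n + 1, ⟨s, i⟩ => by
    have h0 : vert 0 ∈ within L := by simp [vert_mem_within]
    have hv : sg s (vert L) ∈ ends L := by
      rcases Int.units_eq_one_or s with rfl | rfl <;> simp [neg_vert, vert_mem_ends]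
    rcases lt_trichotomy i n with h | rfl | h
    · rw [cubeCell_lt (b := ⟨s, i⟩) h]
      exact Pw.cons_mem_bdry_right (cell_mem_on h0) (cubeCell_mem L n ⟨s, i⟩)
    · rw [cubeCell_eq]
      exact add_mem (Pw.cons_mem_bdry_right (act_sg_mem (fun c => neg_mem_within) s (half_mem L))
        (Pw.d_chain_mem (fun c => d_mem_within) (whole_mem L) (d_whole_mem L) i))
        (Pw.cons_mem_bdry_left (cell_mem_on hv) (Pw.chain_mem (whole_mem L) i))
    · rw [cubeCell_gt (b := ⟨s, i⟩) h]
      exact zero_mem _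

end Hemi

section Metric

variable {α : Type} [PseudoMetricSpace α]

instance Pw.instPseudoMetricSpace : ∀ n, PseudoMetricSpace (Pw α n)
  | 0 => inferInstanceAs (PseudoMetricSpace Unit)
  | n + 1 => let _ := Pw.instPseudoMetricSpace n; inferInstanceAs (PseudoMetricSpace (α × Pw α n))

instance Tr.instPseudoMetricSpace : ∀ r, PseudoMetricSpace (Tr α r)
  | 0 => inferInstanceAs (PseudoMetricSpace Unit)
  | r + 1 =>
    let _ := Tr.instPseudoMetricSpace r; inferInstanceAs (PseudoMetricSpace (α × Tr α r × Tr α r))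

theorem Pw.isCompact_all {s : Set α} (hs : IsCompact s) : ∀ n, IsCompact (Pw.all s n)
  | 0 => (isCompact_univ : IsCompact (Set.univ : Set Unit))
  | n + 1 => hs.prod (isCompact_all hs n)

theorem Pw.isCompact_bdry {s k : Set α} (hs : IsCompact s) (hk : IsCompact k) :
    ∀ n, IsCompact (Pw.bdry s k n)
  | 0 => (isCompact_empty : IsCompact (∅ : Set Unit))
  | n + 1 => (hk.prod (isCompact_all hs n)).union (hs.prod (isCompact_bdry hs hk n))

theorem Tr.isCompact_all {P : α → Prop} (hs : IsCompact {x | P x}) :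
    ∀ r, IsCompact {t : Tr α r | Tr.All P r t}
  | 0 => by
    have : IsCompact (Set.univ : Set Unit) := isCompact_univ
    exact this
  | r + 1 => hs.prod ((isCompact_all hs r).prod (isCompact_all hs r))

end Metric

section Points

variable {α β : Type}

/-- The realization of a cell of a power. -/
def Pw.pts (f : α → Set β) : ∀ n, Pw α n → Set (Pw β n)
  | 0, _ => (Set.univ : Set Unit)
  | n + 1, (x, p) => f x ×ˢ pts f n p

/-- The realization of a cell of a product indexed by a tree. -/
def Tr.pts (f : α → Set β) : ∀ r, Tr α r → Set (Tr β r)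
  | 0, _ => (Set.univ : Set Unit)
  | r + 1, (x, t, u) => f x ×ˢ pts f r t ×ˢ pts f r u

theorem Pw.pts_nonempty {f : α → Set β} (hf : ∀ x, (f x).Nonempty) :
    ∀ n p, (Pw.pts f n p).Nonempty
  | 0, _ => (Set.univ_nonempty : (Set.univ : Set Unit).Nonempty)
  | n + 1, (x, p) => (hf x).prod (pts_nonempty hf n p)

theorem Tr.pts_nonempty {f : α → Set β} (hf : ∀ x, (f x).Nonempty) :
    ∀ r t, (Tr.pts f r t).Nonempty
  | 0, _ => (Set.univ_nonempty : (Set.univ : Set Unit).Nonempty)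
  | r + 1, (x, t, u) => (hf x).prod ((pts_nonempty hf r t).prod (pts_nonempty hf r u))

theorem Pw.mem_all_of_pts {f : α → Set β} {s : Set α} {s' : Set β}
    (hs : ∀ x ∈ s, f x ⊆ s') : ∀ {n p y}, p ∈ Pw.all s n → y ∈ Pw.pts f n p → y ∈ Pw.all s' n
  | 0, _, _, _, _ => trivial
  | n + 1, (x, p), (y, q), h, h' => ⟨hs x h.1 h'.1, mem_all_of_pts hs h.2 h'.2⟩

theorem Pw.mem_bdry_of_pts {f : α → Set β} {s k : Set α} {s' k' : Set β}
    (hs : ∀ x ∈ s, f x ⊆ s') (hk : ∀ x ∈ k, f x ⊆ k') :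
    ∀ {n p y}, p ∈ Pw.bdry s k n → y ∈ Pw.pts f n p → y ∈ Pw.bdry s' k' n
  | 0, _, _, h, _ => h
  | n + 1, (x, p), (y, q), h, h' => Or.imp
      (fun h => ⟨hk x h.1 h'.1, mem_all_of_pts hs h.2 h'.2⟩)
      (fun h => ⟨hs x h.1 h'.1, mem_bdry_of_pts hs hk h.2 h'.2⟩) h

theorem Tr.all_of_pts {f : α → Set β} {P : α → Prop} {P' : β → Prop}
    (hP : ∀ x y, P x → y ∈ f x → P' y) :
    ∀ {r t y}, Tr.All P r t → y ∈ Tr.pts f r t → Tr.All P' r y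
  | 0, _, _, _, _ => trivial
  | r + 1, (x, t, u), (y, t', u'), h, h' =>
    ⟨hP x y h.1 h'.1, all_of_pts hP h.2.1 h'.2.1, all_of_pts hP h.2.2 h'.2.2⟩

section Neg

variable [InvolutiveNeg α] [InvolutiveNeg β]

theorem Pw.neg_mem_pts {f : α → Set β} (hf : ∀ x, ∀ y ∈ f x, -y ∈ f (-x)) :
    ∀ {n} p, ∀ y ∈ Pw.pts f n p, -y ∈ Pw.pts f n (-p)
  | 0, _, _, _ => trivial
  | n + 1, (x, p), (y, q), h => ⟨hf x y h.1, neg_mem_pts hf p q h.2⟩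

theorem Tr.neg_mem_pts {f : α → Set β} (hf : ∀ x, ∀ y ∈ f x, -y ∈ f (-x)) :
    ∀ {r} t, ∀ y ∈ Tr.pts f r t, -y ∈ Tr.pts f r (-t)
  | 0, _, _, _ => trivial
  | r + 1, (x, t, u), (y, t', u'), h =>
    ⟨hf x y h.1, neg_mem_pts hf t t' h.2.1, neg_mem_pts hf u u' h.2.2⟩

theorem Tr.ρ_mem_pts {f : α → Set β} (hf : ∀ x, ∀ y ∈ f x, -y ∈ f (-x)) :
    ∀ {r} (g : W r) t, ∀ y ∈ Tr.pts f r t, Tr.ρ r g y ∈ Tr.pts f r (Tr.ρ r g t)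
  | 0, _, _, _, _ => trivial
  | r + 1, g, (x, t, u), (y, t', u'), h => by
    change Wr (W r) at g
    obtain ⟨a, b, rfl | rfl⟩ := Wr.cases g
    · rw [ρ_mk_one, ρ_mk_one]
      exact ⟨h.1, ρ_mem_pts hf a t t' h.2.1, ρ_mem_pts hf b u u' h.2.2⟩
    · rw [ρ_mk_neg_one, ρ_mk_neg_one]
      exact ⟨hf x y h.1, ρ_mem_pts hf a u u' h.2.2, ρ_mem_pts hf b t t' h.2.1⟩

end Neg

section Faces

variable [CellComplex α]

/-- A realization of cells under which faces of a cell are realized by subsets. -/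
def IsRealization {A B : Type} [CellComplex A] (f : A → Set B) : Prop :=
  ∀ a, d (cell a) ∈ on {a' | f a' ⊆ f a}

theorem IsRealization.prod {A A' B B' : Type} [CellComplex A] [CellComplex A'] {f : A → Set B}
    {f' : A' → Set B'} (h : IsRealization f) (h' : IsRealization f') :
    IsRealization fun x : A × A' => f x.1 ×ˢ f' x.2 := fun (a, a') => by
  rw [← cell_tens_cell, d_tens]
  refine add_mem (on_mono ?_ (tens_mem_on (h a) (cell_mem_on (Set.mem_singleton a'))))
    (on_mono ?_ (tens_mem_on (cell_mem_on (Set.mem_singleton a)) (h' a')))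
  · rintro ⟨x, y⟩ ⟨hx, rfl⟩
    exact Set.prod_mono hx subset_rfl
  · rintro ⟨x, y⟩ ⟨rfl, hy⟩
    exact Set.prod_mono subset_rfl hy

theorem IsRealization.pw {f : α → Set β} (h : IsRealization f) : ∀ n, IsRealization (Pw.pts f n)
  | 0 => fun _ => zero_mem _
  | n + 1 => h.prod (IsRealization.pw h n)

theorem IsRealization.tr {f : α → Set β} (h : IsRealization f) : ∀ r, IsRealization (Tr.pts f r)
  | 0 => fun _ => zero_mem _
  | r + 1 => h.prod ((IsRealization.tr h r).prod (IsRealization.tr h r))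

end Faces

section Small

variable [PseudoMetricSpace β]

theorem Pw.dist_le_of_pts {f : α → Set β} {δ : ℝ} (hδ : 0 ≤ δ)
    (hf : ∀ x, ∀ y ∈ f x, ∀ y' ∈ f x, dist y y' ≤ δ) :
    ∀ {n} p, ∀ y ∈ Pw.pts f n p, ∀ y' ∈ Pw.pts f n p, dist y y' ≤ δ
  | 0, _, _, _, _, _ => (dist_self (α := Unit) ()).trans_le hδ
  | n + 1, (x, p), (y, q), h, (y', q'), h' =>
    max_le (hf x y h.1 y' h'.1) (dist_le_of_pts hδ hf p q h.2 q' h'.2)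

theorem Tr.dist_le_of_pts {f : α → Set β} {δ : ℝ} (hδ : 0 ≤ δ)
    (hf : ∀ x, ∀ y ∈ f x, ∀ y' ∈ f x, dist y y' ≤ δ) :
    ∀ {r} t, ∀ y ∈ Tr.pts f r t, ∀ y' ∈ Tr.pts f r t, dist y y' ≤ δ
  | 0, _, _, _, _, _ => (dist_self (α := Unit) ()).trans_le hδ
  | r + 1, (x, t, u), (y, q, p), h, (y', q', p'), h' =>
    max_le (hf x y h.1 y' h'.1) (max_le (dist_le_of_pts hδ hf t q h.2.1 q' h'.2.1)
      (dist_le_of_pts hδ hf u p h.2.2 p' h'.2.2))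

end Small

end Points

namespace Lin

/-- The realization of a cell of the line, scaled by `1 / L`. -/
def real (L : ℕ) : Lin → Set ℝ
  | vert j => {(j : ℝ) / L}
  | edge j => Set.Icc ((j : ℝ) / L) (((j : ℝ) + 1) / L)

variable {L : ℕ}

theorem mem_real_vert {j : ℤ} {y : ℝ} : y ∈ real L (vert j) ↔ y = (j : ℝ) / L := Iff.rfl

theorem mem_real_edge {j : ℤ} {y : ℝ} :
    y ∈ real L (edge j) ↔ (j : ℝ) / L ≤ y ∧ y ≤ ((j : ℝ) + 1) / L := Iff.rfl

theorem real_nonempty (c : Lin) : (real L c).Nonempty := by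
  cases c with
  | vert j => exact ⟨_, rfl⟩
  | edge j =>
    refine ⟨(j : ℝ) / L, le_rfl, ?_⟩
    gcongr
    linarith

theorem neg_mem_real (c : Lin) : ∀ y ∈ real L c, -y ∈ real L (-c) := by
  intro y hy
  cases c with
  | vert j => rw [neg_vert, mem_real_vert] at *; rw [hy]; push_cast; ring
  | edge j =>
    rw [mem_real_edge] at hy
    rw [neg_edge, mem_real_edge]
    push_cast
    rw [sub_add_cancel, neg_div, show -(j : ℝ) - 1 = -(j + 1) by ring, neg_div]
    exact ⟨by linarith [hy.2], by linarith [hy.1]⟩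

theorem isRealization_real : IsRealization (real L)
  | vert j => by rw [d_vert]; exact zero_mem _
  | edge j => by
    rw [d_edge]
    have h : (j : ℝ) / L ≤ ((j : ℝ) + 1) / L := by gcongr; linarith
    refine add_mem (cell_mem_on ?_) (cell_mem_on ?_) <;> rintro y hy <;>
      rw [mem_real_vert] at hy <;> rw [mem_real_edge, hy]
    · exact ⟨le_rfl, h⟩
    · push_cast
      exact ⟨h, le_rfl⟩

theorem real_subset_Icc (hL : 0 < L) {c : Lin} (h : c ∈ within L) :
    real L c ⊆ Set.Icc (-1) 1 := by
  have hL' : (0 : ℝ) < L := by exact_mod_cast hL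
  intro y hy
  cases c with
  | vert j =>
    rw [vert_mem_within] at h
    rw [mem_real_vert] at hy
    rw [hy, Set.mem_Icc, le_div_iff₀ hL', div_le_iff₀ hL', neg_one_mul, one_mul]
    exact_mod_cast h
  | edge j =>
    rw [edge_mem_within] at h
    rw [mem_real_edge] at hy
    have h1 : -1 ≤ (j : ℝ) / L := by
      rw [le_div_iff₀ hL', neg_one_mul]; exact_mod_cast h.1
    have h2 : ((j : ℝ) + 1) / L ≤ 1 := by
      rw [div_le_iff₀ hL', one_mul]; exact_mod_cast h.2
    exact ⟨h1.trans hy.1, hy.2.trans h2⟩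

theorem real_subset_ends (hL : 0 < L) {c : Lin} (h : c ∈ ends L) : real L c ⊆ {-1, 1} := by
  have hL' : (L : ℝ) ≠ 0 := by exact_mod_cast hL.ne'
  intro y hy
  cases c with
  | vert j =>
    rw [mem_real_vert] at hy
    rcases (vert_mem_ends.1 h) with rfl | rfl
    · right; simp [hy, hL']
    · left; simp [hy, neg_div, hL']
  | edge j => exact h.elim

theorem dist_le_of_mem_real (c : Lin) :
    ∀ y ∈ real L c, ∀ y' ∈ real L c, dist y y' ≤ 1 / L := by
  intro y hy y' hy'
  cases c with
  | vert j =>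
    rw [mem_real_vert] at hy hy'
    rw [hy, hy', dist_self]
    positivity
  | edge j =>
    refine (Real.dist_le_of_mem_Icc hy hy').trans_eq ?_
    ring

theorem neg_ne_of_mem_ends (hL : 0 < L) {c : Lin} (h : c ∈ ends L) : -c ≠ c := by
  cases c with
  | vert j =>
    rw [neg_vert]
    intro e
    have : -j = j := by injection e
    rcases (vert_mem_ends.1 h) with rfl | rfl <;> omega
  | edge j => exact h.elim

end Lin

theorem Pw.neg_ne_of_mem_bdry {α : Type} [InvolutiveNeg α] {s k : Set α}
    (hk : ∀ x ∈ k, -x ≠ x) : ∀ {n} {p : Pw α n}, p ∈ Pw.bdry s k n → -p ≠ p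
  | 0, _, h => h.elim
  | n + 1, (x, p), h => fun e => by
    rcases h with h | h
    · exact hk x h.1 (congrArg Prod.fst e)
    · exact neg_ne_of_mem_bdry hk h.2 (congrArg Prod.snd e)

section Carrier

variable {A A' Y Y' : Type} [CellComplex A] [CellComplex A'] [PseudoMetricSpace Y]
  [PseudoMetricSpace Y']

/-- An acyclic carrier for which the cells detected by a functional only carry small sets that are
far from the point `z`. -/
structure IsCarrier (C : Set Y → Set A) (φ : Chain A →ₗ[ZMod 2] ZMod 2) (z : Y) : Prop where
  mono : ∀ {s t}, s ⊆ t → C s ⊆ C t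
  acyclic : ∀ {s}, s.Nonempty → IsAcyclicOn (C s)
  small : ∀ {s c δ}, φ (cell c) ≠ 0 → c ∈ C s → 0 < δ → (∀ y ∈ s, ∀ y' ∈ s, dist y y' < δ) →
    ∀ y ∈ s, dist y z < δ

theorem IsCarrier.unit : IsCarrier (fun _ : Set Unit => (Set.univ : Set Unit)) ε () where
  mono _ := subset_rfl
  acyclic _ := isAcyclicOn_unit
  small _ _ hδ _ _ _ := (dist_self _).trans_lt hδ

theorem IsCarrier.prod {C : Set Y → Set A} {C' : Set Y' → Set A'}
    {φ : Chain A →ₗ[ZMod 2] ZMod 2} {φ' : Chain A' →ₗ[ZMod 2] ZMod 2} {z : Y} {z' : Y'}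
    (h : IsCarrier C φ z) (h' : IsCarrier C' φ' z') :
    IsCarrier (fun s : Set (Y × Y') => C (Prod.fst '' s) ×ˢ C' (Prod.snd '' s)) (tfun φ φ')
      (z, z') where
  mono hst := Set.prod_mono (h.mono (Set.image_mono hst)) (h'.mono (Set.image_mono hst))
  acyclic hs := (h.acyclic (hs.image _)).prod (h'.acyclic (hs.image _))
  small {s c δ} hc hcs hδ hs y hy := by
    obtain ⟨a, b⟩ := c
    rw [← cell_tens_cell, tfun_tens] at hc
    refine max_lt (h.small (left_ne_zero_of_mul hc) hcs.1 hδ ?_ _ (Set.mem_image_of_mem _ hy))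
      (h'.small (right_ne_zero_of_mul hc) hcs.2 hδ ?_ _ (Set.mem_image_of_mem _ hy))
    · rintro _ ⟨u, hu, rfl⟩ _ ⟨v, hv, rfl⟩
      exact (le_max_left _ _).trans_lt (hs u hu v hv)
    · rintro _ ⟨u, hu, rfl⟩ _ ⟨v, hv, rfl⟩
      exact (le_max_right _ _).trans_lt (hs u hu v hv)

/-- The cells of the interval that carry a set of reals. -/
def Ivl.carrier (s : Set ℝ) : Set Ivl :=
  {c | (s ⊆ Set.Ioi 0 → c = pos) ∧ (s ⊆ Set.Iio 0 → c = neg)}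

theorem Ivl.isCarrier : IsCarrier Ivl.carrier Ivl.top 0 where
  mono hst c hc := ⟨fun h => hc.1 (hst.trans h), fun h => hc.2 (hst.trans h)⟩
  acyclic {s} hs := by
    obtain ⟨y, hy⟩ := hs
    by_cases h1 : s ⊆ Set.Ioi 0
    · have h2 : ¬ s ⊆ Set.Iio 0 := fun h => lt_asymm (Set.mem_Ioi.1 (h1 hy)) (Set.mem_Iio.1 (h hy))
      have : Ivl.carrier s = {pos} := by
        ext c; exact ⟨fun h => h.1 h1, fun h => ⟨fun _ => h, fun h => (h2 h).elim⟩⟩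
      rw [this]
      exact isAcyclicOn_singleton _ (by simp) (by simp) rfl
    · by_cases h2 : s ⊆ Set.Iio 0
      · have : Ivl.carrier s = {neg} := by
          ext c; exact ⟨fun h => h.2 h2, fun h => ⟨fun h => (h1 h).elim, fun _ => h⟩⟩
        rw [this]
        exact isAcyclicOn_singleton _ (by simp) (by simp) rfl
      · have : Ivl.carrier s = Set.univ := Set.eq_univ_of_forall fun c =>
          ⟨fun h => (h1 h).elim, fun h => (h2 h).elim⟩
        rw [this]
        exact Ivl.isAcyclicOn
  small {s c δ} hc hcs hδ hs y hy := by
    have hm : c = mid := by cases c <;> simp_all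
    subst hm
    have h1 : ¬ s ⊆ Set.Ioi 0 := fun h => by cases hcs.1 h
    have h2 : ¬ s ⊆ Set.Iio 0 := fun h => by cases hcs.2 h
    obtain ⟨u, hu, hu0⟩ := Set.not_subset.1 h1
    obtain ⟨v, hv, hv0⟩ := Set.not_subset.1 h2
    simp only [Set.mem_Ioi, not_lt, Set.mem_Iio] at hu0 hv0
    have h3 := abs_lt.1 (hs y hy u hu)
    have h4 := abs_lt.1 (hs y hy v hv)
    rw [Real.dist_0_eq_abs, abs_lt]
    constructor <;> linarith [h3.1, h3.2, h4.1, h4.2]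

theorem Ivl.neg_mem_carrier {s t : Set ℝ} (h : ∀ y ∈ s, -y ∈ t) {c : Ivl} (hc : c ∈ carrier s) :
    -c ∈ carrier t := by
  refine ⟨fun ht => ?_, fun ht => ?_⟩
  · rw [hc.2 fun y hy => _root_.neg_pos.1 (Set.mem_Ioi.1 (ht (h y hy))), neg_neg']
  · rw [hc.1 fun y hy => neg_lt_zero.1 (Set.mem_Iio.1 (ht (h y hy))), Ivl.neg_pos]

/-- The vector all of whose entries are equal. -/
def Pw.const {α : Type} (x : α) : ∀ n, Pw α n
  | 0 => ()
  | n + 1 => (x, Pw.const x n)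

/-- The power of a carrier. -/
def Pw.carrier (C : Set Y → Set A) : ∀ n, Set (Pw Y n) → Set (Pw A n)
  | 0, _ => (Set.univ : Set Unit)
  | n + 1, s => C ((Prod.fst : Y × Pw Y n → Y) '' s) ×ˢ
      Pw.carrier C n ((Prod.snd : Y × Pw Y n → Pw Y n) '' s)

/-- The power of a carrier over the nodes of a tree. -/
def Tr.carrier (C : Set Y → Set A) : ∀ r, Set (Tr Y r) → Set (Tr A r)
  | 0, _ => (Set.univ : Set Unit)
  | r + 1, s => C ((Prod.fst : Y × Tr Y r × Tr Y r → Y) '' s) ×ˢ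
      (Tr.carrier C r ((Prod.fst : Tr Y r × Tr Y r → Tr Y r) ''
          ((Prod.snd : Y × Tr Y r × Tr Y r → Tr Y r × Tr Y r) '' s)) ×ˢ
        Tr.carrier C r ((Prod.snd : Tr Y r × Tr Y r → Tr Y r) ''
          ((Prod.snd : Y × Tr Y r × Tr Y r → Tr Y r × Tr Y r) '' s)))

theorem IsCarrier.pw {C : Set Y → Set A} {φ : Chain A →ₗ[ZMod 2] ZMod 2} {z : Y}
    (h : IsCarrier C φ z) : ∀ n, IsCarrier (Pw.carrier C n) (Pw.top φ n) (Pw.const z n)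
  | 0 => IsCarrier.unit
  | n + 1 => h.prod (IsCarrier.pw h n)

theorem IsCarrier.tr {C : Set Y → Set A} {φ : Chain A →ₗ[ZMod 2] ZMod 2} {z : Y}
    (h : IsCarrier C φ z) : ∀ r, IsCarrier (Tr.carrier C r) (Tr.top φ r) (Tr.const z r)
  | 0 => IsCarrier.unit
  | r + 1 => h.prod ((IsCarrier.tr h r).prod (IsCarrier.tr h r))

theorem Pw.neg_mem_carrier [InvolutiveNeg A] [InvolutiveNeg Y] {C : Set Y → Set A}
    (hC : ∀ {s t}, (∀ y ∈ s, -y ∈ t) → ∀ {c}, c ∈ C s → -c ∈ C t) :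
    ∀ {n} {s t : Set (Pw Y n)}, (∀ y ∈ s, -y ∈ t) → ∀ {c}, c ∈ Pw.carrier C n s →
      -c ∈ Pw.carrier C n t
  | 0, _, _, _, _, _ => trivial
  | n + 1, s, t, h, (c, p), hc => by
    refine ⟨hC ?_ hc.1, neg_mem_carrier hC ?_ hc.2⟩
    · rintro _ ⟨y, hy, rfl⟩
      exact ⟨_, h y hy, rfl⟩
    · rintro _ ⟨y, hy, rfl⟩
      exact ⟨_, h y hy, rfl⟩

theorem Tr.ρ_mem_carrier [InvolutiveNeg A] [InvolutiveNeg Y] {C : Set Y → Set A}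
    (hC : ∀ {s t}, (∀ y ∈ s, -y ∈ t) → ∀ {c}, c ∈ C s → -c ∈ C t)
    (hC' : ∀ {s t}, s ⊆ t → C s ⊆ C t) :
    ∀ {r} (g : W r) {s t : Set (Tr Y r)}, (∀ y ∈ s, Tr.ρ r g y ∈ t) →
      ∀ {c}, c ∈ Tr.carrier C r s → Tr.ρ r g c ∈ Tr.carrier C r t
  | 0, _, _, _, _, _, _ => trivial
  | r + 1, g, s, t, h, (c, p, q), hc => by
    change Wr (W r) at g
    obtain ⟨a, b, rfl | rfl⟩ := Wr.cases g
    · rw [ρ_mk_one]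
      have h' : ∀ y : Y × Tr Y r × Tr Y r, y ∈ s → (y.1, ρ r a y.2.1, ρ r b y.2.2) ∈ t :=
        fun y hy => ρ_mk_one a b y.1 y.2.1 y.2.2 ▸ h y hy
      refine ⟨hC' ?_ hc.1, ρ_mem_carrier hC hC' a ?_ hc.2.1, ρ_mem_carrier hC hC' b ?_ hc.2.2⟩
      · rintro _ ⟨y, hy, rfl⟩
        exact ⟨_, h' y hy, rfl⟩
      · rintro _ ⟨_, ⟨y, hy, rfl⟩, rfl⟩
        exact ⟨_, ⟨_, h' y hy, rfl⟩, rfl⟩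
      · rintro _ ⟨_, ⟨y, hy, rfl⟩, rfl⟩
        exact ⟨_, ⟨_, h' y hy, rfl⟩, rfl⟩
    · rw [ρ_mk_neg_one]
      have h' : ∀ y : Y × Tr Y r × Tr Y r, y ∈ s → (-y.1, ρ r a y.2.2, ρ r b y.2.1) ∈ t :=
        fun y hy => ρ_mk_neg_one a b y.1 y.2.1 y.2.2 ▸ h y hy
      refine ⟨hC ?_ hc.1, ρ_mem_carrier hC hC' a ?_ hc.2.2, ρ_mem_carrier hC hC' b ?_ hc.2.1⟩
      · rintro _ ⟨y, hy, rfl⟩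
        exact ⟨_, h' y hy, rfl⟩
      · rintro _ ⟨_, ⟨y, hy, rfl⟩, rfl⟩
        exact ⟨_, ⟨_, h' y hy, rfl⟩, rfl⟩
      · rintro _ ⟨_, ⟨y, hy, rfl⟩, rfl⟩
        exact ⟨_, ⟨_, h' y hy, rfl⟩, rfl⟩

end Carrier

section TreeMap

variable {A B C D : Type} [CellComplex A] [CellComplex B] [CellComplex C] [CellComplex D]

/-- A linear map that is a chain map on a set of cells. -/
def IsChainMapOn (f : Chain A →ₗ[ZMod 2] Chain B) (S : Set A) : Prop :=
  ∀ b ∈ S, d (f (cell b)) = f (d (cell b)) ∧ ε (f (cell b)) = ε (cell b)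

theorem IsChainMapOn.of_isChainMap {f : Chain A →ₗ[ZMod 2] Chain B} (hf : IsChainMap f) (S : Set A) :
    IsChainMapOn f S := fun b _ => ⟨hf.d_map _, hf.ε_map _⟩

theorem IsChainMapOn.tmap {f : Chain A →ₗ[ZMod 2] Chain C} {g : Chain B →ₗ[ZMod 2] Chain D}
    {S : Set A} {T : Set B} (hf : IsChainMapOn f S) (hg : IsChainMapOn g T) :
    IsChainMapOn (tmap f g) (S ×ˢ T) := by
  rintro ⟨a, b⟩ ⟨ha, hb⟩
  rw [← cell_tens_cell, tmap_tens, d_tens, d_tens, map_add, tmap_tens, tmap_tens, ε_tens, ε_tens,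
    (hf a ha).1, (hg b hb).1, (hf a ha).2, (hg b hb).2]
  exact ⟨rfl, rfl⟩

theorem IsChainMapOn.comp {f : Chain A →ₗ[ZMod 2] Chain B} {g : Chain B →ₗ[ZMod 2] Chain C}
    {S : Set A} {T : Set B} (hg : IsChainMapOn g T) (hf : IsChainMapOn f S)
    (hST : ∀ b ∈ S, f (cell b) ∈ on T) : IsChainMapOn (g ∘ₗ f) S := by
  intro b hb
  have h1 : d (g (f (cell b))) = g (d (f (cell b))) :=
    eq_on (f := d ∘ₗ g) (g := g ∘ₗ d) (fun c hc => (hg c hc).1) (hST b hb)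
  have h2 : ε (g (f (cell b))) = ε (f (cell b)) :=
    eq_on (f := ε ∘ₗ g) (g := ε) (fun c hc => (hg c hc).2) (hST b hb)
  rw [LinearMap.comp_apply, LinearMap.comp_apply, h1, h2, (hf b hb).1, (hf b hb).2]
  exact ⟨rfl, rfl⟩

/-- The power of a linear map over the nodes of a tree. -/
noncomputable def Tr.map (f : Chain A →ₗ[ZMod 2] Chain B) :
    ∀ r, Chain (Tr A r) →ₗ[ZMod 2] Chain (Tr B r)
  | 0 => (LinearMap.id : Chain Unit →ₗ[ZMod 2] Chain Unit)
  | r + 1 => tmap f (tmap (Tr.map f r) (Tr.map f r))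

theorem Tr.map_isChainMapOn {f : Chain A →ₗ[ZMod 2] Chain B} {P : A → Prop}
    (hf : IsChainMapOn f {x | P x}) : ∀ r, IsChainMapOn (Tr.map f r) {t | Tr.All P r t}
  | 0 => fun _ _ => ⟨rfl, rfl⟩
  | r + 1 => hf.tmap ((map_isChainMapOn hf r).tmap (map_isChainMapOn hf r))

theorem tmap_mem_on {f : Chain A →ₗ[ZMod 2] Chain C} {g : Chain B →ₗ[ZMod 2] Chain D}
    {K : Set C} {L : Set D} (hf : ∀ a, f (cell a) ∈ on K) (hg : ∀ b, g (cell b) ∈ on L)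
    (x : A × B) : tmap f g (cell x) ∈ on (K ×ˢ L) := by
  rw [← Prod.mk.eta (p := x), ← cell_tens_cell, tmap_tens]
  exact tens_mem_on (hf _) (hg _)

theorem Tr.map_mem {f : Chain A →ₗ[ZMod 2] Chain B} {P : B → Prop}
    (hf : ∀ a, f (cell a) ∈ on {x | P x}) : ∀ r t, Tr.map f r (cell t) ∈ on {t | Tr.All P r t}
  | 0, _ => cell_mem_on trivial
  | r + 1, t => tmap_mem_on hf (tmap_mem_on (map_mem hf r) (map_mem hf r)) t

theorem Tr.map_act_ρ [InvolutiveNeg A] [InvolutiveNeg B] {f : Chain A →ₗ[ZMod 2] Chain B}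
    (hf : ∀ x, f (act Neg.neg x) = act Neg.neg (f x)) :
    ∀ r (g : W r) x, Tr.map f r (act (Tr.ρ r g) x) = act (Tr.ρ r g) (Tr.map f r x)
  | 0, _, x => (congrArg _ (act_id x)).trans (act_id x).symm
  | r + 1, g, x => by
    change Wr (W r) at g
    obtain ⟨a, b, rfl | rfl⟩ := Wr.cases g
    · rw [Tr.ρ_one_fun, Tr.ρ_one_fun]
      exact tmap_act (map_act_id f) (tmap_act (map_act_ρ hf r a) (map_act_ρ hf r b)) x
    · rw [Tr.ρ_neg_one_fun, Tr.ρ_neg_one_fun]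
      refine tmap_act hf (fun y => ?_) x
      rw [← act_act, tmap_act (map_act_ρ hf r a) (map_act_ρ hf r b), tmap_swap, act_act]

theorem Tr.map_act_neg [InvolutiveNeg A] [InvolutiveNeg B] {f : Chain A →ₗ[ZMod 2] Chain B}
    (hf : ∀ x, f (act Neg.neg x) = act Neg.neg (f x)) :
    ∀ r x, Tr.map f r (act Neg.neg x) = act Neg.neg (Tr.map f r x)
  | 0, x => (congrArg _ (act_id x)).trans (act_id x).symm
  | r + 1, x => tmap_act hf (tmap_act (map_act_neg hf r) (map_act_neg hf r)) x

theorem d_mem_prod {K : Set A} {L : Set B} {a : A} {b : B} (ha : a ∈ K) (hb : b ∈ L)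
    (hda : d (cell a) ∈ on K) (hdb : d (cell b) ∈ on L) : d (cell (a, b)) ∈ on (K ×ˢ L) := by
  rw [← cell_tens_cell, d_tens]
  exact add_mem (tens_mem_on hda (cell_mem_on hb)) (tens_mem_on (cell_mem_on ha) hdb)

theorem Tr.d_mem_all {P : A → Prop} (hP : ∀ x, P x → d (cell x) ∈ on {x | P x}) :
    ∀ r t, Tr.All P r t → d (cell t) ∈ on {t | Tr.All P r t}
  | 0, _, _ => zero_mem _
  | r + 1, (x, t, u), h => d_mem_prod (K := {x | P x})
      (L := {t : Tr A r | Tr.All P r t} ×ˢ {t : Tr A r | Tr.All P r t}) h.1 h.2 (hP x h.1)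
      (d_mem_prod (K := {t : Tr A r | Tr.All P r t}) h.2.1 h.2.2 (d_mem_all hP r t h.2.1)
        (d_mem_all hP r u h.2.2))

end TreeMap

section Source

variable {A B C D : Type} [CellComplex A] [InvolutiveNeg A] [SymmComplex A]
  [CellComplex B] [InvolutiveNeg B] [SymmComplex B] {r : ℕ}

theorem Tr.sourceAction_mem {S : Set A} {P : B → Prop} (hS : ∀ x ∈ S, -x ∈ S)
    (hP : ∀ x, P x → P (-x)) (g : ℤˣ × W r) :
    ∀ b ∈ S ×ˢ {t | Tr.All P r t}, (Tr.sourceAction A B r).ρ g b ∈ S ×ˢ {t | Tr.All P r t} := by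
  rintro ⟨x, t⟩ ⟨hx, ht⟩
  obtain ⟨s, g⟩ := g
  rcases Int.units_eq_one_or s with rfl | rfl
  · rw [sourceAction_one]
    exact ⟨hx, all_ρ hP r g t ht⟩
  · rw [sourceAction_neg_one]
    exact ⟨hS x hx, all_neg hP r _ (all_ρ hP r g t ht)⟩

theorem Tr.sourceAction_free {S : Set A} {P : B → Prop} (hS : ∀ x ∈ S, -x ≠ x)
    (hP : ∀ x, P x → -x ≠ x) (g : ℤˣ × W r) :
    ∀ b ∈ S ×ˢ {t | Tr.All P r t}, (Tr.sourceAction A B r).ρ g b = b → g = 1 := by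
  rintro ⟨x, t⟩ ⟨hx, ht⟩ e
  obtain ⟨s, g⟩ := g
  rcases Int.units_eq_one_or s with rfl | rfl
  · rw [sourceAction_one] at e
    rw [ρ_free hP r g t ht (congrArg Prod.snd e)]
    rfl
  · rw [sourceAction_neg_one] at e
    exact absurd (congrArg Prod.fst e) (hS x hx)

theorem Tr.equivariant_of [CellComplex C] [InvolutiveNeg C] [SymmComplex C]
    {f : Chain (A × Tr B r) →ₗ[ZMod 2] Chain (Tr C r)}
    (h1 : ∀ g x, f (act (Prod.map id (Tr.ρ r g)) x) = act (Tr.ρ r g) (f x))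
    (h2 : ∀ x, f (act (Prod.map Neg.neg Neg.neg) x) = f x) :
    CellAction.Equivariant (Tr.sourceAction A B r)
      ((Tr.action C r).comap (MonoidHom.snd ℤˣ (W r))) f := by
  rintro ⟨s, g⟩ x
  change _ = act (Tr.ρ r g) (f x)
  rcases Int.units_eq_one_or s with rfl | rfl
  · rw [show (Tr.sourceAction A B r).ρ (1, g) = Prod.map id (Tr.ρ r g) from
      funext fun (_, _) => Tr.sourceAction_one _ _ _, h1]
  · rw [show (Tr.sourceAction A B r).ρ (-1, g) =
        Prod.map Neg.neg Neg.neg ∘ Prod.map id (Tr.ρ r g) from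
      funext fun (_, _) => Tr.sourceAction_neg_one _ _ _, ← act_act, h2, h1]

theorem Tr.equivariant_tmap_map [CellComplex C] [InvolutiveNeg C] [SymmComplex C]
    [CellComplex D] [InvolutiveNeg D] [SymmComplex D]
    {f : Chain A →ₗ[ZMod 2] Chain C} {f' : Chain B →ₗ[ZMod 2] Chain D}
    (hf : ∀ x, f (act Neg.neg x) = act Neg.neg (f x))
    (hf' : ∀ x, f' (act Neg.neg x) = act Neg.neg (f' x)) :
    CellAction.Equivariant (Tr.sourceAction A B r) (Tr.sourceAction C D r)
      (tmap f (Tr.map f' r)) := by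
  rintro ⟨s, g⟩ x
  rcases Int.units_eq_one_or s with rfl | rfl
  · rw [show (Tr.sourceAction A B r).ρ (1, g) = Prod.map id (Tr.ρ r g) from
      funext fun (_, _) => Tr.sourceAction_one _ _ _,
      show (Tr.sourceAction C D r).ρ (1, g) = Prod.map id (Tr.ρ r g) from
      funext fun (_, _) => Tr.sourceAction_one _ _ _]
    exact tmap_act (map_act_id f) (Tr.map_act_ρ hf' r g) x
  · rw [show (Tr.sourceAction A B r).ρ (-1, g) = Prod.map Neg.neg (Neg.neg ∘ Tr.ρ r g) from
      funext fun (_, _) => Tr.sourceAction_neg_one _ _ _,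
      show (Tr.sourceAction C D r).ρ (-1, g) = Prod.map Neg.neg (Neg.neg ∘ Tr.ρ r g) from
      funext fun (_, _) => Tr.sourceAction_neg_one _ _ _]
    refine tmap_act hf (fun y => ?_) x
    rw [← act_act, Tr.map_act_neg hf', Tr.map_act_ρ hf', act_act]

end Source

section TestSpace

/-- The boundary of the cube `[-1, 1] ^ n`. -/
def cubeBdry (n : ℕ) : Set (Pw ℝ n) := Pw.bdry (Set.Icc (-1) 1) {-1, 1} n

/-- The product of the boundary of a cube with boundaries of cubes indexed by a tree. -/
def testSpace (a m r : ℕ) : Set (Pw ℝ a × Tr (Pw ℝ m) r) :=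
  cubeBdry a ×ˢ {t | Tr.All (· ∈ cubeBdry m) r t}

/-- The cells of the subdivision of the test space. -/
def gridCells (L a m r : ℕ) : Set (Pw Lin a × Tr (Pw Lin m) r) :=
  Pw.bdry (Lin.within L) (Lin.ends L) a ×ˢ
    {t | Tr.All (· ∈ Pw.bdry (Lin.within L) (Lin.ends L) m) r t}

/-- The realization of a cell in a product of a power and a tree of powers. -/
def gridPts (L a m r : ℕ) (b : Pw Lin a × Tr (Pw Lin m) r) : Set (Pw ℝ a × Tr (Pw ℝ m) r) :=
  Pw.pts (Lin.real L) a b.1 ×ˢ Tr.pts (Pw.pts (Lin.real L) m) r b.2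

variable {L a m r N : ℕ}

theorem isRealization_gridPts : IsRealization (gridPts L a m r) :=
  (Lin.isRealization_real.pw a).prod ((Lin.isRealization_real.pw m).tr r)

theorem gridPts_nonempty (b : Pw Lin a × Tr (Pw Lin m) r) : (gridPts L a m r b).Nonempty :=
  (Pw.pts_nonempty Lin.real_nonempty _ _).prod
    (Tr.pts_nonempty (Pw.pts_nonempty Lin.real_nonempty _) _ _)

theorem pts_subset_cubeBdry (hL : 0 < L) {n : ℕ} {p : Pw Lin n}
    (hp : p ∈ Pw.bdry (Lin.within L) (Lin.ends L) n) : Pw.pts (Lin.real L) n p ⊆ cubeBdry n :=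
  fun _ => Pw.mem_bdry_of_pts (fun _ h => Lin.real_subset_Icc hL h)
    (fun _ h => Lin.real_subset_ends hL h) hp

theorem gridPts_subset (hL : 0 < L) {b : Pw Lin a × Tr (Pw Lin m) r} (hb : b ∈ gridCells L a m r) :
    gridPts L a m r b ⊆ testSpace a m r := fun _ hy =>
  ⟨pts_subset_cubeBdry hL hb.1 hy.1,
    Tr.all_of_pts (fun _ _ h h' => pts_subset_cubeBdry hL h h') hb.2 hy.2⟩

theorem dist_le_of_mem_gridPts (b : Pw Lin a × Tr (Pw Lin m) r) :
    ∀ y ∈ gridPts L a m r b, ∀ y' ∈ gridPts L a m r b, dist y y' ≤ 1 / L := fun y hy y' hy' =>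
  max_le (Pw.dist_le_of_pts (by positivity) Lin.dist_le_of_mem_real _ _ hy.1 _ hy'.1)
    (Tr.dist_le_of_pts (by positivity)
      (Pw.dist_le_of_pts (by positivity) Lin.dist_le_of_mem_real) _ _ hy.2 _ hy'.2)

theorem isCompact_cubeBdry (n : ℕ) : IsCompact (cubeBdry n) :=
  Pw.isCompact_bdry isCompact_Icc (Set.toFinite _).isCompact n

theorem isCompact_testSpace : IsCompact (testSpace a m r) :=
  (isCompact_cubeBdry a).prod (Tr.isCompact_all (isCompact_cubeBdry m) r)

theorem neg_mem_cubeBdry {n : ℕ} {x : Pw ℝ n} : x ∈ cubeBdry n → -x ∈ cubeBdry n := by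
  refine Pw.neg_mem_bdry (fun x hx => ?_) fun x hx => ?_
  · exact ⟨by linarith [hx.2], by linarith [hx.1]⟩
  · rcases hx with rfl | rfl <;> simp

theorem neg_mem_gridBdry {n : ℕ} : ∀ x ∈ Pw.bdry (Lin.within L) (Lin.ends L) n,
    -x ∈ Pw.bdry (Lin.within L) (Lin.ends L) n := fun _ =>
  Pw.neg_mem_bdry (fun _ => Lin.neg_mem_within) (fun _ => Lin.neg_mem_ends)

theorem d_mem_gridBdry {n : ℕ} : ∀ x ∈ Pw.bdry (Lin.within L) (Lin.ends L) n,
    d (cell x) ∈ on (Pw.bdry (Lin.within L) (Lin.ends L) n) := fun _ =>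
  Pw.d_mem_bdry (fun _ => Lin.d_mem_within)
    (fun _ => Lin.d_ends)

theorem neg_ne_of_mem_gridBdry (hL : 0 < L) {n : ℕ} :
    ∀ x ∈ Pw.bdry (Lin.within L) (Lin.ends L) n, -x ≠ x := fun _ =>
  Pw.neg_ne_of_mem_bdry fun _ => Lin.neg_ne_of_mem_ends hL

/-- A map from the test space that is equivariant for the tree automorphisms and even. -/
structure IsTestMap (F : Pw ℝ a × Tr (Pw ℝ m) r → Tr (Pw ℝ N) r) : Prop where
  continuousOn : ContinuousOn F (testSpace a m r)
  tree : ∀ g, ∀ x ∈ testSpace a m r, F (x.1, Tr.ρ r g x.2) = Tr.ρ r g (F x)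
  even : ∀ x ∈ testSpace a m r, F (-x.1, -x.2) = F x

/-- The carrier of the cells of the target. -/
def targetCarrier (N r : ℕ) : Set (Tr (Pw ℝ N) r) → Set (Tr (Pw Ivl N) r) :=
  Tr.carrier (Pw.carrier Ivl.carrier N) r

theorem isCarrier_targetCarrier : IsCarrier (targetCarrier N r) (Tr.top (Pw.top Ivl.top N) r)
    (Tr.const (Pw.const 0 N) r) :=
  (Ivl.isCarrier.pw N).tr r

theorem ρ_mem_targetCarrier (g : W r) {s t : Set (Tr (Pw ℝ N) r)} (h : ∀ y ∈ s, Tr.ρ r g y ∈ t)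
    {c : Tr (Pw Ivl N) r} (hc : c ∈ targetCarrier N r s) : Tr.ρ r g c ∈ targetCarrier N r t :=
  Tr.ρ_mem_carrier (Pw.neg_mem_carrier Ivl.neg_mem_carrier) (Ivl.isCarrier.pw N).mono g h hc

theorem IsTestMap.exists_chainMap {F : Pw ℝ a × Tr (Pw ℝ m) r → Tr (Pw ℝ N) r}
    (hF : IsTestMap F) (hL : 0 < L) :
    ∃ f, CellAction.Equivariant (Tr.sourceAction (Pw Lin a) (Pw Lin m) r)
        ((Tr.action (Pw Ivl N) r).comap (MonoidHom.snd ℤˣ (W r))) f ∧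
      IsChainMapOn f (gridCells L a m r) ∧
      ∀ b ∈ gridCells L a m r, f (cell b) ∈ on (targetCarrier N r (F '' gridPts L a m r b)) := by
  have hC := isCarrier_targetCarrier (N := N) (r := r)
  obtain ⟨f, heq, hsol⟩ := CellAction.exists_equivariant
    (Tr.sourceAction (Pw Lin a) (Pw Lin m) r)
    ((Tr.action (Pw Ivl N) r).comap (MonoidHom.snd ℤˣ (W r))) (S := gridCells L a m r)
    (fun g => Tr.sourceAction_mem neg_mem_gridBdry neg_mem_gridBdry g)
    (fun g => Tr.sourceAction_free (neg_ne_of_mem_gridBdry hL) (neg_ne_of_mem_gridBdry hL) g)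
    (fun b hb => d_mem_prod hb.1 hb.2 (d_mem_gridBdry _ hb.1)
      (Tr.d_mem_all d_mem_gridBdry _ _ hb.2))
    (K := fun b => targetCarrier N r (F '' gridPts L a m r b))
    (K' := fun b => targetCarrier N r (F '' gridPts L a m r b))
    (fun g b hb y hy => by
      refine ρ_mem_targetCarrier g.2 ?_ hy
      rintro _ ⟨⟨u, t⟩, hx, rfl⟩
      have hxX := gridPts_subset hL hb hx
      obtain ⟨p, q⟩ := b
      obtain ⟨s, g⟩ := g
      have hq := Tr.ρ_mem_pts (Pw.neg_mem_pts (Lin.neg_mem_real (L := L))) g q t hx.2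
      rcases Int.units_eq_one_or s with rfl | rfl
      · rw [Tr.sourceAction_one]
        exact ⟨(u, Tr.ρ r g t), ⟨hx.1, hq⟩, hF.tree g _ hxX⟩
      · rw [Tr.sourceAction_neg_one]
        refine ⟨(-u, -Tr.ρ r g t), ⟨Pw.neg_mem_pts Lin.neg_mem_real _ _ hx.1,
          Tr.neg_mem_pts (Pw.neg_mem_pts Lin.neg_mem_real) _ _ hq⟩, ?_⟩
        refine (hF.even (u, Tr.ρ r g t) ?_).trans (hF.tree g _ hxX)
        refine ⟨hxX.1, Tr.all_ρ (P := (· ∈ cubeBdry m)) (fun _ => neg_mem_cubeBdry) r g t hxX.2⟩)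
    (fun b _ b' _ hb' => hC.mono (Set.image_mono (isRealization_gridPts b hb')))
    (θ := 0) (a := ε)
    (fun b _ z hz hdz hεz a => by
      obtain ⟨n, hn⟩ := exists_on_deg_lt z
      obtain ⟨w, hw, hw'⟩ := (hC.acyclic ((gridPts_nonempty b).image F)).solve (n := n)
        (Set.subset_inter hz hn) hdz hεz a
      exact ⟨w, on_mono Set.inter_subset_left hw, hw'⟩)
    (fun g x => by simp) (CellAction.ε_act _) (fun _ _ => by simp) (fun _ _ => by simp)
    (fun _ _ => ε_d _) (fun _ _ => zero_mem _)
  exact ⟨f, heq, fun b hb => ⟨by simpa using (hsol b hb).1, (hsol b hb).2.1⟩,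
    fun b hb => (hsol b hb).2.2⟩

theorem IsTestMap.exists_top_eq_zero {F : Pw ℝ a × Tr (Pw ℝ m) r → Tr (Pw ℝ N) r}
    (hF : IsTestMap F) (h0 : ∀ x ∈ testSpace a m r, F x ≠ Tr.const (Pw.const 0 N) r)
    (hd : ∀ y z : Tr (Pw ℝ N) r, dist y z = 0 → y = z) :
    ∃ L : ℕ, 0 < L ∧ ∀ b ∈ gridCells L a m r,
      ∀ x ∈ on (targetCarrier N r (F '' gridPts L a m r b)),
        Tr.top (Pw.top Ivl.top N) r x = 0 := by
  set z := Tr.const (Pw.const (0 : ℝ) N) r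
  obtain ⟨δ, hδ, hδF⟩ : ∃ δ > 0, ∀ x ∈ testSpace a m r, δ ≤ dist (F x) z := by
    rcases (testSpace a m r).eq_empty_or_nonempty with he | hne
    · exact ⟨1, one_pos, by simp [he]⟩
    · obtain ⟨x, hx, hmin⟩ := isCompact_testSpace.exists_isMinOn hne
        ((continuous_id.dist continuous_const).comp_continuousOn hF.continuousOn :
          ContinuousOn (fun x => dist (F x) z) _)
      exact ⟨dist (F x) z, lt_of_le_of_ne dist_nonneg fun h => h0 x hx (hd _ _ h.symm),
        fun y hy => hmin hy⟩
  obtain ⟨η, hη, hηF⟩ := Metric.uniformContinuousOn_iff.1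
    (isCompact_testSpace.uniformContinuousOn_of_continuous hF.continuousOn) δ hδ
  obtain ⟨n, hn⟩ := exists_nat_one_div_lt hη
  refine ⟨n + 1, n.succ_pos, fun b hb x hx => ?_⟩
  refine eq_on (f := Tr.top (Pw.top Ivl.top N) r) (g := 0) (fun c hc => ?_) hx
  rw [LinearMap.zero_apply]
  by_contra hne
  obtain ⟨y, hy⟩ := gridPts_nonempty (L := n + 1) b
  have hsub := gridPts_subset n.succ_pos hb
  refine absurd (isCarrier_targetCarrier.small hne hc hδ ?_ (F y) ⟨y, hy, rfl⟩)
    (not_lt.2 (hδF y (hsub hy)))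
  rintro _ ⟨u, hu, rfl⟩ _ ⟨v, hv, rfl⟩
  refine hηF u (hsub hu) v (hsub hv) ((dist_le_of_mem_gridPts b u hu v hv).trans_lt ?_)
  exact_mod_cast hn

theorem Pw.eq_of_dist_eq_zero : ∀ {n} (y z : Pw ℝ n), dist y z = 0 → y = z
  | 0, _, _, _ => rfl
  | n + 1, (x, p), (y, q), h => by
    have h' : max (dist x y) (dist p q) = 0 := h
    have h1 : dist x y = 0 := le_antisymm ((le_max_left _ _).trans_eq h') dist_nonneg
    have h2 : dist p q = 0 := le_antisymm ((le_max_right _ _).trans_eq h') dist_nonneg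
    rw [eq_of_dist_eq_zero p q h2, dist_eq_zero.1 h1]

theorem Tr.eq_of_dist_eq_zero : ∀ {r} (y z : Tr (Pw ℝ N) r), dist y z = 0 → y = z
  | 0, _, _, _ => rfl
  | r + 1, (x, p, p'), (y, q, q'), h => by
    have h' : max (dist x y) (max (dist p q) (dist p' q')) = 0 := h
    have h1 : dist x y = 0 := le_antisymm ((le_max_left _ _).trans_eq h') dist_nonneg
    have h3 : max (dist p q) (dist p' q') = 0 := le_antisymm ((le_max_right _ _).trans_eq h')
      ((dist_nonneg (x := p)).trans (le_max_left _ _))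
    have h2 : dist p q = 0 := le_antisymm ((le_max_left _ _).trans_eq h3) dist_nonneg
    have h4 : dist p' q' = 0 := le_antisymm ((le_max_right _ _).trans_eq h3) dist_nonneg
    rw [eq_of_dist_eq_zero p q h2, eq_of_dist_eq_zero p' q' h4, Pw.eq_of_dist_eq_zero x y h1]

/-- An equivariant map has a zero under a condition on binomial coefficients. -/
theorem IsTestMap.exists_zero {n e : ℕ} (hr : ∀ j ≤ r, Odd ((n + 2).choose (2 ^ j)))
    (he : e = 2 * (2 ^ r - 1)) {F : Pw ℝ (e + 1) × Tr (Pw ℝ (n + 1)) r → Tr (Pw ℝ (n + 2)) r}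
    (hF : IsTestMap F) :
    ∃ x ∈ testSpace (e + 1) (n + 1) r, F x = Tr.const (Pw.const 0 (n + 2)) r := by
  by_contra! h0
  obtain ⟨L, hL, hLF⟩ := hF.exists_top_eq_zero h0 Tr.eq_of_dist_eq_zero
  obtain ⟨f, heq, hf, hfC⟩ := hF.exists_chainMap hL
  obtain ⟨Φ, hΦ, hb⟩ := exists_isTreeMap n r hr
  rw [← he] at hb
  clear he hF h0
  let S : Set (Hemi × Tr Hemi r) := {b | b.i < e + 1} ×ˢ {t | Tr.All (fun b => b.i < n + 1) r t}
  let c : Chain (Hemi × Tr Hemi r) →ₗ[ZMod 2] Chain (Pw Lin (e + 1) × Tr (Pw Lin (n + 1)) r) :=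
    tmap (Hemi.cube L (e + 1)) (Tr.map (Hemi.cube L (n + 1)) r)
  have hcube : ∀ k x, Hemi.cube L k (act Neg.neg x) = act Neg.neg (Hemi.cube L k x) := fun k =>
    LinearMap.congr_fun (f := Hemi.cube L k ∘ₗ act Neg.neg) (g := act Neg.neg ∘ₗ Hemi.cube L k)
      (hom_ext fun b => by
        rw [LinearMap.comp_apply, LinearMap.comp_apply, act_cell, Hemi.cube_cell, Hemi.cube_cell,
          Hemi.cubeCell_neg])
  have hmem : ∀ k b, Hemi.cube L k (cell b) ∈ on (Pw.bdry (Lin.within L) (Lin.ends L) k) :=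
    fun k b => by rw [Hemi.cube_cell]; exact Hemi.cubeCell_mem L k b
  have hcubeOn : ∀ k, IsChainMapOn (Hemi.cube L k) {b | b.i < k} := fun k b hb => by
    rw [Hemi.cube_cell]
    exact ⟨Hemi.d_cubeCell L hb, Hemi.ε_cubeCell L hb⟩
  have hcS : IsChainMapOn c S := (hcubeOn (e + 1)).tmap (Tr.map_isChainMapOn (hcubeOn (n + 1)) r)
  have hcmem : ∀ b, c (cell b) ∈ on (gridCells L (e + 1) (n + 1) r) :=
    tmap_mem_on (hmem _) (Tr.map_mem (hmem _) r)
  have hceq : CellAction.Equivariant (Tr.sourceAction Hemi Hemi r) (Tr.sourceAction _ _ r) c :=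
    Tr.equivariant_tmap_map (hcube _) (hcube _)
  have hdeg : ∀ {k} (b : Hemi), b.i < k → d (cell b) ∈ on {b : Hemi | b.i < k} := fun b hb =>
    on_mono (fun b' hb' => lt_trans (show b'.i < b.i from hb') hb) (CellComplex.d_cell b)
  have hconst : ∀ r, Tr.All (fun b : Hemi => b.i < n + 1) r (Tr.const ⟨1, n⟩ r) := fun r => by
    induction r with
    | zero => trivial
    | succ r ih => exact ⟨n.lt_succ_self, ih, ih⟩
  have hxS : cell (⟨1, e⟩, Tr.const ⟨1, n⟩ r) ∈ on S := cell_mem_on ⟨e.lt_succ_self, hconst r⟩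
  let α := Tr.sourceAction Hemi Hemi r
  let β := (Tr.action (Pw Ivl (n + 2)) r).comap (MonoidHom.snd ℤˣ (W r))
  have hS : ∀ g, ∀ b ∈ S, α.ρ g b ∈ S :=
    fun g => Tr.sourceAction_mem (fun b hb => hb) (fun b hb => hb) g
  have free : ∀ g, ∀ b ∈ S, α.ρ g b = b → g = 1 :=
    fun g => Tr.sourceAction_free (fun b _ => b.neg_ne) (fun b _ => b.neg_ne) g
  have hdS : ∀ b ∈ S, d (cell b) ∈ on S :=
    fun b hb => d_mem_prod hb.1 hb.2 (hdeg _ hb.1) (Tr.d_mem_all (fun _ => hdeg _) _ _ hb.2)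
  have hac : IsAcyclicOn (Set.univ : Set (Tr (Pw Ivl (n + 2)) r)) :=
    Tr.isAcyclicOn (Pw.isAcyclicOn Ivl.isAcyclicOn _) r
  have hfc : CellAction.Equivariant α β (f ∘ₗ c) := heq.comp hceq
  have hΦe : CellAction.Equivariant α β Φ := Tr.equivariant_of hΦ.tree hΦ.neg
  have hfcS : IsChainMapOn (f ∘ₗ c) S := hf.comp hcS fun b _ => hcmem b
  have hΦS := IsChainMapOn.of_isChainMap hΦ.chain S
  have htop : ∀ g x, Tr.top (Pw.top Ivl.top (n + 2)) r (act (β.ρ g) x) =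
      Tr.top (Pw.top Ivl.top (n + 2)) r x :=
    fun g => Tr.top_act_ρ (Pw.top_act_neg Ivl.top_act_neg _) r g.2
  have htopd : ∀ x, Tr.top (Pw.top Ivl.top (n + 2)) r (d x) = 0 :=
    Tr.top_d (Pw.top_d Ivl.top_d _) r
  have key := CellAction.functional_eq α β hS free hdS hac hfc hΦe hfcS hΦS htop htopd hxS
    (fun ψ hψ => Tr.invariant_d_const n _ hψ)
  have h1 := hb ⟨1, e⟩ le_rfl
  rw [if_pos rfl, branch_apply, cell_tens_cell] at h1
  rw [h1] at key
  refine one_ne_zero (key.symm.trans ?_)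
  exact eq_on (f := Tr.top (Pw.top Ivl.top (n + 2)) r ∘ₗ f) (g := 0)
    (fun b hb => hLF b hb _ (hfC b hb)) (hcmem _)

end TestSpace

end CellularTopology

theorem odd_choose_two_pow_sub_one (ℓ : ℕ) : ∀ i, i < 2 ^ ℓ → Odd ((2 ^ ℓ - 1).choose i)
  | 0, _ => by simp
  | i + 1, h => by
    have ih := odd_choose_two_pow_sub_one ℓ i (by omega)
    have h2 : 2 ∣ (2 ^ ℓ).choose (i + 1) :=
      Nat.prime_two.dvd_choose_pow i.succ_ne_zero h.ne
    obtain ⟨k, hk⟩ : ∃ k, 2 ^ ℓ = k + 1 := ⟨2 ^ ℓ - 1, by omega⟩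
    rw [hk, Nat.add_sub_cancel] at ih ⊢
    rw [hk, Nat.choose_succ_succ] at h2
    rw [← Nat.not_even_iff_odd] at ih ⊢
    rw [← even_iff_two_dvd, Nat.even_add] at h2
    rwa [← h2]

section Leaves

variable {A V : Type} [NormedAddCommGroup V] [InnerProductSpace ℝ V]

/-- The leaves of the tree with root `y` whose edges are given by the labels, with lengths
decreasing geometrically. -/
noncomputable def leaves (X : A → V) : ∀ r, V → ℝ → Tr A r → List V
  | 0, y, _, _ => [y]
  | r + 1, y, δ, (x, t, t') =>
    leaves X r (y + δ • X x) (δ / 3) t ++ leaves X r (y - δ • X x) (δ / 3) t'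

/-- The sum of the values of a function at the leaves. -/
noncomputable def leafSum (f : V → V) (X : A → V) (r : ℕ) (y : V) (δ : ℝ) (t : Tr A r) : V :=
  ((leaves X r y δ t).map f).sum

variable {X : A → V} {f : V → V}

theorem leafSum_succ (r : ℕ) (y : V) (δ : ℝ) (x : A) (t t' : Tr A r) :
    leafSum f X (r + 1) y δ (x, t, t') =
      leafSum f X r (y + δ • X x) (δ / 3) t + leafSum f X r (y - δ • X x) (δ / 3) t' := by
  simp only [leafSum, leaves, List.map_append, List.sum_append]

theorem length_leaves : ∀ r y δ (t : Tr A r), (leaves X r y δ t).length = 2 ^ r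
  | 0, _, _, _ => rfl
  | r + 1, y, δ, (x, t, t') => by
    rw [leaves, List.length_append, length_leaves, length_leaves, pow_succ, mul_two]

theorem leafSum_ρ [InvolutiveNeg A] (hX : ∀ x, X (-x) = -X x) : ∀ r (g : W r) y δ (t : Tr A r),
    leafSum f X r y δ (Tr.ρ r g t) = leafSum f X r y δ t
  | 0, _, _, _, _ => rfl
  | r + 1, g, y, δ, (x, t, t') => by
    change Wr (W r) at g
    obtain ⟨a, b, rfl | rfl⟩ := Wr.cases g
    · rw [Tr.ρ_mk_one, leafSum_succ, leafSum_succ, leafSum_ρ hX, leafSum_ρ hX]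
    · rw [Tr.ρ_mk_neg_one, leafSum_succ, leafSum_succ, leafSum_ρ hX, leafSum_ρ hX, hX, smul_neg,
        ← sub_eq_add_neg, sub_neg_eq_add, add_comm]

theorem leafSum_neg [InvolutiveNeg A] (hX : ∀ x, X (-x) = -X x) (hf : ∀ y, f (-y) = f y) : ∀ r y δ (t : Tr A r),
    leafSum f X r (-y) δ (-t) = leafSum f X r y δ t
  | 0, y, _, _ => by simp [leafSum, leaves, hf]
  | r + 1, y, δ, (x, t, t') => by
    refine (leafSum_succ r (-y) δ (-x) (-t) (-t')).trans ?_
    rw [leafSum_succ, hX, smul_neg, ← neg_add, leafSum_neg hX hf, sub_neg_eq_add,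
      ← leafSum_neg hX hf r (y - _), neg_sub', sub_neg_eq_add]

variable {p : Seminorm ℝ V}

theorem leaves_sub_le : ∀ {r y δ} {t : Tr A r}, 0 ≤ δ → Tr.All (fun x => p (X x) = 1) r t →
    ∀ z ∈ leaves X r y δ t, p (z - y) ≤ 3 / 2 * δ
  | 0, y, δ, _, hδ, _, z, hz => by
    rw [leaves, List.mem_singleton] at hz
    rw [hz, sub_self, map_zero]
    positivity
  | r + 1, y, δ, (x, t, t'), hδ, h, z, hz => by
    have hx : p (δ • X x) = δ := by rw [map_smul_eq_mul, h.1, Real.norm_of_nonneg hδ, mul_one]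
    rw [leaves, List.mem_append] at hz
    rcases hz with hz | hz
    · have := leaves_sub_le (by positivity) h.2.1 z hz
      have h2 := map_add_le_add p (z - (y + δ • X x)) (δ • X x)
      rw [show z - (y + δ • X x) + δ • X x = z - y by abel] at h2
      linarith
    · have := leaves_sub_le (by positivity) h.2.2 z hz
      have h2 := map_sub_le_add p (z - (y - δ • X x)) (δ • X x)
      rw [show z - (y - δ • X x) - δ • X x = z - y by abel] at h2
      linarith

theorem leaves_nodup : ∀ {r y δ} {t : Tr A r}, 0 < δ → Tr.All (fun x => p (X x) = 1) r t →
    (leaves X r y δ t).Nodup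
  | 0, _, _, _, _, _ => List.nodup_singleton _
  | r + 1, y, δ, (x, t, t'), hδ, h => by
    rw [leaves, List.nodup_append]
    refine ⟨leaves_nodup (by positivity) h.2.1, leaves_nodup (by positivity) h.2.2, ?_⟩
    rintro z hz _ hz' rfl
    have h1 := leaves_sub_le (by positivity) h.2.1 z hz
    have h2 := leaves_sub_le (by positivity) h.2.2 z hz'
    have h3 := map_sub_le_add p (z - (y - δ • X x)) (z - (y + δ • X x))
    rw [show z - (y - δ • X x) - (z - (y + δ • X x)) = (2 * δ) • X x by module, map_smul_eq_mul,
      h.1, Real.norm_of_nonneg (by positivity)] at h3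
    linarith

theorem inner_leaves {u : V} : ∀ {r y δ} {t : Tr A r}, Tr.All (fun x => ⟪X x, u⟫ = 0) r t →
    ∀ z ∈ leaves X r y δ t, ⟪z, u⟫ = ⟪y, u⟫
  | 0, y, δ, _, _, z, hz => by
    rw [leaves, List.mem_singleton] at hz
    rw [hz]
  | r + 1, y, δ, (x, t, t'), h, z, hz => by
    rw [leaves, List.mem_append] at hz
    rcases hz with hz | hz
    · rw [inner_leaves h.2.1 z hz, inner_add_left, inner_smul_left, h.1, mul_zero, add_zero]
    · rw [inner_leaves h.2.2 z hz, inner_sub_left, inner_smul_left, h.1, mul_zero, sub_zero]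

end Leaves

section NodeMap

variable {A V : Type} [NormedAddCommGroup V] [InnerProductSpace ℝ V] {N : ℕ}

/-- The tree whose labels compare the leaves on both sides of each node. -/
noncomputable def nodeMap (f : V → V) (X : A → V) (J : V → Pw ℝ N) (u : V) :
    ∀ r, V → ℝ → Tr A r → Tr (Pw ℝ (N + 1)) r
  | 0, _, _, _ => ()
  | r + 1, y, δ, (x, t, t') =>
    ((⟪X x, u⟫, J (leafSum f X r (y + δ • X x) (δ / 3) t -
        leafSum f X r (y - δ • X x) (δ / 3) t')),
      nodeMap f X J u r (y + δ • X x) (δ / 3) t, nodeMap f X J u r (y - δ • X x) (δ / 3) t')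

variable {X : A → V} {f : V → V} {J : V → Pw ℝ N}

theorem nodeMap_ρ [InvolutiveNeg A] (hX : ∀ x, X (-x) = -X x) (hJ : ∀ v, J (-v) = -J v) (u : V) :
    ∀ r (g : W r) y δ (t : Tr A r),
      nodeMap f X J u r y δ (Tr.ρ r g t) = Tr.ρ r g (nodeMap f X J u r y δ t)
  | 0, _, _, _, _ => rfl
  | r + 1, g, y, δ, (x, t, t') => by
    change Wr (W r) at g
    obtain ⟨a, b, rfl | rfl⟩ := Wr.cases g
    · rw [Tr.ρ_mk_one, nodeMap, leafSum_ρ hX, leafSum_ρ hX, nodeMap_ρ hX hJ, nodeMap_ρ hX hJ]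
      rfl
    · rw [Tr.ρ_mk_neg_one, nodeMap, leafSum_ρ hX, leafSum_ρ hX, nodeMap_ρ hX hJ,
        nodeMap_ρ hX hJ, hX, smul_neg, ← sub_eq_add_neg, sub_neg_eq_add, inner_neg_left,
        ← neg_sub (leafSum _ _ _ _ _ _), hJ]
      rfl

theorem nodeMap_neg [InvolutiveNeg A] (hX : ∀ x, X (-x) = -X x) (hf : ∀ y, f (-y) = f y) (u : V) :
    ∀ r y δ (t : Tr A r), nodeMap f X J (-u) r (-y) δ (-t) = nodeMap f X J u r y δ t
  | 0, _, _, _ => rfl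
  | r + 1, y, δ, (x, t, t') => by
    have h1 : -y + δ • X (-x) = -(y + δ • X x) := by rw [hX]; module
    have h2 : -y - δ • X (-x) = -(y - δ • X x) := by rw [hX]; module
    have : nodeMap f X J (-u) (r + 1) (-y) δ (-x, -t, -t') =
        nodeMap f X J u (r + 1) y δ (x, t, t') := by
      rw [nodeMap, nodeMap, h1, h2, leafSum_neg hX hf, leafSum_neg hX hf, nodeMap_neg hX hf,
        nodeMap_neg hX hf, hX, inner_neg_neg]
    exact this

theorem eq_of_nodeMap_eq_const (hJ : ∀ v, J v = Pw.const 0 N → v = 0) (u : V) :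
    ∀ {r y δ} {t : Tr A r}, nodeMap f X J u r y δ t = Tr.const (Pw.const 0 (N + 1)) r →
      Tr.All (fun x => ⟪X x, u⟫ = 0) r t ∧ ∃ c, ∀ z ∈ leaves X r y δ t, f z = c
  | 0, y, δ, _, _ => ⟨trivial, f y, fun z hz => by rw [leaves, List.mem_singleton] at hz; rw [hz]⟩
  | r + 1, y, δ, (x, t, t'), h => by
    have h1 := congrArg Prod.fst h
    have hl := congrArg (fun q : Pw ℝ (N + 1) × Tr (Pw ℝ (N + 1)) r × Tr (Pw ℝ (N + 1)) r => q.2.1) h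
    have hr := congrArg (fun q : Pw ℝ (N + 1) × Tr (Pw ℝ (N + 1)) r × Tr (Pw ℝ (N + 1)) r => q.2.2) h
    obtain ⟨ha, c, hc⟩ := eq_of_nodeMap_eq_const hJ u hl
    obtain ⟨hb, c', hc'⟩ := eq_of_nodeMap_eq_const hJ u hr
    have hx : ⟪X x, u⟫ = 0 := congrArg (Prod.fst : ℝ × Pw ℝ N → ℝ) h1
    have hs := sub_eq_zero.1 (hJ _ (congrArg (Prod.snd : ℝ × Pw ℝ N → Pw ℝ N) h1))
    have key : ∀ {z δ} {t : Tr A r} {c}, (∀ a ∈ leaves X r z δ t, f a = c) →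
        leafSum f X r z δ t = 2 ^ r • c := fun {z δ t c} h => by
      rw [leafSum, List.map_congr_left h, List.map_const', List.sum_replicate, length_leaves]
    rw [key hc, key hc'] at hs
    have hcc : c = c' := by
      have h2 : ((2 : ℝ) ^ r) • c = ((2 : ℝ) ^ r) • c' := by
        exact_mod_cast hs
      exact smul_right_injective V (by positivity : (2 : ℝ) ^ r ≠ 0) h2
    refine ⟨⟨hx, ha, hb⟩, c, fun z hz => ?_⟩
    rw [leaves, List.mem_append] at hz
    exact hz.elim (hc z) fun hz => (hc' z hz).trans hcc.symm

end NodeMap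

section Continuity

variable {A V Z : Type} [PseudoMetricSpace A] [NormedAddCommGroup V]
  [InnerProductSpace ℝ V] [TopologicalSpace Z] {N : ℕ} {X : A → V} {f : V → V} {J : V → Pw ℝ N}
  {p : Seminorm ℝ V} {s : Set Z}

theorem lt_seminorm_child {x y : V} {δ : ℝ} (hδ : 0 ≤ δ) (hx : p x = 1) (hy : 3 / 2 * δ < p y) :
    3 / 2 * (δ / 3) < p (y + δ • x) ∧ 3 / 2 * (δ / 3) < p (y - δ • x) := by
  have h1 : p (δ • x) = δ := by rw [map_smul_eq_mul, hx, Real.norm_of_nonneg hδ, mul_one]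
  have h2 := map_sub_le_add p (y + δ • x) (δ • x)
  have h3 := map_add_le_add p (y - δ • x) (δ • x)
  rw [add_sub_cancel_right] at h2
  rw [sub_add_cancel] at h3
  constructor <;> linarith

theorem continuousOn_leafSum (hX : Continuous X) (hf : ContinuousOn f {0}ᶜ) :
    ∀ {r} {δ : ℝ} {y : Z → V} {t : Z → Tr A r}, 0 ≤ δ → ContinuousOn y s → ContinuousOn t s →
      (∀ z ∈ s, Tr.All (fun x => p (X x) = 1) r (t z)) → (∀ z ∈ s, 3 / 2 * δ < p (y z)) →
      ContinuousOn (fun z => leafSum f X r (y z) δ (t z)) s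
  | 0, δ, y, t, hδ, hy, _, _, hp => by
    simp only [leafSum, leaves, List.map_singleton, List.sum_singleton]
    refine hf.comp hy fun z hz h0 => ?_
    have := hp z hz
    rw [Set.mem_singleton_iff.1 h0, map_zero] at this
    linarith
  | r + 1, δ, y, t, hδ, hy, ht, hl, hp => by
    have hx : ContinuousOn (fun z => X (t z).1) s :=
      hX.comp_continuousOn (continuous_fst.comp_continuousOn ht)
    have ht1 : ContinuousOn (fun z => (t z).2.1) s :=
      continuous_fst.comp_continuousOn (continuous_snd.comp_continuousOn ht)
    have ht2 : ContinuousOn (fun z => (t z).2.2) s :=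
      continuous_snd.comp_continuousOn (continuous_snd.comp_continuousOn ht)
    have h3 : 0 ≤ δ / 3 := by positivity
    have h1 := continuousOn_leafSum hX hf h3 (hy.add (hx.const_smul δ)) ht1
      (fun z hz => (hl z hz).2.1) fun z hz => (lt_seminorm_child hδ (hl z hz).1 (hp z hz)).1
    have h2 := continuousOn_leafSum hX hf h3 (hy.sub (hx.const_smul δ)) ht2
      (fun z hz => (hl z hz).2.2) fun z hz => (lt_seminorm_child hδ (hl z hz).1 (hp z hz)).2
    exact (h1.add h2).congr fun z _ => leafSum_succ r (y z) δ (t z).1 (t z).2.1 (t z).2.2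

theorem continuousOn_nodeMap (hX : Continuous X) (hf : ContinuousOn f {0}ᶜ) (hJ : Continuous J)
    {u : Z → V} (hu : ContinuousOn u s) :
    ∀ {r} {δ : ℝ} {y : Z → V} {t : Z → Tr A r}, 0 ≤ δ → ContinuousOn y s → ContinuousOn t s →
      (∀ z ∈ s, Tr.All (fun x => p (X x) = 1) r (t z)) → (∀ z ∈ s, 3 / 2 * δ < p (y z)) →
      ContinuousOn (fun z => nodeMap f X J (u z) r (y z) δ (t z)) s
  | 0, _, _, _, _, _, _, _, _ => continuousOn_const
  | r + 1, δ, y, t, hδ, hy, ht, hl, hp => by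
    have hx : ContinuousOn (fun z => X (t z).1) s :=
      hX.comp_continuousOn (continuous_fst.comp_continuousOn ht)
    have ht1 : ContinuousOn (fun z => (t z).2.1) s :=
      continuous_fst.comp_continuousOn (continuous_snd.comp_continuousOn ht)
    have ht2 : ContinuousOn (fun z => (t z).2.2) s :=
      continuous_snd.comp_continuousOn (continuous_snd.comp_continuousOn ht)
    have h3 : 0 ≤ δ / 3 := by positivity
    have hy1 := hy.add (hx.const_smul δ)
    have hy2 := hy.sub (hx.const_smul δ)
    have hl1 : ∀ z ∈ s, Tr.All (fun x => p (X x) = 1) r (t z).2.1 := fun z hz => (hl z hz).2.1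
    have hl2 : ∀ z ∈ s, Tr.All (fun x => p (X x) = 1) r (t z).2.2 := fun z hz => (hl z hz).2.2
    have hp1 := fun z hz => (lt_seminorm_child hδ (hl z hz).1 (hp z hz)).1
    have hp2 := fun z hz => (lt_seminorm_child hδ (hl z hz).1 (hp z hz)).2
    have h1 := continuousOn_leafSum hX hf h3 hy1 ht1 hl1 hp1
    have h2 := continuousOn_leafSum hX hf h3 hy2 ht2 hl2 hp2
    have g1 := continuousOn_nodeMap hX hf hJ hu h3 hy1 ht1 hl1 hp1
    have g2 := continuousOn_nodeMap hX hf hJ hu h3 hy2 ht2 hl2 hp2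
    exact ((hx.inner hu).prodMk (hJ.comp_continuousOn (h1.sub h2))).prodMk (g1.prodMk g2)

end Continuity

section Coordinates

/-- The coordinates of a point. -/
def Pw.get : ∀ n, Pw ℝ n → Fin n → ℝ
  | 0, _ => 0
  | n + 1, (x, q) => Fin.cons x (Pw.get n q)

/-- The point with given coordinates. -/
def Pw.ofFn : ∀ n, (Fin n → ℝ) → Pw ℝ n
  | 0, _ => ()
  | n + 1, v => (v 0, Pw.ofFn n (Fin.tail v))

theorem Pw.continuous_get : ∀ n, Continuous (Pw.get n)
  | 0 => continuous_const
  | n + 1 => by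
    refine continuous_pi (Fin.cases ?_ fun i => ?_)
    · exact (continuous_fst : Continuous (Prod.fst : ℝ × Pw ℝ n → ℝ))
    · exact (continuous_apply i).comp ((continuous_get n).comp
        (continuous_snd : Continuous (Prod.snd : ℝ × Pw ℝ n → Pw ℝ n)))

theorem Pw.continuous_ofFn : ∀ n, Continuous (Pw.ofFn n)
  | 0 => continuous_const
  | n + 1 => by
    have h : Continuous fun v : Fin (n + 1) → ℝ => Pw.ofFn n (Fin.tail v) :=
      (continuous_ofFn n).comp (continuous_pi fun i => continuous_apply i.succ)
    exact (continuous_apply (0 : Fin (n + 1))).prodMk h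

theorem Pw.get_neg : ∀ n q, Pw.get n (-q) = -Pw.get n q
  | 0, _ => (neg_zero).symm
  | n + 1, (x, q) => by
    change Fin.cons (-x) (Pw.get n (-q)) = -Fin.cons (α := fun _ => ℝ) x (Pw.get n q)
    rw [get_neg n q]
    funext i
    refine Fin.cases ?_ (fun i => ?_) i <;> simp

theorem Pw.ofFn_neg : ∀ n v, Pw.ofFn n (-v) = -Pw.ofFn n v
  | 0, _ => rfl
  | n + 1, v => Prod.ext rfl (ofFn_neg n (Fin.tail v))

theorem Pw.eq_zero_of_ofFn : ∀ {n v}, Pw.ofFn n v = Pw.const 0 n → v = 0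
  | 0, v, _ => Subsingleton.elim _ _
  | n + 1, v, h => by
    have h1 : v 0 = 0 := congrArg (Prod.fst : ℝ × Pw ℝ n → ℝ) h
    have h2 := eq_zero_of_ofFn (congrArg (Prod.snd : ℝ × Pw ℝ n → Pw ℝ n) h)
    funext i
    exact Fin.cases h1 (fun i => congrFun h2 i) i

theorem Pw.norm_get_le : ∀ {n q}, q ∈ Pw.all (Set.Icc (-1) 1) n → ‖Pw.get n q‖ ≤ 1
  | 0, _, _ => by rw [Pw.get, norm_zero]; exact zero_le_one
  | n + 1, (x, q), h => by
    rw [pi_norm_le_iff_of_nonneg zero_le_one]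
    exact Fin.cases (abs_le.2 h.1) fun i => (norm_le_pi_norm (Pw.get n q) i).trans (norm_get_le h.2)

theorem cubeBdry_norm_get : ∀ {n q}, q ∈ cubeBdry n → ‖Pw.get n q‖ = 1
  | 0, _, h => h.elim
  | n + 1, (x, q), h => by
    have hcons : ‖Pw.get (n + 1) (x, q)‖ = max ‖x‖ ‖Pw.get n q‖ := by
      refine le_antisymm ?_ (max_le ?_ ?_)
      · rw [pi_norm_le_iff_of_nonneg (le_max_of_le_left (norm_nonneg _))]
        exact Fin.cases (le_max_left _ _)
          fun i => (norm_le_pi_norm (Pw.get n q) i).trans (le_max_right _ _)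
      · exact norm_le_pi_norm (Pw.get (n + 1) (x, q)) 0
      · exact (pi_norm_le_iff_of_nonneg (norm_nonneg _)).2
          fun i => norm_le_pi_norm (Pw.get (n + 1) (x, q)) i.succ
    rw [hcons]
    rcases h with ⟨hx, hq⟩ | ⟨hx, hq⟩
    · rw [show ‖x‖ = 1 by rcases hx with rfl | rfl <;> simp]
      exact max_eq_left (Pw.norm_get_le hq)
    · rw [cubeBdry_norm_get hq]
      exact max_eq_right (abs_le.2 hx)

end Coordinates

section Coincidence

/-- The supremum norm on a Euclidean space. -/
noncomputable def supSeminorm (n : ℕ) : Seminorm ℝ (EuclideanSpace ℝ (Fin n)) :=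
  (normSeminorm ℝ (Fin n → ℝ)).comp (WithLp.linearEquiv 2 ℝ (Fin n → ℝ)).toLinearMap

theorem supSeminorm_apply {n : ℕ} (v : EuclideanSpace ℝ (Fin n)) :
    supSeminorm n v = ‖WithLp.ofLp v‖ := rfl

/-- Extension of a vector by zeros. -/
noncomputable def extendByZero (a n : ℕ) (v : Fin a → ℝ) : EuclideanSpace ℝ (Fin n) :=
  WithLp.toLp 2 fun i => if h : i.1 < a then v ⟨i, h⟩ else 0

variable {a n : ℕ}

theorem continuous_extendByZero : Continuous (extendByZero a n) := by
  refine (PiLp.continuous_toLp 2 _).comp (continuous_pi fun i => ?_)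
  by_cases h : i.1 < a
  · simpa only [dif_pos h] using continuous_apply _
  · simpa only [dif_neg h] using continuous_const

theorem extendByZero_neg (v : Fin a → ℝ) : extendByZero a n (-v) = -extendByZero a n v := by
  ext i
  change (if h : i.1 < a then (-v) ⟨i, h⟩ else 0) = -(if h : i.1 < a then v ⟨i, h⟩ else 0)
  split_ifs <;> simp

theorem supSeminorm_extendByZero (h : a ≤ n) (v : Fin a → ℝ) :
    supSeminorm n (extendByZero a n v) = ‖v‖ := by
  rw [supSeminorm_apply, extendByZero]
  refine le_antisymm ?_ ?_
  · refine (pi_norm_le_iff_of_nonneg (norm_nonneg _)).2 fun i => ?_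
    dsimp only
    split_ifs
    · exact norm_le_pi_norm v _
    · rw [norm_zero]; exact norm_nonneg _
  · refine (pi_norm_le_iff_of_nonneg (norm_nonneg _)).2 fun i => ?_
    have := norm_le_pi_norm (fun i : Fin n => if h : i.1 < a then v ⟨i, h⟩ else 0) (i.castLE h)
    simpa using this

/-- An even function on the nonzero vectors takes the same value at sufficiently many vectors in
different directions. -/
theorem exists_eq_of_even {n r : ℕ} (hr : ∀ j ≤ r, Odd ((n + 2).choose (2 ^ j)))
    (hn : 2 * (2 ^ r - 1) ≤ n)
    {f : EuclideanSpace ℝ (Fin (n + 1)) → EuclideanSpace ℝ (Fin (n + 1))}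
    (hf : ContinuousOn f {0}ᶜ) (heven : ∀ y, f (-y) = f y) :
    ∃ y : Fin (2 ^ r) → EuclideanSpace ℝ (Fin (n + 1)), (∀ i, y i ≠ 0) ∧
      (∀ i j (c : ℝ), y i = c • y j → i = j) ∧ ∀ i j, f (y i) = f (y j) := by
  obtain ⟨e, he⟩ : ∃ e, e = 2 * (2 ^ r - 1) := ⟨_, rfl⟩
  let X : Pw ℝ (n + 1) → EuclideanSpace ℝ (Fin (n + 1)) :=
    fun x => extendByZero (n + 1) (n + 1) (Pw.get (n + 1) x)
  let U : Pw ℝ (e + 1) → EuclideanSpace ℝ (Fin (n + 1)) :=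
    fun x => extendByZero (e + 1) (n + 1) (Pw.get (e + 1) x)
  let J : EuclideanSpace ℝ (Fin (n + 1)) → Pw ℝ (n + 1) := fun v => Pw.ofFn (n + 1) (WithLp.ofLp v)
  have hX : ∀ x, X (-x) = -X x := fun x => by
    simp only [X]; rw [Pw.get_neg, extendByZero_neg]
  have hU : ∀ x, U (-x) = -U x := fun x => by
    simp only [U]; rw [Pw.get_neg, extendByZero_neg]
  have hXc : Continuous X := continuous_extendByZero.comp (Pw.continuous_get _)
  have hUc : Continuous U := continuous_extendByZero.comp (Pw.continuous_get _)
  have hJ : ∀ v, J (-v) = -J v := fun v => Pw.ofFn_neg _ _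
  have hJc : Continuous J := (Pw.continuous_ofFn _).comp (PiLp.continuous_ofLp 2 _)
  have hJ0 : ∀ v, J v = Pw.const 0 (n + 1) → v = 0 := fun v h =>
    (WithLp.ofLp_eq_zero 2).1 (Pw.eq_zero_of_ofFn h)
  have hXp : ∀ x ∈ cubeBdry (n + 1), supSeminorm (n + 1) (X x) = 1 := fun x hx => by
    rw [supSeminorm_extendByZero le_rfl, cubeBdry_norm_get hx]
  have hUp : ∀ x ∈ cubeBdry (e + 1), supSeminorm (n + 1) (U x) = 1 := fun x hx => by
    rw [supSeminorm_extendByZero (by omega), cubeBdry_norm_get hx]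
  have hall : ∀ {r} {t : Tr (Pw ℝ (n + 1)) r}, Tr.All (· ∈ cubeBdry (n + 1)) r t →
      Tr.All (fun x => supSeminorm (n + 1) (X x) = 1) r t := by
    intro r
    induction r with
    | zero => exact fun h => h
    | succ r ih => exact fun {t} h => ⟨hXp _ h.1, ih h.2.1, ih h.2.2⟩
  let F : Pw ℝ (e + 1) × Tr (Pw ℝ (n + 1)) r → Tr (Pw ℝ (n + 2)) r :=
    fun x => nodeMap f X J (U x.1) r (U x.1) (1 / 3) x.2
  have hF : IsTestMap F := by
    refine ⟨?_, fun g x _ => nodeMap_ρ hX hJ _ r g _ _ _, fun x _ => ?_⟩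
    · have hu : ContinuousOn (fun x : Pw ℝ (e + 1) × Tr (Pw ℝ (n + 1)) r => U x.1)
          (testSpace (e + 1) (n + 1) r) := (hUc.comp continuous_fst).continuousOn
      exact continuousOn_nodeMap (p := supSeminorm (n + 1)) hXc hf hJc hu (by norm_num) hu
        continuousOn_snd (fun z hz => hall hz.2) fun z hz => by rw [hUp _ hz.1]; norm_num
    · change nodeMap f X J (U (-x.1)) r (U (-x.1)) (1 / 3) (-x.2) = _
      rw [hU]
      exact nodeMap_neg hX heven _ r _ _ _
  obtain ⟨⟨x, t⟩, ⟨hx, ht⟩, h0⟩ := hF.exists_zero hr he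
  obtain ⟨horth, c, hc⟩ := eq_of_nodeMap_eq_const hJ0 (U x) h0
  have hlen : (leaves X r (U x) (1 / 3) t).length = 2 ^ r := length_leaves _ _ _ _
  have hU0 : ⟪U x, U x⟫ ≠ 0 := fun h => by
    have := hUp x hx
    rw [inner_self_eq_zero.1 h, map_zero] at this
    exact zero_ne_one this
  refine ⟨fun i => (leaves X r (U x) (1 / 3) t).get (i.cast hlen.symm), fun i h => ?_,
    fun i j k h => ?_, fun i j => ?_⟩
  · beta_reduce at h
    have := inner_leaves horth _ (List.get_mem (leaves X r (U x) (1 / 3) t) (i.cast hlen.symm))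
    rw [h, inner_zero_left] at this
    exact hU0 this.symm
  · beta_reduce at h
    have hi := inner_leaves horth _ (List.get_mem (leaves X r (U x) (1 / 3) t) (i.cast hlen.symm))
    have hj := inner_leaves horth _ (List.get_mem (leaves X r (U x) (1 / 3) t) (j.cast hlen.symm))
    have hk : k = 1 := by
      rw [h, real_inner_smul_left, hj] at hi
      exact mul_right_cancel₀ hU0 (hi.trans (one_mul _).symm)
    rw [hk, one_smul] at h
    have := (leaves_nodup (by norm_num) (hall ht)).injective_get h
    exact Fin.cast_injective hlen.symm this
  · rw [hc _ (List.get_mem _ _), hc _ (List.get_mem _ _)]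

end Coincidence

section Barycenter

open Filter Topology

variable {V W : Type*} [NormedAddCommGroup V] [InnerProductSpace ℝ V] [NormedAddCommGroup W]
  [NormedSpace ℝ W]

/-- A reflection that maps the orthogonal complement of `a` to that of `b`. -/
noncomputable def turn (a b : V) : V ≃ₗᵢ[ℝ] V := (ℝ ∙ (‖a‖ • b + ‖b‖ • a))ᗮ.reflection

theorem turn_smul (a b : V) : turn a b (‖a‖ • b) = -(‖b‖ • a) := by
  have := Submodule.reflection_sub (F := V) (v := ‖a‖ • b) (w := -(‖b‖ • a)) (by
    rw [norm_neg, norm_smul, norm_smul, norm_norm, norm_norm, mul_comm])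
  rwa [sub_neg_eq_add] at this

theorem inner_turn (a b x : V) : ‖a‖ * ⟪turn a b x, b⟫ = -(‖b‖ * ⟪x, a⟫) := by
  rw [← real_inner_smul_right, ← real_inner_smul_right, ← inner_neg_right, ← turn_smul]
  nth_rw 1 [← Submodule.reflection_reflection (ℝ ∙ (‖a‖ • b + ‖b‖ • a))ᗮ (‖a‖ • b)]
  exact LinearIsometryEquiv.inner_map_map (turn a b) _ _

theorem turn_apply (a b x : V) : turn a b x =
    x - (2 * (⟪‖a‖ • b + ‖b‖ • a, x⟫ / ‖‖a‖ • b + ‖b‖ • a‖ ^ 2)) • (‖a‖ • b + ‖b‖ • a) := by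
  rw [turn, Submodule.reflection_orthogonal_apply, Submodule.reflection_singleton_apply]
  simp only [RCLike.ofReal_real_eq_id, id]
  module

theorem tendsto_turn {a x : V} (ha : a ≠ 0) (hx : ⟪x, a⟫ = 0) :
    Tendsto (fun b => turn a b x) (𝓝 a) (𝓝 x) := by
  have h0 : ‖‖a‖ • a + ‖a‖ • a‖ ^ 2 ≠ 0 := by
    rw [← two_smul ℝ, smul_smul]
    exact pow_ne_zero 2 (norm_ne_zero_iff.2 (smul_ne_zero
      (mul_ne_zero two_ne_zero (norm_ne_zero_iff.2 ha)) ha))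
  have hc : ContinuousAt (fun b => x - (2 * (⟪‖a‖ • b + ‖b‖ • a, x⟫ / ‖‖a‖ • b + ‖b‖ • a‖ ^ 2)) •
      (‖a‖ • b + ‖b‖ • a)) a := by
    fun_prop (disch := exact h0)
  have hin : ⟪‖a‖ • a + ‖a‖ • a, x⟫ = 0 := by
    rw [inner_add_left, real_inner_smul_left, real_inner_comm, hx, mul_zero, add_zero]
  have h1 := hc.tendsto
  rw [hin, zero_div, mul_zero, zero_smul, sub_zero] at h1
  exact h1.congr fun b => (turn_apply a b x).symm

/-- The isometric embedding of the orthogonal complement of `a` onto that of `b`. -/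
noncomputable def turnEmb (a b : V) (x : (ℝ ∙ a)ᗮ) : V := turn a b x

theorem isometry_turnEmb (a b : V) : Isometry (turnEmb a b) :=
  (turn a b).isometry.comp isometry_subtype_coe

theorem range_turnEmb {a b : V} (ha : a ≠ 0) (hb : b ≠ 0) :
    Set.range (turnEmb a b) = {x | ⟪x, b⟫ = 0} := by
  have ha' := norm_ne_zero_iff.2 ha
  have hb' := norm_ne_zero_iff.2 hb
  ext x
  constructor
  · rintro ⟨x, rfl⟩
    have h1 := inner_turn a b x
    rw [Submodule.mem_orthogonal_singleton_iff_inner_left.1 x.2, mul_zero, neg_zero] at h1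
    exact (mul_eq_zero.1 h1).resolve_left ha'
  · intro hx
    obtain ⟨z, rfl⟩ := (turn a b).surjective x
    have h1 := inner_turn a b z
    rw [show ⟪turn a b z, b⟫ = 0 from hx, mul_zero, zero_eq_neg] at h1
    exact ⟨⟨z, Submodule.mem_orthogonal_singleton_iff_inner_left.2
      ((mul_eq_zero.1 h1).resolve_left hb')⟩, rfl⟩

theorem tendsto_turnEmb {a : V} (ha : a ≠ 0) (x : (ℝ ∙ a)ᗮ) :
    Tendsto (fun b => turnEmb a b x) (𝓝 a) (𝓝 (x : V)) :=
  tendsto_turn ha (Submodule.mem_orthogonal_singleton_iff_inner_left.1 x.2)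

theorem Convex.subset_frontier_preimage_interior {K : Set V} (hK : Convex ℝ K) (h0 : 0 ∈ interior K)
    (S : Submodule ℝ V) :
    ((↑) : S → V) ⁻¹' frontier K ⊆ frontier (((↑) : S → V) ⁻¹' interior K) := by
  intro x hx
  have hopen : IsOpen (((↑) : S → V) ⁻¹' interior K) :=
    isOpen_interior.preimage continuous_subtype_val
  rw [hopen.frontier_eq]
  refine ⟨?_, hx.2⟩
  have ht : Tendsto (fun t : ℝ => t • x) (𝓝[<] 1) (𝓝 x) := by
    have : Tendsto (fun t : ℝ => t • x) (𝓝 1) (𝓝 ((1 : ℝ) • x)) :=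
      (continuous_id.smul continuous_const).tendsto 1
    rw [one_smul] at this
    exact this.mono_left nhdsWithin_le_nhds
  refine mem_closure_of_tendsto ht ?_
  filter_upwards [Ioo_mem_nhdsLT (zero_lt_one' ℝ)] with t ht
  have := hK.combo_interior_closure_mem_interior h0 hx.1 (sub_pos.2 ht.2) ht.1.le (by ring)
  rwa [smul_zero, zero_add] at this

theorem Convex.measure_preimage_frontier {K : Set V} (hK : Convex ℝ K) (h0 : 0 ∈ interior K)
    (S : Submodule ℝ V) [FiniteDimensional ℝ S] [MeasurableSpace S] [BorelSpace S] (μ : Measure S)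
    [μ.IsAddHaarMeasure] : μ (((↑) : S → V) ⁻¹' frontier K) = 0 :=
  measure_mono_null (hK.subset_frontier_preimage_interior h0 S)
    ((hK.interior.linear_preimage S.subtype).addHaar_frontier μ)

/-- Integrals over the hyperplane sections of a convex body depend continuously on the normal. -/
theorem tendsto_integral_turnEmb [FiniteDimensional ℝ V] [MeasurableSpace V] [BorelSpace V]
    {K : Set V} (hK : IsCompact K) (hconv : Convex ℝ K) (h0 : 0 ∈ interior K) {a : V} (ha : a ≠ 0)
    (μ : Measure (ℝ ∙ a)ᗮ) [μ.IsAddHaarMeasure] {h : V → W} (hh : Continuous h) :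
    Tendsto (fun b => ∫ x in turnEmb a b ⁻¹' K, h (turnEmb a b x) ∂μ) (𝓝 a)
      (𝓝 (∫ x in ((↑) : (ℝ ∙ a)ᗮ → V) ⁻¹' K, h x ∂μ)) := by
  have hmeas : ∀ b, MeasurableSet (turnEmb a b ⁻¹' K) := fun b =>
    (hK.isClosed.preimage (isometry_turnEmb a b).continuous).measurableSet
  have hmeas0 : MeasurableSet (((↑) : (ℝ ∙ a)ᗮ → V) ⁻¹' K) :=
    (hK.isClosed.preimage continuous_subtype_val).measurableSet
  obtain ⟨R, hR⟩ := hK.isBounded.exists_norm_le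
  obtain ⟨C, hC⟩ := hK.exists_bound_of_continuousOn hh.continuousOn
  have hind : ∀ b, ∫ x in turnEmb a b ⁻¹' K, h (turnEmb a b x) ∂μ =
      ∫ x, K.indicator h (turnEmb a b x) ∂μ := fun b => by
    rw [← integral_indicator (hmeas b)]; rfl
  have hind0 : ∫ x in ((↑) : (ℝ ∙ a)ᗮ → V) ⁻¹' K, h x ∂μ = ∫ x, K.indicator h (x : V) ∂μ := by
    rw [← integral_indicator hmeas0]; rfl
  rw [hind0]
  simp only [hind]
  refine tendsto_integral_filter_of_dominated_convergence
    ((Metric.closedBall (0 : (ℝ ∙ a)ᗮ) R).indicator fun _ => C) (.of_forall fun b => ?_)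
    (.of_forall fun b => .of_forall fun x => ?_) ?_ ?_
  · have : (fun x => K.indicator h (turnEmb a b x)) =
        (turnEmb a b ⁻¹' K).indicator fun x => h (turnEmb a b x) := rfl
    rw [this]
    exact ((hh.comp (isometry_turnEmb a b).continuous).stronglyMeasurable.indicator
      (hmeas b)).aestronglyMeasurable
  · by_cases hx : turnEmb a b x ∈ K
    · have hn : ‖turnEmb a b x‖ = ‖x‖ := (turn a b).norm_map x
      rw [Set.indicator_of_mem hx, Set.indicator_of_mem
        (mem_closedBall_zero_iff.2 (hn ▸ hR _ hx))]
      exact hC _ hx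
    · rw [Set.indicator_of_notMem hx, norm_zero]
      exact Set.indicator_nonneg (fun _ _ => (norm_nonneg _).trans (hC 0 (interior_subset h0))) _
  · exact (integrable_indicator_iff measurableSet_closedBall).2
      (integrableOn_const (isCompact_closedBall _ _).measure_lt_top.ne)
  · filter_upwards [compl_mem_ae_iff.2 (hconv.measure_preimage_frontier h0 _ μ)] with x hx
    have hx' : (x : V) ∉ frontier K := hx
    have ht := tendsto_turnEmb ha x
    refine Tendsto.comp (?_ : ContinuousAt (K.indicator h) (x : V)) ht
    by_cases hxi : (x : V) ∈ interior K
    · refine hh.continuousAt.congr ?_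
      filter_upwards [isOpen_interior.mem_nhds hxi] with z hz
      rw [Set.indicator_of_mem (interior_subset hz)]
    · have hxK : (x : V) ∉ K := fun hxK => hx' ⟨subset_closure hxK, hxi⟩
      refine continuousAt_const.congr (f := fun _ => 0) ?_
      filter_upwards [hK.isClosed.isOpen_compl.mem_nhds hxK] with z hz
      rw [Set.indicator_of_notMem hz]

theorem centerOfMass_range {m : ℕ} {F : Type*} [EMetricSpace F] [MeasurableSpace F] [BorelSpace F]
    {K : Set (EuclideanSpace ℝ (Fin m))} (hK : MeasurableSet K)
    {j : F → EuclideanSpace ℝ (Fin m)} (hj : Isometry j)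
    (hd : 0 ≤ (m : ℝ) - 1) :
    centerOfMass m K (Set.range j) = (μH[(m : ℝ) - 1] (j ⁻¹' K)).toReal⁻¹ •
      ∫ x in j ⁻¹' K, j x ∂μH[(m : ℝ) - 1] := by
  have hmap := hj.map_hausdorffMeasure (d := (m : ℝ) - 1) (.inl hd)
  rw [centerOfMass, hj.hausdorffMeasure_preimage (.inl hd), ← Measure.restrict_restrict hK, ← hmap,
    setIntegral_map (f := fun x => x) hK measurable_id.aestronglyMeasurable
      hj.continuous.aemeasurable]

theorem continuousOn_centerOfMass {n : ℕ} {K : Set (EuclideanSpace ℝ (Fin (n + 1)))}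
    (hK : IsCompact K) (hconv : Convex ℝ K) (h0 : 0 ∈ interior K) :
    ContinuousOn (fun b => centerOfMass (n + 1) K {x | ⟪x, b⟫ = 0}) {0}ᶜ := by
  intro a ha
  refine ContinuousAt.continuousWithinAt ?_
  have hd : ((n + 1 : ℕ) : ℝ) - 1 = n := by push_cast; ring
  have hd0 : 0 ≤ ((n + 1 : ℕ) : ℝ) - 1 := by rw [hd]; positivity
  have hfin : Module.finrank ℝ (ℝ ∙ a)ᗮ = n := by
    have : Fact (Module.finrank ℝ (EuclideanSpace ℝ (Fin (n + 1))) = n + 1) := ⟨by simp⟩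
    exact Submodule.finrank_orthogonal_span_singleton ha
  let μ : Measure (ℝ ∙ a)ᗮ := μH[((n + 1 : ℕ) : ℝ) - 1]
  have : μ.IsAddHaarMeasure := by
    have := isAddHaarMeasure_hausdorffMeasure (E := (ℝ ∙ a)ᗮ)
    rw [hfin, ← hd] at this
    exact this
  have hrange0 : Set.range ((↑) : (ℝ ∙ a)ᗮ → EuclideanSpace ℝ (Fin (n + 1))) =
      {x | ⟪x, a⟫ = 0} := by
    rw [Subtype.range_coe]
    ext x
    exact Submodule.mem_orthogonal_singleton_iff_inner_left
  have hreal : ∀ s : Set (ℝ ∙ a)ᗮ, (μ s).toReal = ∫ _ in s, (1 : ℝ) ∂μ := fun s => by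
    simp [Measure.real]
  have hvol := tendsto_integral_turnEmb hK hconv h0 ha μ (continuous_const (y := (1 : ℝ)))
  have hmom := tendsto_integral_turnEmb hK hconv h0 ha μ continuous_id
  have hpos : (∫ _ in ((↑) : (ℝ ∙ a)ᗮ → EuclideanSpace ℝ (Fin (n + 1))) ⁻¹' K, (1 : ℝ) ∂μ) ≠ 0 := by
    rw [← hreal]
    refine ENNReal.toReal_ne_zero.2 ⟨fun h => ?_, ?_⟩
    · have hopen : IsOpen (((↑) : (ℝ ∙ a)ᗮ → EuclideanSpace ℝ (Fin (n + 1))) ⁻¹' interior K) :=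
        isOpen_interior.preimage continuous_subtype_val
      exact hopen.measure_ne_zero μ ⟨0, h0⟩
        (measure_mono_null (Set.preimage_mono interior_subset) h)
    · exact ((Submodule.isClosed_orthogonal _).isClosedEmbedding_subtypeVal.isCompact_preimage
        hK).measure_lt_top.ne
  have key := (hvol.inv₀ hpos).smul hmom
  have hval : centerOfMass (n + 1) K {x | ⟪x, a⟫ = 0} =
      (μ (((↑) : (ℝ ∙ a)ᗮ → EuclideanSpace ℝ (Fin (n + 1))) ⁻¹' K)).toReal⁻¹ •
        ∫ x in ((↑) : (ℝ ∙ a)ᗮ → EuclideanSpace ℝ (Fin (n + 1))) ⁻¹' K, (x : EuclideanSpace ℝ _) ∂μ := by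
    rw [← hrange0]
    exact centerOfMass_range hK.measurableSet isometry_subtype_coe hd0
  rw [ContinuousAt, hval, hreal]
  refine key.congr' ?_
  filter_upwards [isOpen_compl_singleton.mem_nhds ha] with b hb
  rw [← range_turnEmb ha hb, centerOfMass_range hK.measurableSet (isometry_turnEmb a b) hd0]
  change _ = (μ _).toReal⁻¹ • _
  rw [hreal]
  rfl

end Barycenter

theorem exists_smul_eq_of_hyperplane_eq {V : Type*} [NormedAddCommGroup V] [InnerProductSpace ℝ V]
    {a b : V} (h : {x : V | ⟪x, a⟫ = 0} = {x | ⟪x, b⟫ = 0}) : ∃ c : ℝ, a = c • b := by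
  have hle : (ℝ ∙ b)ᗮ ≤ (ℝ ∙ a)ᗮ := fun x hx => by
    rw [Submodule.mem_orthogonal_singleton_iff_inner_left] at hx ⊢
    exact h.symm.subset hx
  have h2 := Submodule.orthogonal_le hle
  rw [Submodule.orthogonal_orthogonal, Submodule.orthogonal_orthogonal] at h2
  obtain ⟨c, hc⟩ := Submodule.mem_span_singleton.1 (h2 (Submodule.mem_span_singleton_self a))
  exact ⟨c, hc.symm⟩

theorem exists_hyperplanes {n r : ℕ} (hr : ∀ j ≤ r, Odd ((n + 2).choose (2 ^ j)))
    (hn : 2 * (2 ^ r - 1) ≤ n) {m : ℕ} (hm : m = n + 1) {K : Set (EuclideanSpace ℝ (Fin m))}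
    (hK : IsCompact K) (hconv : Convex ℝ K) (h0 : 0 ∈ interior K) :
    ∃ H : Fin (2 ^ r) → Set (EuclideanSpace ℝ (Fin m)), Function.Injective H ∧
      (∀ i, IsLinearHyperplane (H i)) ∧ ∀ i j, centerOfMass m K (H i) = centerOfMass m K (H j) := by
  subst hm
  obtain ⟨y, hy0, hy, heq⟩ := exists_eq_of_even hr hn (continuousOn_centerOfMass hK hconv h0)
    fun b => by simp only [inner_neg_right, neg_eq_zero]
  refine ⟨fun i => {x | ⟪x, y i⟫ = 0}, fun i j h => ?_, fun i => ⟨y i, hy0 i, rfl⟩, heq⟩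
  obtain ⟨c, hc⟩ := exists_smul_eq_of_hyperplane_eq h
  exact hy i j c hc

/-- For `m = 2^ℓ - 2` and `k = 2^(ℓ-2)`, every convex body `K ⊆ ℝ^m` with `0 ∈ int K`
admits `k` pairwise distinct linear hyperplanes whose centers of mass (of the
sections of `K`) coincide. -/
theorem exists_linear_hyperplanes_with_coinciding_barycenters
    (ℓ : ℕ) (hℓ : 3 ≤ ℓ) (K : Set (EuclideanSpace ℝ (Fin (2 ^ ℓ - 2))))
    (hKcomp : IsCompact K) (hKconv : Convex ℝ K)
    (hK0 : (0 : EuclideanSpace ℝ (Fin (2 ^ ℓ - 2))) ∈ interior K) :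
    ∃ H : Fin (2 ^ (ℓ - 2)) → Set (EuclideanSpace ℝ (Fin (2 ^ ℓ - 2))),
      Function.Injective H ∧
        (∀ i, IsLinearHyperplane (H i)) ∧
        ∀ i j, centerOfMass (2 ^ ℓ - 2) K (H i) = centerOfMass (2 ^ ℓ - 2) K (H j) := by
  have h4 : 2 ^ ℓ = 2 ^ (ℓ - 2) * 4 := by
    rw [show (4 : ℕ) = 2 ^ 2 by norm_num, ← pow_add, Nat.sub_add_cancel (by omega)]
  have h1 : 1 ≤ 2 ^ (ℓ - 2) := Nat.one_le_two_pow
  refine exists_hyperplanes (n := 2 ^ ℓ - 3) (fun j hj => ?_) (by omega) (by omega)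
    hKcomp hKconv hK0
  rw [show 2 ^ ℓ - 3 + 2 = 2 ^ ℓ - 1 by omega]
  exact odd_choose_two_pow_sub_one ℓ _ (Nat.pow_lt_pow_right (by norm_num) (by omega))
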